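/- For every a ∈ ℕ and every k ≥ 1 with k + 1 ≤ min{r,t}, the elements ω_{a,k+1} and ω̄_{a,k+1} of BC_{r,t} commute with y_{k+1}, with ȳ_{k+1}, and with c_l and c̄_l for every l ≥ k + 1. -/

import Mathlib

open Polynomial

noncomputable section

/-- Transposition `(a b)` (0-based indices) in the symmetric group on `Fin n`;
it is `1` if an index is out of range. -/
def sw (n a b : ℕ) : Equiv.Perm (Fin n) :=
  if h : a < n ∧ b < n then Equiv.swap ⟨a, h.1⟩ ⟨b, h.2⟩ else 1

/-- The permutation word `s_{i,j}` of the paper (1-based indices):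
`s_{i,j} = s_i s_{i+1,j}` for `i < j`, `s_{i,i} = 1`, `s_{i,j} = s_{i,j+1} s_j` for `i > j`. -/
def sIJ (n i j : ℕ) : Equiv.Perm (Fin n) :=
  if i < j then ((List.range' i (j - i)).map (fun k => sw n (k - 1) k)).prod
  else ((List.range' j (i - j)).reverse.map (fun k => sw n (k - 1) k)).prod

/-- The coefficients `a_{2n+1,j}` of the paper: `acoef ω n j = a_{2n+1,j}`, defined by the
recursion `a_{1,0} = -1`, `a_{2n+1,j+1} = a_{2n-1,j}` and
`a_{2n+1,0} = ∑_{j=0}^{n-1} a_{2n-1,j} ω_{2j+1}`. -/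
def acoef {A : Type} [Ring A] (ω : ℕ → A) : ℕ → ℕ → A
  | 0, _ => -1
  | n + 1, 0 => ∑ j ∈ Finset.range (n + 1), acoef ω n j * ω (2 * j + 1)
  | n + 1, j + 1 => acoef ω n j

/-- The parameters `ω̄_k` determined by the parameters `ω` as in Corollary 3.5:
`ω̄_{2n} = 0` and `ω̄_{2n+1} = ∑_{j=0}^{n} a_{2n+1,j} ω_{2j+1}`. -/
def obar {R : Type} [CommRing R] (ω : ℕ → R) (k : ℕ) : R :=
  if k % 2 = 0 then 0
  else ∑ j ∈ Finset.range (k / 2 + 1), acoef ω (k / 2) j * ω (2 * j + 1)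

/-- Data for the presentation of the walled Brauer–Clifford superalgebra `BC_{r,t}`
(Definition 2.1 together with relations (2.1)–(2.3)) on an `R`-algebra `A`.
The images of the two symmetric groups are recorded as monoid homomorphisms, so the
symmetric group relations among the `s_i` (resp. `s̄_j`) hold automatically. -/
structure WBC (R A : Type) [CommRing R] [Ring A] [Algebra R A] (r t : ℕ) : Type where
  σ : Equiv.Perm (Fin r) →* A
  σb : Equiv.Perm (Fin t) →* A
  c : Fin r → A
  cb : Fin t → A
  e : A
  c_sq : ∀ i, c i * c i = -1
  c_anti : ∀ i j, i ≠ j → c i * c j = -(c j * c i)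
  c_conj : ∀ w i, σ w * c i * σ (w⁻¹) = c (w i)
  cb_sq : ∀ i, cb i * cb i = 1
  cb_anti : ∀ i j, i ≠ j → cb i * cb j = -(cb j * cb i)
  cb_conj : ∀ w i, σb w * cb i * σb (w⁻¹) = cb (w i)
  comm_σσb : ∀ w v, σ w * σb v = σb v * σ w
  comm_σcb : ∀ w j, σ w * cb j = cb j * σ w
  comm_σbc : ∀ v i, σb v * c i = c i * σb v
  anti_ccb : ∀ i j, c i * cb j = -(cb j * c i)
  e_c1 : ∀ (h1 : 0 < r) (h2 : 0 < t), e * c ⟨0, h1⟩ = e * cb ⟨0, h2⟩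
  c1_e : ∀ (h1 : 0 < r) (h2 : 0 < t), c ⟨0, h1⟩ * e = cb ⟨0, h2⟩ * e
  e_sq : e * e = 0
  e_s_e : 1 < r → e * σ (sw r 0 1) * e = e
  e_sb_e : 1 < t → e * σb (sw t 0 1) * e = e
  s_e_comm : ∀ i : ℕ, 0 < i → i + 1 < r → σ (sw r i (i + 1)) * e = e * σ (sw r i (i + 1))
  sb_e_comm : ∀ j : ℕ, 0 < j → j + 1 < t → σb (sw t j (j + 1)) * e = e * σb (sw t j (j + 1))
  braid1 : 1 < r → 1 < t →
    e * σ (sw r 0 1) * σb (sw t 0 1) * e * σ (sw r 0 1)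
      = e * σ (sw r 0 1) * σb (sw t 0 1) * e * σb (sw t 0 1)
  braid2 : 1 < r → 1 < t →
    σ (sw r 0 1) * e * σ (sw r 0 1) * σb (sw t 0 1) * e
      = σb (sw t 0 1) * e * σ (sw r 0 1) * σb (sw t 0 1) * e
  c_e_comm : ∀ i : Fin r, (i : ℕ) ≠ 0 → c i * e = e * c i
  cb_e_comm : ∀ j : Fin t, (j : ℕ) ≠ 0 → cb j * e = e * cb j
  e_c_e : ∀ h : 0 < r, e * c ⟨0, h⟩ * e = 0
  e_cb_e : ∀ h : 0 < t, e * cb ⟨0, h⟩ * e = 0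

namespace WBC

variable {R A : Type} [CommRing R] [Ring A] [Algebra R A] {r t : ℕ}

/-- The transposition `(i,j) ∈ Σ_r` (1-based indices). -/
def tr (d : WBC R A r t) (i j : ℕ) : A := d.σ (sw r (i - 1) (j - 1))

/-- The transposition `(ī,j̄) ∈ Σ_t` (1-based indices). -/
def trb (d : WBC R A r t) (i j : ℕ) : A := d.σb (sw t (i - 1) (j - 1))

/-- The generator `s_j = (j, j+1)` (1-based). -/
def s (d : WBC R A r t) (j : ℕ) : A := d.σ (sw r (j - 1) j)

/-- The generator `s̄_j` (1-based). -/
def sb (d : WBC R A r t) (j : ℕ) : A := d.σb (sw t (j - 1) j)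

/-- The generator `c_i` (1-based). -/
def cn (d : WBC R A r t) (i : ℕ) : A := if h : i - 1 < r then d.c ⟨i - 1, h⟩ else 0

/-- The generator `c̄_i` (1-based). -/
def cbn (d : WBC R A r t) (i : ℕ) : A := if h : i - 1 < t then d.cb ⟨i - 1, h⟩ else 0

/-- `e_{i,j} = (1̄,j̄)(1,i) e_1 (1,i)(1̄,j̄)` (1-based). -/
def E (d : WBC R A r t) (i j : ℕ) : A := d.trb 1 j * d.tr 1 i * d.e * d.tr 1 i * d.trb 1 j

/-- `ē_{i,j} = c_i e_{i,j} c_i`. -/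
def Eb (d : WBC R A r t) (i j : ℕ) : A := d.cn i * d.E i j * d.cn i

/-- `L'_i = ∑_{j=1}^{i-1} (j,i)`. -/
def LL (d : WBC R A r t) (i : ℕ) : A := ∑ j ∈ Finset.Ico 1 i, d.tr j i

/-- The Jucys–Murphy element `L_i = L'_i + c_i L'_i c_i`. -/
def L (d : WBC R A r t) (i : ℕ) : A := d.LL i + d.cn i * d.LL i * d.cn i

/-- `L̄'_i = ∑_{j=1}^{i-1} (j̄,ī)`. -/
def LLb (d : WBC R A r t) (i : ℕ) : A := ∑ j ∈ Finset.Ico 1 i, d.trb j i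

/-- The Jucys–Murphy element `L̄_i = L̄'_i - c̄_i L̄'_i c̄_i`. -/
def Lb (d : WBC R A r t) (i : ℕ) : A := d.LLb i - d.cbn i * d.LLb i * d.cbn i

/-- `y_i = ∑_{j=1}^{i-1} (e_{i,j} + ē_{i,j}) - L_i`. -/
def y (d : WBC R A r t) (i : ℕ) : A := (∑ j ∈ Finset.Ico 1 i, (d.E i j + d.Eb i j)) - d.L i

/-- `ȳ_i = ∑_{j=1}^{i-1} (e_{j,i} - ē_{j,i}) - L̄_i`. -/
def yb (d : WBC R A r t) (i : ℕ) : A := (∑ j ∈ Finset.Ico 1 i, (d.E j i - d.Eb j i)) - d.Lb i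

/-- `c^α = c_1^{α_1} ⋯ c_r^{α_r}`. -/
def cpow (d : WBC R A r t) (α : Fin r → Fin 2) : A :=
  ((List.finRange r).map (fun i => d.c i ^ (α i : ℕ))).prod

/-- `c̄^β = c̄_1^{β_1} ⋯ c̄_t^{β_t}`. -/
def cbpow (d : WBC R A r t) (β : Fin t → Fin 2) : A :=
  ((List.finRange t).map (fun j => d.cb j ^ (β j : ℕ))).prod

/-- `e^f = e_1 e_2 ⋯ e_f`. -/
def epow (d : WBC R A r t) (f : ℕ) : A :=
  ((List.range f).map (fun i => d.E (i + 1) (i + 1))).prod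

/-- Generators of the subalgebra `BC_{m,m}`: the elements `e_1`, `s_1, …, s_{m-1}`,
`s̄_1, …, s̄_{m-1}`, `c_1` and `c̄_1` (interpreted as `∅` when `m = 0`). -/
def lowerGens (d : WBC R A r t) (m : ℕ) : Set A :=
  {x | (1 ≤ m ∧ x = d.e) ∨ (∃ j : ℕ, 1 ≤ j ∧ j + 1 ≤ m ∧ x = d.s j)
    ∨ (∃ j : ℕ, 1 ≤ j ∧ j + 1 ≤ m ∧ x = d.sb j)
    ∨ (1 ≤ m ∧ x = d.cn 1) ∨ (1 ≤ m ∧ x = d.cbn 1)}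

end WBC

/-- `φ` intertwines two sets of walled Brauer–Clifford data. -/
structure WBCHom {R A B : Type} [CommRing R] [Ring A] [Algebra R A] [Ring B] [Algebra R B]
    {r t : ℕ} (d : WBC R A r t) (d' : WBC R B r t) (φ : A →ₐ[R] B) : Prop where
  map_σ : ∀ w, φ (d.σ w) = d'.σ w
  map_σb : ∀ w, φ (d.σb w) = d'.σb w
  map_c : ∀ i, φ (d.c i) = d'.c i
  map_cb : ∀ j, φ (d.cb j) = d'.cb j
  map_e : φ d.e = d'.e

/-- `A` (with the data `d`) *is* the walled Brauer–Clifford superalgebra `BC_{r,t}`: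
it is initial among all algebras with such data. -/
def WBC.IsUniversal {R A : Type} [CommRing R] [Ring A] [Algebra R A] {r t : ℕ}
    (d : WBC R A r t) : Prop :=
  ∀ (B : Type) [Ring B] [Algebra R B], ∀ d' : WBC R B r t, ∃! φ : A →ₐ[R] B, WBCHom d d' φ

/-- An element of `D^f_{r,t}`: data `1 ≤ i_1 < ⋯ < i_f ≤ r` and `k ≤ j_k ≤ t`
(all 1-based) describing `s_{f,i_f} s̄_{f,j_f} ⋯ s_{1,i_1} s̄_{1,j_1}`. -/
structure DElt (r t f : ℕ) : Type where
  a : Fin f → ℕ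
  b : Fin f → ℕ
  ha_mono : StrictMono a
  ha_lb : ∀ k, 1 ≤ a k
  ha_ub : ∀ k, a k ≤ r
  hb_lb : ∀ k : Fin f, (k : ℕ) + 1 ≤ b k
  hb_ub : ∀ k, b k ≤ t

/-- The `Σ_r`-component `s_{f,i_f} ⋯ s_{1,i_1}` of the element of `D^f_{r,t}`. -/
def DElt.pr {r t f : ℕ} (x : DElt r t f) : Equiv.Perm (Fin r) :=
  ((List.finRange f).reverse.map (fun (k : Fin f) => sIJ r ((k : ℕ) + 1) (x.a k))).prod

/-- The `Σ_t`-component `s̄_{f,j_f} ⋯ s̄_{1,j_1}` of the element of `D^f_{r,t}`. -/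
def DElt.pt {r t f : ℕ} (x : DElt r t f) : Equiv.Perm (Fin t) :=
  ((List.finRange f).reverse.map (fun (k : Fin f) => sIJ t ((k : ℕ) + 1) (x.b k))).prod

/-- Index for the basis `{c^α d_1⁻¹ e^f w d_2 c̄^β}` of `BC_{r,t}`; the component
`w ∈ Σ_{r-f} × Σ_{t-f}` is a pair of permutations fixing `1, …, f` pointwise. -/
structure BCIndex (r t : ℕ) : Type where
  α : Fin r → Fin 2
  β : Fin t → Fin 2
  f : ℕ
  hf : f ≤ min r t
  d1 : DElt r t f
  d2 : DElt r t f
  w : Equiv.Perm (Fin r)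
  wb : Equiv.Perm (Fin t)
  hw : ∀ i : Fin r, (i : ℕ) < f → w i = i
  hwb : ∀ j : Fin t, (j : ℕ) < f → wb j = j

/-- The basis element `c^α d_1⁻¹ e^f w d_2 c̄^β` of Theorem 2.4. -/
def WBC.basElt {R A : Type} [CommRing R] [Ring A] [Algebra R A] {r t : ℕ}
    (d : WBC R A r t) (x : BCIndex r t) : A :=
  d.cpow x.α * d.σ (x.d1.pr⁻¹) * d.σb (x.d1.pt⁻¹) * d.epow x.f *
    d.σ x.w * d.σb x.wb * d.σ x.d2.pr * d.σb x.d2.pt * d.cbpow x.β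

/-- Data for the presentation of the affine walled Brauer–Clifford superalgebra
`BC^aff_{r,t}` (Definition 3.1) with distinguished parameter `ω_1 ∈ R`.
`om k` is `ω_k` (with `ω_1` the scalar `ω1` and `ω_{2k} = 0`), `omb k` is `ω̄_k`. -/
structure AWBC (R A : Type) [CommRing R] [Ring A] [Algebra R A] (r t : ℕ) (ω1 : R)
    extends WBC R A r t : Type where
  x1 : A
  xb1 : A
  om : ℕ → A
  omb : ℕ → A
  om_one : om 1 = algebraMap R A ω1
  om_even : ∀ k, om (2 * k) = 0
  omb_zero : omb 0 = 0
  om_comm : ∀ k, (∀ w, om k * σ w = σ w * om k) ∧ (∀ w, om k * σb w = σb w * om k) ∧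
    (∀ i, om k * c i = c i * om k) ∧ (∀ j, om k * cb j = cb j * om k) ∧
    om k * e = e * om k ∧ om k * x1 = x1 * om k ∧ om k * xb1 = xb1 * om k ∧
    (∀ l, om k * om l = om l * om k) ∧ (∀ l, om k * omb l = omb l * om k)
  omb_comm : ∀ k, (∀ w, omb k * σ w = σ w * omb k) ∧ (∀ w, omb k * σb w = σb w * omb k) ∧
    (∀ i, omb k * c i = c i * omb k) ∧ (∀ j, omb k * cb j = cb j * omb k) ∧
    omb k * e = e * omb k ∧ omb k * x1 = x1 * omb k ∧ omb k * xb1 = xb1 * omb k ∧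
    (∀ l, omb k * omb l = omb l * omb k)
  x_comm : ∀ h : 1 < r, x1 * (σ (sw r 0 1) * x1 * σ (sw r 0 1)
      - (1 - c ⟨0, by omega⟩ * c ⟨1, h⟩) * σ (sw r 0 1))
    = (σ (sw r 0 1) * x1 * σ (sw r 0 1)
      - (1 - c ⟨0, by omega⟩ * c ⟨1, h⟩) * σ (sw r 0 1)) * x1
  x1_c1 : ∀ h : 0 < r, x1 * c ⟨0, h⟩ = -(c ⟨0, h⟩ * x1)
  x1_c : ∀ i : Fin r, (i : ℕ) ≠ 0 → x1 * c i = c i * x1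
  s_x1 : ∀ i : ℕ, 0 < i → i + 1 < r → σ (sw r i (i + 1)) * x1 = x1 * σ (sw r i (i + 1))
  xb_comm : ∀ h : 1 < t, xb1 * (σb (sw t 0 1) * xb1 * σb (sw t 0 1)
      - (1 + cb ⟨0, by omega⟩ * cb ⟨1, h⟩) * σb (sw t 0 1))
    = (σb (sw t 0 1) * xb1 * σb (sw t 0 1)
      - (1 + cb ⟨0, by omega⟩ * cb ⟨1, h⟩) * σb (sw t 0 1)) * xb1
  xb1_cb1 : ∀ h : 0 < t, xb1 * cb ⟨0, h⟩ = -(cb ⟨0, h⟩ * xb1)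
  xb1_cb : ∀ j : Fin t, (j : ℕ) ≠ 0 → xb1 * cb j = cb j * xb1
  sb_xb1 : ∀ j : ℕ, 0 < j → j + 1 < t → σb (sw t j (j + 1)) * xb1 = xb1 * σb (sw t j (j + 1))
  e_xsum : e * (x1 + xb1) = 0
  xsum_e : (x1 + xb1) * e = 0
  e_sxs : 1 < r → e * (σ (sw r 0 1) * x1 * σ (sw r 0 1)) = (σ (sw r 0 1) * x1 * σ (sw r 0 1)) * e
  x_mixed : ∀ h : 0 < r, x1 * (e + xb1 - c ⟨0, h⟩ * e * c ⟨0, h⟩)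
      = (e - c ⟨0, h⟩ * e * c ⟨0, h⟩ + xb1) * x1
  e_sbxbsb : 1 < t →
    e * (σb (sw t 0 1) * xb1 * σb (sw t 0 1)) = (σb (sw t 0 1) * xb1 * σb (sw t 0 1)) * e
  e_xodd : ∀ k : ℕ, e * x1 ^ (2 * k + 1) * e = om (2 * k + 1) * e
  e_xeven : ∀ k : ℕ, 1 ≤ k → e * x1 ^ (2 * k) * e = 0
  e_xb : ∀ k : ℕ, 1 ≤ k → e * xb1 ^ k * e = omb k * e
  x1_cb_comm : ∀ j, x1 * cb j = cb j * x1
  xb1_c_comm : ∀ i, xb1 * c i = c i * xb1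
  x1_σb : ∀ w, σb w * x1 = x1 * σb w
  xb1_σ : ∀ w, σ w * xb1 = xb1 * σ w

namespace AWBC

variable {R A : Type} [CommRing R] [Ring A] [Algebra R A] {r t : ℕ} {ω1 : R}

/-- `x'_i = s_{i-1} ⋯ s_1 x_1 s_1 ⋯ s_{i-1}` (1-based). -/
def xp (d : AWBC R A r t ω1) (i : ℕ) : A :=
  ((List.range (i - 1)).reverse.map (fun k => d.toWBC.s (k + 1))).prod * d.x1 *
    ((List.range (i - 1)).map (fun k => d.toWBC.s (k + 1))).prod

/-- `x̄'_j = s̄_{j-1} ⋯ s̄_1 x̄_1 s̄_1 ⋯ s̄_{j-1}` (1-based). -/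
def xbp (d : AWBC R A r t ω1) (j : ℕ) : A :=
  ((List.range (j - 1)).reverse.map (fun k => d.toWBC.sb (k + 1))).prod * d.xb1 *
    ((List.range (j - 1)).map (fun k => d.toWBC.sb (k + 1))).prod

/-- `x_i = x'_i - L_i`. -/
def xv (d : AWBC R A r t ω1) (i : ℕ) : A := d.xp i - d.toWBC.L i

/-- `x̄_j = x̄'_j - L̄_j`. -/
def xbv (d : AWBC R A r t ω1) (j : ℕ) : A := d.xbp j - d.toWBC.Lb j

/-- `x^α = x_1^{α_1} ⋯ x_r^{α_r}`. -/
def xpow (d : AWBC R A r t ω1) (α : Fin r → ℕ) : A :=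
  ((List.finRange r).map (fun (i : Fin r) => d.xv ((i : ℕ) + 1) ^ α i)).prod

/-- `x̄^β = x̄_1^{β_1} ⋯ x̄_t^{β_t}`. -/
def xbpow (d : AWBC R A r t ω1) (β : Fin t → ℕ) : A :=
  ((List.finRange t).map (fun (j : Fin t) => d.xbv ((j : ℕ) + 1) ^ β j)).prod

/-- `∏_{n ∈ ℤ^{>0}} ω_{2n+1}^{a_{2n+1}}`, where `g i` is the exponent of `ω_{2(i+1)+1}`. -/
def ompow (d : AWBC R A r t ω1) (g : ℕ →₀ ℕ) : A :=
  ((g.support.sort (· ≤ ·)).map (fun n => d.om (2 * n + 3) ^ g n)).prod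

/-- `z_i = x'_i + y_i`. -/
def z (d : AWBC R A r t ω1) (i : ℕ) : A := d.xp i + d.toWBC.y i

/-- `z̄_j = x̄'_j + ȳ_j`. -/
def zb (d : AWBC R A r t ω1) (j : ℕ) : A := d.xbp j + d.toWBC.yb j

/-- Generators of the subalgebra `BC_{2,m,m}`-type subalgebra:
`e_1, s_1, …, s_{m-1}, s̄_1, …, s̄_{m-1}, c_1, c̄_1, x_1, x̄_1`. -/
def lowerGensA (d : AWBC R A r t ω1) (m : ℕ) : Set A :=
  d.toWBC.lowerGens m ∪ {x | 1 ≤ m ∧ (x = d.x1 ∨ x = d.xb1)}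

end AWBC

/-- `φ` intertwines two sets of affine walled Brauer–Clifford data. -/
structure AWBCHom {R A B : Type} [CommRing R] [Ring A] [Algebra R A] [Ring B] [Algebra R B]
    {r t : ℕ} {ω1 : R} (d : AWBC R A r t ω1) (d' : AWBC R B r t ω1) (φ : A →ₐ[R] B) : Prop where
  map_σ : ∀ w, φ (d.σ w) = d'.σ w
  map_σb : ∀ w, φ (d.σb w) = d'.σb w
  map_c : ∀ i, φ (d.c i) = d'.c i
  map_cb : ∀ j, φ (d.cb j) = d'.cb j
  map_e : φ d.e = d'.e
  map_x1 : φ d.x1 = d'.x1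
  map_xb1 : φ d.xb1 = d'.xb1
  map_om : ∀ k, φ (d.om k) = d'.om k
  map_omb : ∀ k, φ (d.omb k) = d'.omb k

/-- `A` (with the data `d`) is the affine walled Brauer–Clifford superalgebra
`BC^aff_{r,t}` of Definition 3.1. -/
def AWBC.IsUniversal {R A : Type} [CommRing R] [Ring A] [Algebra R A] {r t : ℕ} {ω1 : R}
    (d : AWBC R A r t ω1) : Prop :=
  ∀ (B : Type) [Ring B] [Algebra R B], ∀ d' : AWBC R B r t ω1,
    ∃! φ : A →ₐ[R] B, AWBCHom d d' φ

/-- Assumption 3.6: the parameters `ω̄` are determined by the `ω`'s as in Corollary 3.5. -/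
def AWBC.Ass36 {R A : Type} [CommRing R] [Ring A] [Algebra R A] {r t : ℕ} {ω1 : R}
    (d : AWBC R A r t ω1) : Prop :=
  (∀ n, d.omb (2 * n) = 0) ∧
  (∀ n, d.omb (2 * n + 1) = ∑ j ∈ Finset.range (n + 1), acoef d.om n j * d.om (2 * j + 1))

/-- `A` (with the data `d`) is the affine walled Brauer–Clifford superalgebra
`BC^aff_{r,t}` subject to Assumption 3.6. -/
def AWBC.IsUniversal36 {R A : Type} [CommRing R] [Ring A] [Algebra R A] {r t : ℕ} {ω1 : R}
    (d : AWBC R A r t ω1) : Prop :=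
  d.Ass36 ∧ ∀ (B : Type) [Ring B] [Algebra R B], ∀ d' : AWBC R B r t ω1,
    d'.Ass36 → ∃! φ : A →ₐ[R] B, AWBCHom d d' φ

/-- The parameters `ω_k`, `ω̄_k` are the scalars `ω k`, `obar ω k` (specialization defining
the algebra `B̃C_{r,t}` of Definition 3.13). -/
def AWBC.IsSpec {R A : Type} [CommRing R] [Ring A] [Algebra R A] {r t : ℕ} {ω1 : R}
    (d : AWBC R A r t ω1) (ω : ℕ → R) : Prop :=
  (∀ k, d.om k = algebraMap R A (ω k)) ∧ (∀ k, 1 ≤ k → d.omb k = algebraMap R A (obar ω k))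

/-- `A` (with the data `d`) is the algebra `B̃C_{r,t}` of Definition 3.13 with parameters
`ω_{2n+1} ∈ R`. -/
def AWBC.IsSpecUniversal {R A : Type} [CommRing R] [Ring A] [Algebra R A] {r t : ℕ} {ω1 : R}
    (d : AWBC R A r t ω1) (ω : ℕ → R) : Prop :=
  d.IsSpec ω ∧ ∀ (B : Type) [Ring B] [Algebra R B], ∀ d' : AWBC R B r t ω1,
    d'.IsSpec ω → ∃! φ : A →ₐ[R] B, AWBCHom d d' φ

/-- The cyclotomic relations `f(x_1) = 0` and `g(x̄_1) = 0`. -/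
def AWBC.IsCyc {R A : Type} [CommRing R] [Ring A] [Algebra R A] {r t : ℕ} {ω1 : R}
    (d : AWBC R A r t ω1) (f g : Polynomial R) : Prop :=
  Polynomial.aeval d.x1 f = 0 ∧ Polynomial.aeval d.xb1 g = 0

/-- `A` (with the data `d`) is the cyclotomic walled Brauer–Clifford superalgebra
`BC_{ℓ,r,t}` of Definition 3.14 attached to `f`, `g` and the scalar parameters `ω`. -/
def AWBC.IsCycUniversal {R A : Type} [CommRing R] [Ring A] [Algebra R A] {r t : ℕ} {ω1 : R}
    (d : AWBC R A r t ω1) (ω : ℕ → R) (f g : Polynomial R) : Prop :=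
  d.IsSpec ω ∧ d.IsCyc f g ∧ ∀ (B : Type) [Ring B] [Algebra R B], ∀ d' : AWBC R B r t ω1,
    d'.IsSpec ω → d'.IsCyc f g → ∃! φ : A →ₐ[R] B, AWBCHom d d' φ

/-- Index of a regular monomial `x^α d x̄^β ∏_{n≥1} ω_{2n+1}^{a_{2n+1}}` of `BC^aff_{r,t}`. -/
structure ARIndex (r t : ℕ) : Type where
  α : Fin r → ℕ
  β : Fin t → ℕ
  dIdx : BCIndex r t
  g : ℕ →₀ ℕ

/-- The regular monomial `x^α d x̄^β ∏_{n≥1} ω_{2n+1}^{a_{2n+1}}` of Definition 3.11. -/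
def AWBC.regElt {R A : Type} [CommRing R] [Ring A] [Algebra R A] {r t : ℕ} {ω1 : R}
    (d : AWBC R A r t ω1) (x : ARIndex r t) : A :=
  d.xpow x.α * d.toWBC.basElt x.dIdx * d.xbpow x.β * d.ompow x.g

/-- Index of a regular monomial `x^α d x̄^β` of `B̃C_{r,t}`. -/
structure SIndex (r t : ℕ) : Type where
  α : Fin r → ℕ
  β : Fin t → ℕ
  dIdx : BCIndex r t

/-- The regular monomial `x^α d x̄^β` of `B̃C_{r,t}`. -/
def AWBC.sregElt {R A : Type} [CommRing R] [Ring A] [Algebra R A] {r t : ℕ} {ω1 : R}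
    (d : AWBC R A r t ω1) (x : SIndex r t) : A :=
  d.xpow x.α * d.toWBC.basElt x.dIdx * d.xbpow x.β

/-- Index of a regular monomial `x^α d x̄^β` of the level `ℓ` algebra `BC_{ℓ,r,t}`,
with exponents in `{0, 1, …, ℓ-1}`. -/
structure CIndex (r t ℓ : ℕ) : Type where
  α : Fin r → Fin ℓ
  β : Fin t → Fin ℓ
  dIdx : BCIndex r t

/-- The regular monomial `x^α d x̄^β` of `BC_{ℓ,r,t}`. -/
def AWBC.cregElt {R A : Type} [CommRing R] [Ring A] [Algebra R A] {r t ℓ : ℕ} {ω1 : R}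
    (d : AWBC R A r t ω1) (x : CIndex r t ℓ) : A :=
  d.xpow (fun i => (x.α i : ℕ)) * d.toWBC.basElt x.dIdx * d.xbpow (fun j => (x.β j : ℕ))

/-- Admissibility (Definition 6.4): writing `f(x) = x^{k+2m} + ∑_{i=1}^{2m} a_i x^{k+2m-i}`,
one has `ω_L = -(a_1 ω_{L-1} + ⋯ + a_{2m} ω_{L-2m})` for all `L ≥ k + 2m`. -/
def AdmissibleParam {R : Type} [CommRing R] (ω : ℕ → R) (f : Polynomial R) (k m : ℕ) : Prop :=
  ∀ L, k + 2 * m ≤ L →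
    ω L = -∑ i ∈ Finset.Icc 1 (2 * m), f.coeff (k + 2 * m - i) * ω (L - i)

/-- The parameters `ω_0 = 0`, `ω_1 = -2m(2p-2m+1)`, `ω_i = p(p+1) ω_{i-2}` of (4.16). -/
def omSeq (m : ℕ) (p : ℂ) : ℕ → ℂ
  | 0 => 0
  | 1 => -2 * (m : ℂ) * (2 * p - 2 * (m : ℂ) + 1)
  | n + 2 => p * (p + 1) * omSeq m p n

/-- Index of a monomial `d_1^{-1} c^α x'^β e^f x̄'^{β̄} c̄^{ᾱ} w d_2` of (4.20). -/
structure L2Index (r t : ℕ) : Type where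
  α : Fin r → Fin 2
  βx : Fin r → Fin 2
  αb : Fin t → Fin 2
  βxb : Fin t → Fin 2
  f : ℕ
  hf : f ≤ min r t
  d1 : DElt r t f
  d2 : DElt r t f
  w : Equiv.Perm (Fin r)
  wb : Equiv.Perm (Fin t)
  hw : ∀ i : Fin r, (i : ℕ) < f → w i = i
  hwb : ∀ j : Fin t, (j : ℕ) < f → wb j = j

/-- The monomial `d_1^{-1} c^α x'^β e^f x̄'^{β̄} c̄^{ᾱ} w d_2` of (4.20), where
`x'^β = x'_r{}^{β_r} ⋯ x'_1{}^{β_1}` and `x̄'^{β̄} = x̄'_t{}^{β̄_t} ⋯ x̄'_1{}^{β̄_1}`. -/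
def AWBC.l2Elt {R A : Type} [CommRing R] [Ring A] [Algebra R A] {r t : ℕ} {ω1 : R}
    (d : AWBC R A r t ω1) (x : L2Index r t) : A :=
  d.toWBC.σ (x.d1.pr⁻¹) * d.toWBC.σb (x.d1.pt⁻¹) * d.toWBC.cpow x.α *
    ((List.finRange r).reverse.map (fun (i : Fin r) => d.xp ((i : ℕ) + 1) ^ (x.βx i : ℕ))).prod *
    d.toWBC.epow x.f *
    ((List.finRange t).reverse.map (fun (j : Fin t) => d.xbp ((j : ℕ) + 1) ^ (x.βxb j : ℕ))).prod *
    d.toWBC.cbpow x.αb *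
    d.toWBC.σ x.w * d.toWBC.σb x.wb * d.toWBC.σ x.d2.pr * d.toWBC.σb x.d2.pt

set_option linter.all false

namespace QP
variable {R : Type} [CommRing R] {J : Type} [Fintype J] [DecidableEq J]

variable (R J) in
abbrev V := J → R
variable (R J) in
abbrev Q := ExteriorAlgebra R (J → R)

/-- left multiplication by a vector -/
def Xo (v : J → R) : Module.End R (Q R J) := LinearMap.mulLeft R (ExteriorAlgebra.ι R v)
/-- contraction -/
def D (f : Module.Dual R (J → R)) : Module.End R (Q R J) := CliffordAlgebra.contractLeft f
/-- functoriality -/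
def G (u : Module.End R (J → R)) : Module.End R (Q R J) := (ExteriorAlgebra.map u).toLinearMap

theorem ext_op {S T : Module.End R (Q R J)} (h1 : S 1 = T 1)
    (hX : ∀ (h : Q R J) (v : J → R), S h = T h →
      (S * Xo v : Module.End R (Q R J)) h = (T * Xo v : Module.End R (Q R J)) h) : S = T := by
  refine LinearMap.ext fun h => ?_
  induction h using CliffordAlgebra.left_induction with
  | algebraMap r =>
    rw [Algebra.algebraMap_eq_smul_one, map_smul, map_smul, h1]
  | add x y hx hy => rw [map_add, map_add, hx, hy]
  | ι_mul x m hx => exact hX x m hx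

theorem X_apply (v : J → R) (h : Q R J) : Xo v h = ExteriorAlgebra.ι R v * h := rfl

theorem DX (f : Module.Dual R (J → R)) (v : J → R) : D f * Xo v = (f v) • 1 - Xo v * D f := by
  refine LinearMap.ext fun h => ?_
  simp only [Xo, D, Module.End.mul_apply, LinearMap.mulLeft_apply, LinearMap.sub_apply, LinearMap.smul_apply, Module.End.one_apply]
  exact CliffordAlgebra.contractLeft_ι_mul ..

theorem D_one (f : Module.Dual R (J → R)) : D f (1 : Q R J) = 0 := CliffordAlgebra.contractLeft_one ..
theorem G_one (u : Module.End R (J → R)) : G u (1 : Q R J) = 1 := map_one (ExteriorAlgebra.map u)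

theorem X_add (v w : J → R) : Xo (v + w) = Xo v + Xo w := by
  refine LinearMap.ext fun h => ?_; simp [Xo, add_mul]
theorem X_smul (a : R) (w : J → R) : Xo (a • w) = a • Xo w := by
  refine LinearMap.ext fun h => ?_; simp [Xo]
theorem X_zero : Xo (0 : J → R) = 0 := by
  refine LinearMap.ext fun h => ?_; simp [Xo]
theorem XX (v w : J → R) : Xo v * Xo w = -(Xo w * Xo v) := by
  rw [eq_neg_iff_add_eq_zero]
  refine LinearMap.ext fun h => ?_; simp [Xo, ← mul_assoc, ← add_mul, ExteriorAlgebra.ι_add_mul_swap]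
theorem XXs (v : J → R) : Xo v * Xo v = 0 := by
  refine LinearMap.ext fun h => ?_; simp [Xo, ← mul_assoc]
theorem DD (v w : Module.Dual R (J → R)) : D v * D w = -(D w * D v) := by
  refine LinearMap.ext fun h => ?_; exact CliffordAlgebra.contractLeft_comm ..
theorem DDs (v : Module.Dual R (J → R)) : D v * D v = 0 := by
  refine LinearMap.ext fun h => ?_; exact CliffordAlgebra.contractLeft_contractLeft ..
theorem GX (u : Module.End R (J → R)) (v : J → R) : G u * Xo v = Xo (u v) * G u := by
  refine LinearMap.ext fun h => ?_; simp [Xo, G]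
theorem GG (u v : Module.End R (J → R)) : G u * G v = G (u * v) := by
  refine LinearMap.ext fun h => ?_
  exact DFunLike.congr_fun (ExteriorAlgebra.map_comp_map (R := R) v u) h
theorem G1 : G (1 : Module.End R (J → R)) = 1 := by
  refine LinearMap.ext fun h => ?_
  exact DFunLike.congr_fun (ExteriorAlgebra.map_id (R := R) (M := J → R)) h

theorem DG (u : Module.End R (J → R)) (f : Module.Dual R (J → R)) :
    D f * G u = G u * D (f ∘ₗ u) := by
  apply ext_op
  · simp [G_one, D_one]
  · intro h v hh
    have e1 : D f * G u * Xo v = (f (u v)) • G u - Xo (u v) * (D f * G u) := by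
      rw [mul_assoc, GX, ← mul_assoc, DX, sub_mul, mul_assoc, smul_mul_assoc, one_mul]
    have e2 : G u * D (f ∘ₗ u) * Xo v = (f (u v)) • G u - Xo (u v) * (G u * D (f ∘ₗ u)) := by
      rw [mul_assoc, DX, mul_sub, ← mul_assoc, GX, mul_assoc, mul_smul_comm, mul_one]; rfl
    rw [e1, e2, LinearMap.sub_apply, LinearMap.sub_apply]
    exact congrArg (fun z => (f (u v) • G u) h - Xo (u v) z) hh

theorem rank1_aux {B : Type*} [Ring B] [Algebra R B] (a : R) (g xv xw xu df : B)
    (h1 : df * xw = a • 1 - xw * df) (h2 : g * xw = xu * g) (h3 : xu * xv = -(xv * xu))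
    (h4 : xv * xv = 0) : (g + xv * g * df) * xw = (xu + a • xv) * (g + xv * g * df) := by
  calc _ = g * xw + xv * g * (df * xw) := by noncomm_ring
    _ = xu * g + a • (xv * g) - xv * (g * xw) * df := by
        rw [h1, ← h2]; simp only [mul_sub, mul_smul_comm, mul_one, mul_assoc]; abel
    _ = xu * g + a • (xv * g) + (xu * xv) * g * df + a • ((xv * xv) * g * df) := by
        rw [h2, h3, h4]; simp only [neg_mul, mul_assoc, zero_mul, smul_zero, add_zero]; abel
    _ = _ := by simp only [add_mul, mul_add, smul_mul_assoc, mul_assoc]; abel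

theorem G_rank1 (u : Module.End R (J → R)) (f : Module.Dual R (J → R)) (v : J → R) :
    G (u + f.smulRight v) = G u + Xo v * G u * D f := by
  apply ext_op
  · simp [G_one, D_one]
  · intro h w hh
    have e1 : G (u + f.smulRight v) * Xo w = (Xo (u w) + f w • Xo v) * G (u + f.smulRight v) := by
      rw [GX]; simp [X_add, X_smul]
    have e2 : (G u + Xo v * G u * D f) * Xo w = (Xo (u w) + f w • Xo v) * (G u + Xo v * G u * D f) :=
      rank1_aux (f w) _ _ _ _ _ (DX f w) (GX u w) (XX (u w) v) (XXs (R := R) v)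
    rw [e1, e2, Module.End.mul_apply, Module.End.mul_apply, hh]

end QP

namespace QP

theorem ra {B : Type*} [Semigroup B] {a b r : B} (h : a * b = r) (c : B) : a * (b * c) = r * c := by
  rw [← mul_assoc, h]

/-- rules for a pair of fermions -/
structure PR {B : Type*} [Ring B] (P Q D E z : B) : Prop where
  PP : P * P = 0
  QQ : Q * Q = 0
  QP : Q * P = -(P * Q)
  DD : D * D = 0
  EE : E * E = 0
  DE : D * E = -(E * D)
  DP : D * P = 1 - P * D
  EQ : E * Q = 1 - Q * E
  DQ : D * Q = -(Q * D)
  EP : E * P = -(P * E)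
  zP : z * P = 0
  zQ : z * Q = 0
  Dz : D * z = 0
  Ez : E * z = 0
  zz : z * z = z

variable {B : Type*} [Ring B] {P Q D E z : B}

def ee (P Q D E z : B) : B := (1 - P * Q) * z * (1 + E * D)

theorem PR.e1 (h : PR P Q D E z) : (P - D) * ee P Q D E z = (P + Q) * z * (1 + E * D) := by
  have h1 := h.PP; have h2 := h.DP; have h3 := h.DQ; have h4 := h.Dz
  simp only [ee, mul_add, add_mul, mul_sub, sub_mul, mul_assoc, mul_one, one_mul, h1, h2, h3, h4, ra h1, ra h2, ra h3, ra h4, mul_zero, zero_mul, mul_neg, neg_mul]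
  abel
theorem PR.e1' (h : PR P Q D E z) : (Q + E) * ee P Q D E z = (P + Q) * z * (1 + E * D) := by
  have h1 := h.QP; have h2 := h.EP; have h3 := h.EQ; have h4 := h.Ez; have h5 := h.QQ
  simp only [ee, mul_add, add_mul, mul_sub, sub_mul, mul_assoc, mul_one, one_mul, h1, h2, h3, h4, h5, ra h1, ra h2, ra h3, ra h4, ra h5, mul_zero, zero_mul, mul_neg, neg_mul]
  abel
theorem PR.e2 (h : PR P Q D E z) : ee P Q D E z * (P - D) = (1 - P * Q) * z * (E - D) := by
  have h1 := h.DP; have h2 := h.zP; have h3 := h.EP; have h4 := h.DD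
  simp only [ee, mul_add, add_mul, mul_sub, sub_mul, mul_assoc, mul_one, one_mul, h1, h2, h3, h4, ra h1, ra h2, ra h3, ra h4, mul_zero, zero_mul, mul_neg, neg_mul]
  abel
theorem PR.e2' (h : PR P Q D E z) : ee P Q D E z * (Q + E) = (1 - P * Q) * z * (E - D) := by
  have h1 := h.EQ; have h2 := h.zQ; have h3 := h.DQ; have h4 := h.EE; have h5 := h.DE
  simp only [ee, mul_add, add_mul, mul_sub, sub_mul, mul_assoc, mul_one, one_mul, h1, h2, h3, h4, h5, ra h1, ra h2, ra h3, ra h4, ra h5, mul_zero, zero_mul, mul_neg, neg_mul]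
  abel
theorem PR.sq (h : PR P Q D E z) : ee P Q D E z * ee P Q D E z = 0 := by
  have h1 := h.EQ; have h2 := h.zQ; have h3 := h.DQ; have h4 := h.Dz; have h5 := h.Ez
  have h6 := h.EP; have h7 := h.zP; have h8 := h.DP; have h9 := h.zz
  simp only [ee, mul_add, add_mul, mul_sub, sub_mul, mul_assoc, mul_one, one_mul, h1, h2, h3, h4, h5, h6, h7, h8, h9, ra h1, ra h2, ra h3, ra h4, ra h5, ra h6, ra h7, ra h8, ra h9, mul_zero, zero_mul, mul_neg, neg_mul]
  abel
theorem PR.ece (h : PR P Q D E z) : ee P Q D E z * (P - D) * ee P Q D E z = 0 := by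
  rw [mul_assoc, h.e1]
  have h1 := h.EQ; have h2 := h.zQ; have h3 := h.DQ; have h4 := h.Dz; have h5 := h.Ez
  have h6 := h.EP; have h7 := h.zP; have h8 := h.DP; have h9 := h.zz
  simp only [ee, mul_add, add_mul, mul_sub, sub_mul, mul_assoc, mul_one, one_mul, h1, h2, h3, h4, h5, h6, h7, h8, h9, ra h1, ra h2, ra h3, ra h4, ra h5, ra h6, ra h7, ra h8, ra h9, mul_zero, zero_mul, mul_neg, neg_mul]
  abel

theorem ee_comm_odd {x : B} (h1 : x * P = -(P * x)) (h2 : x * Q = -(Q * x)) (h3 : x * z = z * x)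
    (h4 : x * D = -(D * x)) (h5 : x * E = -(E * x)) : x * ee P Q D E z = ee P Q D E z * x := by
  simp only [ee, mul_add, add_mul, mul_sub, sub_mul, mul_assoc, mul_one, one_mul, h1, h2, h3, h4, h5, ra h1, ra h2, ra h3, ra h4, ra h5, mul_zero, zero_mul, mul_neg, neg_mul]
  abel

theorem ee_conj {x P' Q' D' E' z' : B} (h1 : x * P = P' * x) (h2 : x * Q = Q' * x) (h3 : x * z = z' * x)
    (h4 : x * D = D' * x) (h5 : x * E = E' * x) : x * ee P Q D E z = ee P' Q' D' E' z' * x := by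
  simp only [ee, mul_add, add_mul, mul_sub, sub_mul, mul_assoc, mul_one, one_mul, h1, h2, h3, h4, h5, ra h1, ra h2, ra h3, ra h4, ra h5, mul_zero, zero_mul, mul_neg, neg_mul]

/-- core of `e s e = e` -/
theorem ese1 {P' D' z' θ Z : B} (h : PR P Q D E z) (h' : PR P' Q D' E z')
    (hθ : θ * ee P Q D E z = ee P' Q D' E z' * θ) (hθ2 : θ * θ = 1) (hE : θ * E = E * θ) (hD : θ * D = D' * θ)
    (a1 : D * P' = -(P' * D)) (a2 : D * z' = z' * D) (a3 : z * P' = P' * z)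
    (a4 : z * z' = Z) (a5 : z * θ = Z + P' * Z * D) (a6 : D * D' = - (D' * D)) :
    ee P Q D E z * θ * ee P Q D E z = ee P Q D E z := by
  have hz : z * (1 + E * D) * ((1 - P' * Q) * z' * (1 + E * D')) = z * θ * (1 + E * D') := by
    have b2 := h.zQ; have b3 := h.DQ; have b5 := h'.Ez
    have b6 := h'.EQ; have b7 := h.EP; have b8 := h'.QP; have b9 := h'.EP
    rw [a5]
    simp only [mul_add, add_mul, mul_sub, sub_mul, mul_assoc, mul_one, one_mul, a1, a2, a3, a4, ra a1, ra a2, ra a3, ra a4, b2, b3, b5, b6, b7, b9, ra b2, ra b3, ra b5, ra b6, ra b7, ra b9, mul_zero, zero_mul, mul_neg, neg_mul]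
    abel
  calc _ = ee P Q D E z * (θ * ee P Q D E z) := by rw [mul_assoc]
    _ = (1 - P * Q) * (z * (1 + E * D) * ((1 - P' * Q) * z' * (1 + E * D'))) * θ := by
      rw [hθ]; simp only [ee, mul_assoc]
    _ = (1 - P * Q) * z * ((1 + E * D) * (θ * θ)) := by
      rw [hz]
      have : θ * (1 + E * D') = (1 + E * D) * θ := by
        have : θ * D' = D * θ := by
          calc _ = θ * D' * (θ * θ) := by rw [hθ2, mul_one]
            _ = θ * (D' * θ) * θ := by simp only [mul_assoc]
            _ = θ * θ * (D * θ) := by rw [← hD]; simp only [mul_assoc]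
            _ = _ := by rw [hθ2, one_mul]
        simp only [mul_add, add_mul, mul_one, one_mul, mul_assoc, ra hE, this]
      simp only [mul_assoc, ra this]
    _ = _ := by rw [hθ2, mul_one]; rfl

theorem ese2 {Q' E' z' θ Z : B} (h : PR P Q D E z) (h' : PR P Q' D E' z')
    (hθ : θ * ee P Q D E z = ee P Q' D E' z' * θ) (hθ2 : θ * θ = 1) (hE : θ * E = E' * θ) (hD : θ * D = D * θ)
    (a1 : E * Q' = -(Q' * E)) (a2 : E * z' = z' * E) (a3 : z * Q' = Q' * z)
    (a4 : z * z' = Z) (a5 : z * θ = Z + Q' * Z * E) (a6 : E * E' = - (E' * E)) :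
    ee P Q D E z * θ * ee P Q D E z = ee P Q D E z := by
  have hz : z * (1 + E * D) * ((1 - P * Q') * z' * (1 + E' * D)) = z * θ * (1 + E' * D) := by
    have b2 := h.zP; have b3 := h'.DQ; have b5 := h'.Dz
    have b6 := h'.DP; have b7 := h.EP; 
    rw [a5]
    simp only [mul_add, add_mul, mul_sub, sub_mul, mul_assoc, mul_one, one_mul, a1, a2, a3, a4, ra a1, ra a2, ra a3, ra a4, b2, b3, b5, b6, b7, ra b2, ra b3, ra b5, ra b6, ra b7,  mul_zero, zero_mul, mul_neg, neg_mul]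
    abel
  calc _ = ee P Q D E z * (θ * ee P Q D E z) := by rw [mul_assoc]
    _ = (1 - P * Q) * (z * (1 + E * D) * ((1 - P * Q') * z' * (1 + E' * D))) * θ := by
      rw [hθ]; simp only [ee, mul_assoc]
    _ = (1 - P * Q) * z * ((1 + E * D) * (θ * θ)) := by
      rw [hz]
      have : θ * (1 + E' * D) = (1 + E * D) * θ := by
        have : θ * E' = E * θ := by
          calc _ = θ * E' * (θ * θ) := by rw [hθ2, mul_one]
            _ = θ * (E' * θ) * θ := by simp only [mul_assoc]
            _ = θ * θ * (E * θ) := by rw [← hE]; simp only [mul_assoc]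
            _ = _ := by rw [hθ2, one_mul]
        simp only [mul_add, add_mul, mul_one, one_mul, mul_assoc, ra this, hD]
      simp only [mul_assoc, ra this]
    _ = _ := by rw [hθ2, mul_one]; rfl

/-- product of two disjoint contractions, with a permutation exchanging them -/
theorem ee_disj {P' Q' D' E' z' θ : B}
    (h1 : D * (1 - P' * Q') = (1 - P' * Q') * D) (h2 : E * (1 - P' * Q') = (1 - P' * Q') * E)
    (h3 : z * (1 - P' * Q') = (1 - P' * Q') * z) (h4 : D * z' = z' * D) (h5 : E * z' = z' * E) :
    ee P Q D E z * ee P' Q' D' E' z' =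
      (1 - P * Q) * (1 - P' * Q') * (z * z') * ((1 + E * D) * (1 + E' * D')) := by
  have h1' : (1 + E * D) * (1 - P' * Q') = (1 - P' * Q') * (1 + E * D) := by
    rw [add_mul, mul_assoc, h1, ← mul_assoc, h2]; noncomm_ring
  have h2' : (1 + E * D) * z' = z' * (1 + E * D) := by
    rw [add_mul, mul_assoc, h4, ← mul_assoc, h5]; noncomm_ring
  simp only [ee, mul_assoc]
  simp only [mul_assoc, ra h1', ra h2', ra h3]

end QP

namespace QP
variable {R : Type} [CommRing R] {J : Type} [Fintype J] [DecidableEq J]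

def dgm (a : J → R) : Module.End R (J → R) where
  toFun v := fun j => a j * v j
  map_add' v w := by ext; simp [mul_add]
  map_smul' c v := by ext; simp [mul_left_comm]

variable (R) in
def pm (w : Equiv.Perm J) : Module.End R (J → R) where
  toFun v := fun j => v (w⁻¹ j)
  map_add' v w := by ext; simp
  map_smul' c v := by ext; simp

variable (R) in
def xx (p : J) : Module.End R (Q R J) := Xo (Pi.single p 1)
variable (R) in
def dd (p : J) : Module.End R (Q R J) := D (LinearMap.proj p)
def dg (a : J → R) : Module.End R (Q R J) := G (dgm a)
variable (R) in
def th : Equiv.Perm J →* Module.End R (Q R J) where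
  toFun w := G (pm R w)
  map_one' := by
    rw [← G1]; rfl
  map_mul' v w := by
    rw [GG]; rfl

theorem xx_xx (p q : J) : xx R p * xx R q = -(xx R q * xx R p) := XX _ _
theorem xx_sq (p : J) : xx R p * xx R p = 0 := XXs _
theorem dd_dd (p q : J) : dd R p * dd R q = -(dd R q * dd R p) := DD _ _
theorem dd_sq (p : J) : dd R p * dd R p = 0 := DDs _
theorem dd_xx (p : J) : dd R p * xx R p = 1 - xx R p * dd R p := by
  rw [dd, xx, DX]; simp
theorem dd_xx_ne {p q : J} (h : p ≠ q) : dd R p * xx R q = - (xx R q * dd R p) := by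
  rw [dd, xx, DX]
  have : (LinearMap.proj p : Module.Dual R (J → R)) (Pi.single q 1) = 0 := by simp [h]
  rw [this, zero_smul, zero_sub]
theorem dg_xx (a : J → R) (p : J) : dg a * xx R p = a p • (xx R p * dg a) := by
  rw [dg, xx, GX, ← smul_mul_assoc, ← X_smul]; congr 2
  ext j; by_cases h : j = p
  · subst h; simp [dgm]
  · simp [dgm, h]
theorem dd_dg (a : J → R) (p : J) : dd R p * dg a = a p • (dg a * dd R p) := by
  rw [dg, dd, DG, ← mul_smul_comm]; congr 1
  have : (LinearMap.proj p ∘ₗ dgm a : Module.Dual R (J → R)) = a p • LinearMap.proj p := by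
    ext; simp [dgm]
  rw [this, D, map_smul]; rfl
theorem dg_dg (a b : J → R) : dg a * dg b = dg (a * b) := by
  rw [dg, dg, GG, dg]; congr 1; ext f j; simp [dgm, mul_assoc]
theorem th_xx (w : Equiv.Perm J) (p : J) : th R w * xx R p = xx R (w p) * th R w := by
  show G _ * _ = _ * G _
  rw [xx, GX, xx]; congr 2
  ext j; simp [pm, Pi.single_apply, Equiv.symm_apply_eq]
theorem th_dd (w : Equiv.Perm J) (p : J) : th R w * dd R p = dd R (w p) * th R w := by
  show G _ * _ = _ * G _
  rw [dd, dd, DG]; congr 2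
  ext j; simp [pm]
theorem th_dg (w : Equiv.Perm J) (a : J → R) : th R w * dg a = dg (fun j => a (w⁻¹ j)) * th R w := by
  show G _ * _ = _ * G _
  rw [dg, dg, GG, GG]; congr 1
theorem dg_th (w : Equiv.Perm J) (a : J → R) (h : ∀ j, w j ≠ j → a j = 0): dg a * th R w = dg a := by
  show G _ * G _ = _ 
  rw [dg, GG]; congr 1; ext f j
  simp only [pm, dgm, Module.End.mul_apply, LinearMap.coe_comp, Function.comp_apply, LinearMap.coe_mk, AddHom.coe_mk]
  by_cases hj : w j = j
  · rw [Equiv.Perm.inv_eq_iff_eq.2 hj.symm]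
  · rw [h j hj]; simp
theorem th_dg' (w : Equiv.Perm J) (a : J → R) (h : ∀ j, w j ≠ j → a j = 0): th R w * dg a = dg a := by
  rw [th_dg]
  have : (fun j => a (w⁻¹ j)) = a := by
    ext j
    by_cases hj : w⁻¹ j = j
    · rw [hj]
    · rw [h (w⁻¹ j), h j]
      · intro h'; exact hj (Equiv.Perm.inv_eq_iff_eq.2 h'.symm)
      · intro h'; rw [show w (w⁻¹ j) = j from w.apply_symm_apply j] at h'; exact hj h'.symm
  rw [this, dg_th w a h]

variable (R) in
def za (p q : J) : J → R := fun j => if j = p ∨ j = q then 0 else 1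
variable (R) in
def eQ (p q : J) : Module.End R (Q R J) :=
  ee (xx R p) (xx R q) (dd R p) (dd R q) (dg (za R p q))

theorem PRq {p q : J} (h : p ≠ q) : PR (xx R p) (xx R q) (dd R p) (dd R q) (dg (za R p q)) where
  PP := xx_sq _
  QQ := xx_sq _
  QP := xx_xx _ _
  DD := dd_sq _
  EE := dd_sq _
  DE := dd_dd _ _
  DP := dd_xx _
  EQ := dd_xx _
  DQ := dd_xx_ne h
  EP := dd_xx_ne h.symm
  zP := by rw [dg_xx]; simp [za]
  zQ := by rw [dg_xx]; simp [za]
  Dz := by rw [dd_dg]; simp [za]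
  Ez := by rw [dd_dg]; simp [za]
  zz := by rw [dg_dg]; congr 1; ext j; simp only [za, Pi.mul_apply]; split_ifs <;> simp

theorem eQ_th (w : Equiv.Perm J) (p q : J) : th R w * eQ R p q = eQ R (w p) (w q) * th R w := by
  apply ee_conj (th_xx _ _) (th_xx _ _) _ (th_dd _ _) (th_dd _ _)
  rw [th_dg]; congr 2; ext j; simp [za, Equiv.symm_apply_eq]

theorem xx_eQ {s p q : J} (h1 : s ≠ p) (h2 : s ≠ q) : xx R s * eQ R p q = eQ R p q * xx R s := by
  apply ee_comm_odd (xx_xx _ _) (xx_xx _ _)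
  · rw [dg_xx]; simp [za, h1, h2]
  · rw [dd_xx_ne h1.symm, neg_neg]
  · rw [dd_xx_ne h2.symm, neg_neg]
theorem dd_eQ {s p q : J} (h1 : s ≠ p) (h2 : s ≠ q) : dd R s * eQ R p q = eQ R p q * dd R s := by
  apply ee_comm_odd (dd_xx_ne h1) (dd_xx_ne h2) _ (dd_dd _ _) (dd_dd _ _)
  · rw [dd_dg]; simp [za, h1, h2]

theorem dg_eQ (a : J → R) {p q : J} (h : a p * a q = 1) : dg a * eQ R p q = eQ R p q * dg a := by
  have aux : ∀ {B : Type} [Ring B] [Algebra R B] (g P Q D E z : B) (u v : R) (huv : u * v = 1)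
    (_ : g * P = u • (P * g)) (_ : g * Q = v • (Q * g)) (_ : D * g = u • (g * D)) (_ : E * g = v • (g * E))
    (_ : g * z = z * g), g * ee P Q D E z = ee P Q D E z * g := by
    intro B _ _ g P Q D E z u v huv h1 h2 h3 h4 h5
    have a1 : g * (P * Q) = (P * Q) * g := by
      rw [ra h1, smul_mul_assoc, mul_assoc, h2, mul_smul_comm, smul_smul, huv, one_smul, mul_assoc]
    have a2 : g * (E * D) = (E * D) * g := by
      rw [mul_assoc, h3, mul_smul_comm, ra h4, smul_mul_assoc, smul_smul, huv, one_smul, mul_assoc]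
    have a3 : g * (1 - P * Q) = (1 - P * Q) * g := by rw [mul_sub, a1]; noncomm_ring
    have a4 : g * (1 + E * D) = (1 + E * D) * g := by rw [mul_add, a2]; noncomm_ring
    simp only [ee, mul_assoc, ra a3, ra h5, a4]
  apply aux _ _ _ _ _ _ _ _ h (dg_xx _ _) (dg_xx _ _) (dd_dg _ _) (dd_dg _ _)
  rw [dg_dg, dg_dg, mul_comm]

/-- flips at p,q are absorbed -/
theorem eQ_dg (a : J → R) {p q : J} (h : a p * a q = 1) (h' : ∀ j, j ≠ p → j ≠ q → a j = 1) :
    eQ R p q * dg a = eQ R p q := by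
  have hz : dg (za R p q) * dg a = dg (za R p q) := by
    rw [dg_dg]; congr 1; ext j; by_cases h1 : j = p
    · simp [za, h1]
    · by_cases h2 : j = q
      · simp [za, h2]
      · simp [za, h1, h2, h']
  have a2 : dg a * (dd R q * dd R p) = (dd R q * dd R p) * dg a := by
    rw [mul_assoc, dd_dg, mul_smul_comm, ra (dd_dg a q), smul_mul_assoc, smul_smul, h, one_smul, mul_assoc]
  have a4 : dg a * (1 + dd R q * dd R p) = (1 + dd R q * dd R p) * dg a := by
    rw [mul_add, a2, add_mul, one_mul, mul_one]
  rw [eQ, ee, mul_assoc, ← a4, ← mul_assoc, mul_assoc _ _ (dg a), hz]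

theorem eQ_s1 {p q p' : J} (h : p ≠ q) (h1 : p' ≠ p) (h2 : p' ≠ q) :
    eQ R p q * th R (Equiv.swap p p') * eQ R p q = eQ R p q := by
  have s1 : Equiv.swap p p' q = q := Equiv.swap_apply_of_ne_of_ne h.symm h2.symm
  refine ese1 (Z := dg (za R p q * za R p' q)) (PRq h) (PRq h2) ?_ ?_ ?_ ?_ (dd_xx_ne h1.symm) ?_ ?_ (dg_dg _ _) ?_ (dd_dd _ _)
  · have := eQ_th (R := R) (Equiv.swap p p') p q
    rw [Equiv.swap_apply_left, s1] at this
    exact this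
  · rw [← map_mul, Equiv.swap_mul_self, map_one]
  · rw [th_dd, s1]
  · rw [th_dd, Equiv.swap_apply_left]
  · rw [dd_dg]; simp [za, h, h1.symm]
  · rw [dg_xx]; simp [za, h1, h2]
  · show G _ * G _ = G _ + _ * G _ * _
    rw [xx, dd, ← G_rank1, GG]; congr 1
    refine LinearMap.ext fun v => funext fun j => ?_
    show za R p q j * v ((Equiv.swap p p')⁻¹ j) =
      (za R p q * za R p' q) j * v j + v p * (Pi.single p' (1 : R) : J → R) j
    simp only [Equiv.swap_inv, Equiv.swap_apply_def, za, Pi.mul_apply, Pi.single_apply]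
    split_ifs <;> simp_all

theorem eQ_s2 {p q q' : J} (h : p ≠ q) (h1 : q' ≠ p) (h2 : q' ≠ q) :
    eQ R p q * th R (Equiv.swap q q') * eQ R p q = eQ R p q := by
  have s1 : Equiv.swap q q' p = p := Equiv.swap_apply_of_ne_of_ne h h1.symm
  refine ese2 (Z := dg (za R p q * za R p q')) (PRq h) (PRq h1.symm) ?_ ?_ ?_ ?_ (dd_xx_ne h2.symm) ?_ ?_ (dg_dg _ _) ?_ (dd_dd _ _)
  · have := eQ_th (R := R) (Equiv.swap q q') p q
    rw [Equiv.swap_apply_left, s1] at this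
    exact this
  · rw [← map_mul, Equiv.swap_mul_self, map_one]
  · rw [th_dd, Equiv.swap_apply_left]
  · rw [th_dd, s1]
  · rw [dd_dg]; simp [za, h.symm, h2.symm]
  · rw [dg_xx]; simp [za, h1, h2]
  · show G _ * G _ = G _ + _ * G _ * _
    rw [xx, dd, ← G_rank1, GG]; congr 1
    refine LinearMap.ext fun v => funext fun j => ?_
    show za R p q j * v ((Equiv.swap q q')⁻¹ j) =
      (za R p q * za R p q') j * v j + v q * (Pi.single q' (1 : R) : J → R) j
    simp only [Equiv.swap_inv, Equiv.swap_apply_def, za, Pi.mul_apply, Pi.single_apply]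
    split_ifs <;> simp_all
end QP

namespace QP
variable {R : Type} [CommRing R] {J : Type} [Fintype J] [DecidableEq J]

theorem quad_comm {B : Type*} [Ring B] (k : B → B) {P Q P' Q' : B} 
    (h1 : P * P' = -(P' * P)) (h2 : P * Q' = -(Q' * P)) (h3 : Q * P' = -(P' * Q)) (h4 : Q * Q' = -(Q' * Q)) :
    (P * Q) * (P' * Q') = (P' * Q') * (P * Q) := by
  simp only [mul_assoc, h1, h2, h3, h4, ra h1, ra h2, ra h3, ra h4, neg_mul, mul_neg, neg_neg]

theorem one_sub_comm {B : Type*} [Ring B] {a b : B} (h : a * b = b * a) : (1 - a) * (1 - b) = (1 - b) * (1 - a) := by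
  simp only [mul_sub, sub_mul, h, mul_one, one_mul]; abel
theorem one_add_comm {B : Type*} [Ring B] {a b : B} (h : a * b = b * a) : (1 + a) * (1 + b) = (1 + b) * (1 + a) := by
  simp only [mul_add, add_mul, h, mul_one, one_mul]; abel
theorem comm_one_sub {B : Type*} [Ring B] {D P Q : B} (h1 : D * P = -(P * D)) (h2 : D * Q = -(Q * D)) :
   D * (1 - P * Q) = (1 - P * Q) * D := by
  simp only [mul_sub, sub_mul, mul_one, one_mul, ra h1, mul_assoc, h2, neg_mul, mul_neg, neg_neg]
theorem comm_one_sub' {B : Type*} [Ring B] {D P Q : B} (h1 : D * P = (P * D)) (h2 : D * Q = (Q * D)) :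
   D * (1 - P * Q) = (1 - P * Q) * D := by
  simp only [mul_sub, sub_mul, mul_one, one_mul, ra h1, mul_assoc, h2, neg_mul, mul_neg, neg_neg]
theorem th_one_sub {B : Type*} [Ring B] {θ P Q P' Q' : B} (h1 : θ * P = P' * θ) (h2 : θ * Q = Q' * θ) :
   θ * (1 - P * Q) = (1 - P' * Q') * θ := by
  simp only [mul_sub, sub_mul, mul_one, one_mul, ra h1, mul_assoc, h2]
theorem th_one_add {B : Type*} [Ring B] {θ P Q P' Q' : B} (h1 : θ * P = P' * θ) (h2 : θ * Q = Q' * θ) :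
   θ * (1 + P * Q) = (1 + P' * Q') * θ := by
  simp only [mul_add, add_mul, mul_one, one_mul, ra h1, mul_assoc, h2]

theorem eQ_disj {p q p' q' : J} (h1 : p ≠ p') (h2 : p ≠ q') (h3 : q ≠ p') (h4 : q ≠ q') :
    eQ R p q * eQ R p' q' = (1 - xx R p * xx R q) * (1 - xx R p' * xx R q') * (dg (za R p q) * dg (za R p' q')) *
      ((1 + dd R q * dd R p) * (1 + dd R q' * dd R p')) := by
  refine ee_disj (θ := 1) ?_ ?_ ?_ ?_ ?_
  · exact comm_one_sub (dd_xx_ne h1) (dd_xx_ne h2)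
  · exact comm_one_sub (dd_xx_ne h3) (dd_xx_ne h4)
  · apply comm_one_sub' <;> rw [dg_xx] <;> simp [za, h1.symm, h2.symm, h3.symm, h4.symm]
  · rw [dd_dg]; simp [za, h1, h2]
  · rw [dd_dg]; simp [za, h3, h4]

theorem eQ_disj_th {p q p' q' : J} (h : p ≠ q) (h' : p' ≠ q') (h1 : p ≠ p') (h2 : p ≠ q') (h3 : q ≠ p') (h4 : q ≠ q') :
    th R (Equiv.swap p p' * Equiv.swap q q') * (eQ R p q * eQ R p' q') = eQ R p q * eQ R p' q' ∧
    eQ R p q * eQ R p' q' * th R (Equiv.swap p p' * Equiv.swap q q') = eQ R p q * eQ R p' q' := by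
  rw [eQ_disj h1 h2 h3 h4]
  set w := Equiv.swap p p' * Equiv.swap q q' with hw
  have w1 : w p = p' := by simp [hw, Equiv.swap_apply_of_ne_of_ne h h2]
  have w2 : w q = q' := by simp [hw, Equiv.swap_apply_of_ne_of_ne h2.symm h'.symm]
  have w3 : w p' = p := by simp [hw, Equiv.swap_apply_of_ne_of_ne h3.symm h']
  have w4 : w q' = q := by simp [hw, Equiv.swap_apply_of_ne_of_ne h.symm h3]
  have a1 : th R w * (1 - xx R p * xx R q) = (1 - xx R p' * xx R q') * th R w :=
    th_one_sub (by rw [th_xx, w1]) (by rw [th_xx, w2])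
  have a2 : th R w * (1 - xx R p' * xx R q') = (1 - xx R p * xx R q) * th R w :=
    th_one_sub (by rw [th_xx, w3]) (by rw [th_xx, w4])
  have a3 : th R w * (1 + dd R q * dd R p) = (1 + dd R q' * dd R p') * th R w :=
    th_one_add (by rw [th_dd, w2]) (by rw [th_dd, w1])
  have a4 : th R w * (1 + dd R q' * dd R p') = (1 + dd R q * dd R p) * th R w :=
    th_one_add (by rw [th_dd, w4]) (by rw [th_dd, w3])
  have b1 : (1 - xx R p * xx R q) * (1 - xx R p' * xx R q') = (1 - xx R p' * xx R q') * (1 - xx R p * xx R q) :=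
    one_sub_comm (quad_comm id (xx_xx _ _) (xx_xx _ _) (xx_xx _ _) (xx_xx _ _))
  have b2 : (1 + dd R q * dd R p) * (1 + dd R q' * dd R p') = (1 + dd R q' * dd R p') * (1 + dd R q * dd R p) :=
    one_add_comm (quad_comm id (dd_dd _ _) (dd_dd _ _) (dd_dd _ _) (dd_dd _ _))
  have hwm : ∀ j, w j ≠ j → (za R p q * za R p' q') j = 0 := by
    intro j hj
    by_cases e1 : j = p; · simp [za, e1]
    by_cases e2 : j = q; · simp [za, e2]
    by_cases e3 : j = p'; · simp [za, e3]
    by_cases e4 : j = q'; · simp [za, e4]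
    exact absurd (by simp [hw, Equiv.swap_apply_of_ne_of_ne e1 e3, Equiv.swap_apply_of_ne_of_ne e2 e4]) hj
  have c1 : th R w * (dg (za R p q) * dg (za R p' q')) = dg (za R p q) * dg (za R p' q') := by
    rw [dg_dg, th_dg' _ _ hwm]
  have c2 : (dg (za R p q) * dg (za R p' q')) * th R w = dg (za R p q) * dg (za R p' q') := by
    rw [dg_dg, dg_th _ _ hwm]
  constructor
  · rw [b1]
    rw [mul_assoc, mul_assoc, ra a2, mul_assoc _ (th R w), ra a1, mul_assoc _ (th R w), ra c1, ← mul_assoc, b1]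
    simp only [mul_assoc]
  · rw [b2]
    rw [mul_assoc, mul_assoc (1 + dd R q' * dd R p'), ← a4, ra a3.symm, mul_assoc (th R w), ← mul_assoc _ (th R w), mul_assoc _ _ (th R w), c2, b2]


variable (R J) in
/-- vacuum functional -/
def eps : Q R J →ₗ[R] R := (ExteriorAlgebra.algebraMapInv (R := R) (M := J → R)).toLinearMap

theorem eps_one : eps R J 1 = 1 := map_one (ExteriorAlgebra.algebraMapInv (R := R) (M := J → R))
theorem eps_xx (p : J) (h : Q R J) : eps R J (xx R p h) = 0 := by
  show ExteriorAlgebra.algebraMapInv (ExteriorAlgebra.ι R _ * h) = 0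
  rw [map_mul]
  simp [ExteriorAlgebra.algebraMapInv]
theorem eps_G (u : Module.End R (J → R)) (h : Q R J) : eps R J (G u h) = eps R J h := by
  have : (ExteriorAlgebra.algebraMapInv (R := R) (M := J → R)).comp (ExteriorAlgebra.map u) =
    ExteriorAlgebra.algebraMapInv := by
    apply ExteriorAlgebra.hom_ext
    ext v; simp [ExteriorAlgebra.algebraMapInv]
  exact DFunLike.congr_fun this h
theorem eps_th (w : Equiv.Perm J) (h : Q R J) : eps R J (th R w h) = eps R J h := eps_G _ h
theorem eps_dg (a : J → R) (h : Q R J) : eps R J (dg a h) = eps R J h := eps_G _ h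
theorem th_vac (w : Equiv.Perm J) : th R w 1 = 1 := G_one _
theorem dg_vac (a : J → R) : dg a 1 = 1 := G_one _
theorem dd_vac (p : J) : dd R p 1 = 0 := D_one _

theorem eps_eQ (p q : J) (h : Q R J) (hh : dd R p h = 0) : eps R J (eQ R p q h) = eps R J h := by
  have : eQ R p q h = dg (za R p q) h - xx R p (xx R q (dg (za R p q) h)) := by
    have : eQ R p q h = ((1 : Module.End R (Q R J)) - xx R p * xx R q) (dg (za R p q) (((1 : Module.End R (Q R J)) + dd R q * dd R p) h)) := rfl
    rw [this, LinearMap.add_apply, Module.End.mul_apply, hh, map_zero, Module.End.one_apply, add_zero]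
    rfl
  rw [this, map_sub, eps_xx, sub_zero, eps_dg]

/-- twisting by an even/odd count of letters -/
theorem dg_c {a : J → R} (ha : ∀ j, a j * a j = 1) (p : J) :
    dg a * (xx R p - dd R p) = a p • ((xx R p - dd R p) * dg a) := by
  have : dg a * dd R p = a p • (dd R p * dg a) := by rw [dd_dg, smul_smul, ha, one_smul]
  rw [mul_sub, dg_xx, this, sub_mul, smul_sub]
theorem dg_cb {a : J → R} (ha : ∀ j, a j * a j = 1) (p : J) :
    dg a * (xx R p + dd R p) = a p • ((xx R p + dd R p) * dg a) := by
  have : dg a * dd R p = a p • (dd R p * dg a) := by rw [dd_dg, smul_smul, ha, one_smul]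
  rw [mul_add, dg_xx, this, add_mul, smul_add]

theorem cl1 {B : Type*} [Ring B] {x d : B} (h1 : x * x = 0) (h2 : d * d = 0) (h : d * x = 1 - x * d) :
    (x - d) * (x - d) = -1 := by
  simp only [mul_sub, sub_mul, h1, h2, h]; abel
theorem cl2 {B : Type*} [Ring B] {x d : B} (h1 : x * x = 0) (h2 : d * d = 0) (h : d * x = 1 - x * d) :
    (x + d) * (x + d) = 1 := by
  simp only [mul_add, add_mul, h1, h2, h]; abel
theorem cl3 {B : Type*} [Ring B] {x d x' d' : B} (h1 : x * x' = -(x' * x)) (h2 : d * d' = -(d' * d))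
    (h : d * x' = -(x' * d)) (h' : d' * x = -(x * d')) :
    (x - d) * (x' - d') = -((x' - d') * (x - d)) := by
  simp only [mul_sub, sub_mul, h1, h2, h, h']; abel
theorem cl4 {B : Type*} [Ring B] {x d x' d' : B} (h1 : x * x' = -(x' * x)) (h2 : d * d' = -(d' * d))
    (h : d * x' = -(x' * d)) (h' : d' * x = -(x * d')) :
    (x + d) * (x' + d') = -((x' + d') * (x + d)) := by
  simp only [mul_add, add_mul, h1, h2, h, h']; abel
theorem cl5 {B : Type*} [Ring B] {x d x' d' : B} (h1 : x * x' = -(x' * x)) (h2 : d * d' = -(d' * d))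
    (h : d * x' = -(x' * d)) (h' : d' * x = -(x * d')) :
    (x - d) * (x' + d') = -((x' + d') * (x - d)) := by
  simp only [mul_add, add_mul, mul_sub, sub_mul, h1, h2, h, h']; abel

variable (r t : ℕ)
/-- embedding of the first symmetric group -/
def il : Equiv.Perm (Fin r) →* Equiv.Perm (Fin r ⊕ Fin t) :=
  (Equiv.Perm.sumCongrHom (Fin r) (Fin t)).comp (MonoidHom.inl _ _)
def ir : Equiv.Perm (Fin t) →* Equiv.Perm (Fin r ⊕ Fin t) :=
  (Equiv.Perm.sumCongrHom (Fin r) (Fin t)).comp (MonoidHom.inr _ _)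
variable {r t}
theorem il_inl (w) (i : Fin r) : il r t w (Sum.inl i) = Sum.inl (w i) := rfl
theorem il_inr (w) (i : Fin t) : il r t w (Sum.inr i) = Sum.inr i := rfl
theorem ir_inl (w) (i : Fin r) : ir r t w (Sum.inl i) = Sum.inl i := rfl
theorem ir_inr (w) (i : Fin t) : ir r t w (Sum.inr i) = Sum.inr (w i) := rfl
theorem il_ir (w v) : il r t w * ir r t v = ir r t v * il r t w := by
  ext x; rcases x with x | x <;> rfl
theorem il_swap (i j : Fin r) : il r t (Equiv.swap i j) = Equiv.swap (Sum.inl i) (Sum.inl j) := by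
  ext x; rcases x with x | x <;> simp only [il_inl, il_inr, Equiv.swap_apply_def] <;> split_ifs <;> simp_all
theorem ir_swap (i j : Fin t) : ir r t (Equiv.swap i j) = Equiv.swap (Sum.inr i) (Sum.inr j) := by
  ext x; rcases x with x | x <;> simp only [ir_inl, ir_inr, Equiv.swap_apply_def] <;> split_ifs <;> simp_all

theorem sw_fix {n : ℕ} [NeZero n] {i : ℕ} (h : 0 < i) : sw n i (i + 1) 0 = 0 := by
  unfold sw; split_ifs with h'
  · apply Equiv.swap_apply_of_ne_of_ne <;> intro h'' <;> simp [Fin.ext_iff] at h'' <;> omega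
  · rfl

theorem braid_aux {B : Type*} [Ring B] {a b e e2 : B} (ha : a * a = 1) (hb : b * b = 1) (hab : a * b = b * a)
    (h2 : a * b * e = e2 * (a * b)) (h3 : e * e2 * (a * b) = e * e2) (h4 : (a * b) * (e * e2) = e * e2) :
    e * a * b * e * a = e * a * b * e * b ∧ a * e * a * b * e = b * e * a * b * e := by
  have k : e * a * b * e = e * e2 := by
    rw [mul_assoc, mul_assoc, ← mul_assoc a, h2, ← mul_assoc, h3]
  have k2 : a * b * a = b := by rw [hab, mul_assoc, ha, mul_one]
  have k3 : a * b * b = a := by rw [mul_assoc, hb, mul_one]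
  constructor
  · rw [k]
    calc e * e2 * a = e * e2 * (a * b) * a := by rw [h3]
      _ = e * e2 * (a * b * a) := by rw [mul_assoc]
      _ = _ := by rw [k2]
  · have : ∀ x, x * e * a * b * e = x * (e * e2) := by intro x; rw [← k]; simp only [mul_assoc]
    rw [this, this]
    calc a * (e * e2) = a * (a * b * (e * e2)) := by rw [h4]
      _ = (a * a) * b * (e * e2) := by simp only [mul_assoc]
      _ = _ := by rw [ha, one_mul]

theorem sw_eq {n : ℕ} [NeZero n] (h : 1 < n) : ∃ i : Fin n, i ≠ 0 ∧ sw n 0 1 = Equiv.swap 0 i := by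
  refine ⟨⟨1, h⟩, by simp [Fin.ext_iff], ?_⟩
  unfold sw; rw [dif_pos ⟨by omega, h⟩]; rfl

variable (R r t) in
theorem PR0 [NeZero r] [NeZero t] : PR (xx R (Sum.inl 0 : Fin r ⊕ Fin t)) (xx R (Sum.inr 0)) (dd R (Sum.inl 0)) (dd R (Sum.inr 0))
    (dg (za R (Sum.inl 0) (Sum.inr 0))) := PRq (R := R) (p := (Sum.inl 0 : Fin r ⊕ Fin t)) (q := Sum.inr 0) (by simp)

theorem braidQ [NeZero r] [NeZero t] {i : Fin r} {j : Fin t} (hi : i ≠ 0) (hj : j ≠ 0) :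
    let a := th R (il r t (Equiv.swap 0 i))
    let b := th R (ir r t (Equiv.swap 0 j))
    let e := eQ R (Sum.inl 0 : Fin r ⊕ Fin t) (Sum.inr 0)
    e * a * b * e * a = e * a * b * e * b ∧ a * e * a * b * e = b * e * a * b * e :=
  have w : (il r t (Equiv.swap 0 i)) * ir r t (Equiv.swap 0 j) = Equiv.swap (Sum.inl 0) (Sum.inl i) * Equiv.swap (Sum.inr 0) (Sum.inr j) := by
    rw [il_swap, ir_swap]
  braid_aux (a := th R (il r t (Equiv.swap 0 i))) (b := th R (ir r t (Equiv.swap 0 j)))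
    (e := eQ R (Sum.inl 0) (Sum.inr 0)) (e2 := eQ R (Sum.inl i) (Sum.inr j))
    (by rw [← map_mul, ← map_mul, Equiv.swap_mul_self, map_one, map_one])
    (by rw [← map_mul, ← map_mul, Equiv.swap_mul_self, map_one, map_one])
    (by rw [← map_mul, ← map_mul, il_ir])
    (by rw [← map_mul, eQ_th]; simp [il_inl, ir_inl, il_inr, ir_inr])
    (by rw [← map_mul, w]
        exact (eQ_disj_th (by simp) (by simp) (by simpa using hi.symm) (by simp) (by simp) (by simpa using hj.symm)).2)
    (by rw [← map_mul, w]
        exact (eQ_disj_th (by simp) (by simp) (by simpa using hi.symm) (by simp) (by simp) (by simpa using hj.symm)).1)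

variable (R r t) in
/-- The fermionic representation. -/
def dQ [NeZero r] [NeZero t] : WBC R (Module.End R (Q R (Fin r ⊕ Fin t))) r t where
  σ := (th R).comp (il r t)
  σb := (th R).comp (ir r t)
  c i := xx R (Sum.inl i) - dd R (Sum.inl i)
  cb j := xx R (Sum.inr j) + dd R (Sum.inr j)
  e := eQ R (Sum.inl 0) (Sum.inr 0)
  c_sq i := cl1 (xx_sq _) (dd_sq _) (dd_xx _)
  c_anti i j h := cl3 (xx_xx _ _) (dd_dd _ _) (dd_xx_ne (by simpa using h)) (dd_xx_ne (by simpa using h.symm))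
  c_conj w i := by
    show th R (il r t w) * _ * th R (il r t w⁻¹) = _
    rw [mul_sub, th_xx, th_dd, ← sub_mul, mul_assoc, ← map_mul, ← map_mul, mul_inv_cancel, map_one, map_one, mul_one]; rfl
  cb_sq i := cl2 (xx_sq _) (dd_sq _) (dd_xx _)
  cb_anti i j h := cl4 (xx_xx _ _) (dd_dd _ _) (dd_xx_ne (by simpa using h)) (dd_xx_ne (by simpa using h.symm))
  cb_conj w i := by
    show th R (ir r t w) * _ * th R (ir r t w⁻¹) = _
    rw [mul_add, th_xx, th_dd, ← add_mul, mul_assoc, ← map_mul, ← map_mul, mul_inv_cancel, map_one, map_one, mul_one]; rfl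
  comm_σσb w v := by
    show th R (il r t w) * th R (ir r t v) = th R (ir r t v) * th R (il r t w) 
    rw [← map_mul, ← map_mul, il_ir]
  comm_σcb w j := by
    show th R (il r t w) * _ = _ * th R (il r t w)
    rw [mul_add, th_xx, th_dd, ← add_mul]; rfl
  comm_σbc w j := by
    show th R (ir r t w) * _ = _ * th R (ir r t w)
    rw [mul_sub, th_xx, th_dd, ← sub_mul]; rfl
  anti_ccb i j := cl5 (xx_xx _ _) (dd_dd _ _) (dd_xx_ne (by simp)) (dd_xx_ne (by simp))
  e_c1 h1 h2 := (PR0 R r t).e2.trans (PR0 R r t).e2'.symm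
  c1_e h1 h2 := (PR0 R r t).e1.trans (PR0 R r t).e1'.symm
  e_sq := (PR0 R r t).sq
  e_s_e h := by
    obtain ⟨i, hi, h⟩ := sw_eq h
    show _ * th R (il r t _) * _ = _
    rw [h, il_swap]; exact eQ_s1 (by simp) (by simpa using hi) (by simp)
  e_sb_e h := by
    obtain ⟨i, hi, h⟩ := sw_eq h
    show _ * th R (ir r t _) * _ = _
    rw [h, ir_swap]; exact eQ_s2 (by simp) (by simp) (by simpa using hi)
  s_e_comm i h h' := by
    show th R (il r t _) * _ = _ * th R (il r t _)
    rw [eQ_th, il_inl, il_inr, sw_fix h]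
  sb_e_comm i h h' := by
    show th R (ir r t _) * _ = _ * th R (ir r t _)
    rw [eQ_th, ir_inl, ir_inr, sw_fix h]
  braid1 h h' := by
    obtain ⟨i, hi, h⟩ := sw_eq h
    obtain ⟨j, hj, h'⟩ := sw_eq h'
    rw [h, h']
    exact (braidQ hi hj).1
  braid2 h h' := by
    obtain ⟨i, hi, h⟩ := sw_eq h
    obtain ⟨j, hj, h'⟩ := sw_eq h'
    rw [h, h']
    exact (braidQ hi hj).2
  c_e_comm i h := by
    have h1 : (Sum.inl i : Fin r ⊕ Fin t) ≠ Sum.inl 0 := fun h' => h (by rw [Sum.inl.inj h']; rfl)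
    have h2 : (Sum.inl i : Fin r ⊕ Fin t) ≠ Sum.inr 0 := by simp
    rw [sub_mul, xx_eQ h1 h2, dd_eQ h1 h2, mul_sub]
  cb_e_comm i h := by
    have h1 : (Sum.inr i : Fin r ⊕ Fin t) ≠ Sum.inr 0 := fun h' => h (by rw [Sum.inr.inj h']; rfl)
    have h2 : (Sum.inr i : Fin r ⊕ Fin t) ≠ Sum.inl 0 := by simp
    rw [add_mul, xx_eQ h2 h1, dd_eQ h2 h1, mul_add]
  e_c_e h := (PR0 R r t).ece
  e_cb_e h := by
    have := (PR0 R r t).ece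
    rw [(PR0 R r t).e2, ← (PR0 R r t).e2'] at this
    exact this

end QP

namespace XP
variable {R : Type} [CommRing R] {J : Type} [Fintype J] [DecidableEq J] {Λ : Type} [Fintype Λ] [DecidableEq Λ]

def upd (x : J → Λ) (p q : J) (z : Λ) : J → Λ := fun j => if j = p ∨ j = q then z else x j

variable (R J Λ) in
def PP : Equiv.Perm J →* Module.End R ((J → Λ) → R) where
  toFun w :=
    { toFun := fun f x => f (fun j => x (w j))
      map_add' := fun f g => rfl
      map_smul' := fun c f => rfl }
  map_one' := rfl
  map_mul' v w := rfl

theorem PP_apply (w : Equiv.Perm J) (f : (J → Λ) → R) (x) : PP R J Λ w f x = f (fun j => x (w j)) := rfl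

variable (R Λ) in
def eX (p q : J) : Module.End R ((J → Λ) → R) where
  toFun := fun f x => if x p = x q then ∑ z, f (upd x p q z) else 0
  map_add' := fun f g => by
    ext x; simp only [Pi.add_apply]; split_ifs <;> simp [Finset.sum_add_distrib]
  map_smul' := fun c f => by
    ext x; simp only [Pi.smul_apply, RingHom.id_apply]; split_ifs <;> simp [Finset.mul_sum]

theorem eX_apply (p q : J) (f : (J → Λ) → R) (x) : eX R Λ p q f x = if x p = x q then ∑ z, f (upd x p q z) else 0 := rfl

theorem PP_eX (w : Equiv.Perm J) (p q : J) : PP R J Λ w * eX R Λ p q = eX R Λ (w p) (w q) * PP R J Λ w := by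
  refine LinearMap.ext fun f => funext fun x => ?_
  simp only [Module.End.mul_apply, PP_apply, eX_apply]
  congr 1
  refine Finset.sum_congr rfl fun z _ => ?_
  congr 1; ext j; simp [upd]

theorem eX_s1 {p q p' : J} (h : p ≠ q) (h1 : p' ≠ p) (h2 : p' ≠ q) :
    eX R Λ p q * PP R J Λ (Equiv.swap p p') * eX R Λ p q = eX R Λ p q := by
  refine LinearMap.ext fun f => funext fun x => ?_
  simp only [Module.End.mul_apply, PP_apply, eX_apply]
  split_ifs with hx
  · rw [Finset.sum_eq_single (x p')]
    · rw [if_pos]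
      · refine Finset.sum_congr rfl fun z _ => ?_
        congr 1; ext j; simp only [upd, Equiv.swap_apply_def]; grind
      · simp only [upd, Equiv.swap_apply_def]; grind
    · intro z _ hz
      rw [if_neg]
      simp only [upd, Equiv.swap_apply_def]; grind
    · simp
  · rfl

theorem eX_symm (p q : J) : eX R Λ p q = eX R Λ q p := by
  refine LinearMap.ext fun f => funext fun x => ?_
  simp only [eX_apply, eq_comm (a := x p)]
  congr 1
  refine Finset.sum_congr rfl fun z _ => ?_
  congr 1; ext j; simp only [upd]; grind

theorem eX_s2 {p q q' : J} (h : p ≠ q) (h1 : q' ≠ p) (h2 : q' ≠ q) :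
    eX R Λ p q * PP R J Λ (Equiv.swap q q') * eX R Λ p q = eX R Λ p q := by
  rw [eX_symm p q]; exact eX_s1 h.symm h2 h1

theorem eX_disj {p q p' q' : J} (h1 : p ≠ p') (h2 : p ≠ q') (h3 : q ≠ p') (h4 : q ≠ q') (f x) :
    (eX R Λ p q * eX R Λ p' q') f x = if x p = x q ∧ x p' = x q' then
      ∑ z, ∑ z', f (upd (upd x p q z) p' q' z') else 0 := by
  simp only [Module.End.mul_apply, eX_apply]
  have : ∀ z, (upd x p q z p' = upd x p q z q') ↔ x p' = x q' := by
    intro z; simp only [upd]; grind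
  simp only [this]
  by_cases a : x p = x q <;> by_cases b : x p' = x q' <;> simp [a, b]

theorem eX_comm {p q p' q' : J} (h1 : p ≠ p') (h2 : p ≠ q') (h3 : q ≠ p') (h4 : q ≠ q') :
    eX R Λ p q * eX R Λ p' q' = eX R Λ p' q' * eX R Λ p q := by
  refine LinearMap.ext fun f => funext fun x => ?_
  rw [eX_disj h1 h2 h3 h4, eX_disj h1.symm h3.symm h2.symm h4.symm, Finset.sum_comm]
  simp only [and_comm (a := x p = x q)]
  congr 1
  refine Finset.sum_congr rfl fun z _ => Finset.sum_congr rfl fun z' _ => ?_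
  congr 1; ext j; simp only [upd]; grind

theorem eX_disj_th {p q p' q' : J} (h : p ≠ q) (h' : p' ≠ q') (h1 : p ≠ p') (h2 : p ≠ q') (h3 : q ≠ p') (h4 : q ≠ q') :
    PP R J Λ (Equiv.swap p p' * Equiv.swap q q') * (eX R Λ p q * eX R Λ p' q') = eX R Λ p q * eX R Λ p' q' ∧
    eX R Λ p q * eX R Λ p' q' * PP R J Λ (Equiv.swap p p' * Equiv.swap q q') = eX R Λ p q * eX R Λ p' q' := by
  have key : eX R Λ p q * eX R Λ p' q' * PP R J Λ (Equiv.swap p p' * Equiv.swap q q') = eX R Λ p q * eX R Λ p' q' := by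
    refine LinearMap.ext fun f => funext fun x => ?_
    rw [Module.End.mul_apply, eX_disj h1 h2 h3 h4, eX_disj h1 h2 h3 h4, Finset.sum_comm]
    congr 1
    refine Finset.sum_congr rfl fun z _ => Finset.sum_congr rfl fun z' _ => ?_
    rw [PP_apply]
    congr 1; ext j; simp only [upd, Equiv.Perm.mul_apply, Equiv.swap_apply_def]; grind
  refine ⟨?_, key⟩
  rw [← mul_assoc, PP_eX, mul_assoc, PP_eX, ← mul_assoc]
  have w1 : (Equiv.swap p p' * Equiv.swap q q') p = p' := by simp [Equiv.swap_apply_of_ne_of_ne h h2]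
  have w2 : (Equiv.swap p p' * Equiv.swap q q') q = q' := by simp [Equiv.swap_apply_of_ne_of_ne h2.symm h'.symm]
  have w3 : (Equiv.swap p p' * Equiv.swap q q') p' = p := by simp [Equiv.swap_apply_of_ne_of_ne h3.symm h']
  have w4 : (Equiv.swap p p' * Equiv.swap q q') q' = q := by simp [Equiv.swap_apply_of_ne_of_ne h.symm h3]
  rw [w1, w2, w3, w4, eX_comm h1.symm h3.symm h2.symm h4.symm, key]

open QP TensorProduct

variable {r t : ℕ}

theorem braidX [NeZero r] [NeZero t] {i : Fin r} {j : Fin t} (hi : i ≠ 0) (hj : j ≠ 0) :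
    let a := PP R _ Λ (il r t (Equiv.swap 0 i))
    let b := PP R _ Λ (ir r t (Equiv.swap 0 j))
    let e := eX R Λ (Sum.inl 0 : Fin r ⊕ Fin t) (Sum.inr 0)
    e * a * b * e * a = e * a * b * e * b ∧ a * e * a * b * e = b * e * a * b * e :=
  have w : (il r t (Equiv.swap 0 i)) * ir r t (Equiv.swap 0 j) = Equiv.swap (Sum.inl 0) (Sum.inl i) * Equiv.swap (Sum.inr 0) (Sum.inr j) := by
    rw [il_swap, ir_swap]
  braid_aux (a := PP R _ Λ (il r t (Equiv.swap 0 i))) (b := PP R _ Λ (ir r t (Equiv.swap 0 j)))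
    (e := eX R Λ (Sum.inl 0) (Sum.inr 0)) (e2 := eX R Λ (Sum.inl i) (Sum.inr j))
    (by rw [← map_mul, ← map_mul, Equiv.swap_mul_self, map_one, map_one])
    (by rw [← map_mul, ← map_mul, Equiv.swap_mul_self, map_one, map_one])
    (by rw [← map_mul, ← map_mul, il_ir])
    (by rw [← map_mul, PP_eX]; simp [il_inl, ir_inl, il_inr, ir_inr])
    (by rw [← map_mul, w]
        exact (eX_disj_th (by simp) (by simp) (by simpa using hi.symm) (by simp) (by simp) (by simpa using hj.symm)).2)
    (by rw [← map_mul, w]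
        exact (eX_disj_th (by simp) (by simp) (by simpa using hi.symm) (by simp) (by simp) (by simpa using hj.symm)).1)

variable (R r t Λ) in
abbrev TT := Module.End R ((Fin r ⊕ Fin t → Λ) → R) ⊗[R] Module.End R (Q R (Fin r ⊕ Fin t))

variable (R r t Λ) in
/-- The tensor representation. -/
def dT [NeZero r] [NeZero t] : WBC R (TT R Λ r t) r t where
  σ := { toFun := fun w => PP R _ Λ (il r t w) ⊗ₜ (dQ R r t).σ w
         map_one' := by rw [map_one, map_one, map_one]; rfl
         map_mul' := fun v w => by rw [map_mul, map_mul, map_mul, Algebra.TensorProduct.tmul_mul_tmul] }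
  σb := { toFun := fun w => PP R _ Λ (ir r t w) ⊗ₜ (dQ R r t).σb w
          map_one' := by rw [map_one, map_one, map_one]; rfl
          map_mul' := fun v w => by rw [map_mul, map_mul, map_mul, Algebra.TensorProduct.tmul_mul_tmul] }
  c i := 1 ⊗ₜ (dQ R r t).c i
  cb j := 1 ⊗ₜ (dQ R r t).cb j
  e := eX R Λ (Sum.inl 0) (Sum.inr 0) ⊗ₜ (dQ R r t).e
  c_sq i := by
    rw [Algebra.TensorProduct.tmul_mul_tmul, (dQ R r t).c_sq, one_mul, TensorProduct.tmul_neg]; rfl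
  c_anti i j h := by
    rw [Algebra.TensorProduct.tmul_mul_tmul, (dQ R r t).c_anti _ _ h, one_mul, TensorProduct.tmul_neg,
      Algebra.TensorProduct.tmul_mul_tmul, one_mul]
  c_conj w i := by
    simp only [MonoidHom.coe_mk, OneHom.coe_mk, Algebra.TensorProduct.tmul_mul_tmul, (dQ R r t).c_conj]
    rw [mul_one, ← map_mul, ← map_mul, mul_inv_cancel, map_one, map_one]
  cb_sq i := by
    rw [Algebra.TensorProduct.tmul_mul_tmul, (dQ R r t).cb_sq, one_mul]; rfl
  cb_anti i j h := by
    rw [Algebra.TensorProduct.tmul_mul_tmul, (dQ R r t).cb_anti _ _ h, one_mul, TensorProduct.tmul_neg,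
      Algebra.TensorProduct.tmul_mul_tmul, one_mul]
  cb_conj w i := by
    simp only [MonoidHom.coe_mk, OneHom.coe_mk, Algebra.TensorProduct.tmul_mul_tmul, (dQ R r t).cb_conj]
    rw [mul_one, ← map_mul, ← map_mul, mul_inv_cancel, map_one, map_one]
  comm_σσb w v := by
    simp only [MonoidHom.coe_mk, OneHom.coe_mk, Algebra.TensorProduct.tmul_mul_tmul, (dQ R r t).comm_σσb]
    rw [← map_mul, ← map_mul, il_ir]
  comm_σcb w j := by
    simp only [MonoidHom.coe_mk, OneHom.coe_mk, Algebra.TensorProduct.tmul_mul_tmul, (dQ R r t).comm_σcb, one_mul, mul_one]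
  comm_σbc w j := by
    simp only [MonoidHom.coe_mk, OneHom.coe_mk, Algebra.TensorProduct.tmul_mul_tmul, (dQ R r t).comm_σbc, one_mul, mul_one]
  anti_ccb i j := by
    rw [Algebra.TensorProduct.tmul_mul_tmul, (dQ R r t).anti_ccb, one_mul, TensorProduct.tmul_neg,
      Algebra.TensorProduct.tmul_mul_tmul, one_mul]
  e_c1 h1 h2 := by
    rw [Algebra.TensorProduct.tmul_mul_tmul, Algebra.TensorProduct.tmul_mul_tmul, (dQ R r t).e_c1]
  c1_e h1 h2 := by
    rw [Algebra.TensorProduct.tmul_mul_tmul, Algebra.TensorProduct.tmul_mul_tmul, (dQ R r t).c1_e]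
  e_sq := by
    rw [Algebra.TensorProduct.tmul_mul_tmul, (dQ R r t).e_sq, TensorProduct.tmul_zero]
  e_s_e h := by
    simp only [MonoidHom.coe_mk, OneHom.coe_mk, Algebra.TensorProduct.tmul_mul_tmul, (dQ R r t).e_s_e h]
    obtain ⟨i, hi, h⟩ := sw_eq h
    rw [h, il_swap, eX_s1 (by simp) (by simpa using hi) (by simp)]
  e_sb_e h := by
    simp only [MonoidHom.coe_mk, OneHom.coe_mk, Algebra.TensorProduct.tmul_mul_tmul, (dQ R r t).e_sb_e h]
    obtain ⟨i, hi, h⟩ := sw_eq h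
    rw [h, ir_swap, eX_s2 (by simp) (by simp) (by simpa using hi)]
  s_e_comm i h h' := by
    simp only [MonoidHom.coe_mk, OneHom.coe_mk, Algebra.TensorProduct.tmul_mul_tmul, (dQ R r t).s_e_comm i h h']
    rw [PP_eX, il_inl, il_inr, sw_fix h]
  sb_e_comm i h h' := by
    simp only [MonoidHom.coe_mk, OneHom.coe_mk, Algebra.TensorProduct.tmul_mul_tmul, (dQ R r t).sb_e_comm i h h']
    rw [PP_eX, ir_inl, ir_inr, sw_fix h]
  braid1 h h' := by
    simp only [MonoidHom.coe_mk, OneHom.coe_mk, Algebra.TensorProduct.tmul_mul_tmul, (dQ R r t).braid1 h h']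
    obtain ⟨i, hi, h⟩ := sw_eq h
    obtain ⟨j, hj, h'⟩ := sw_eq h'
    rw [h, h', (braidX hi hj).1]
  braid2 h h' := by
    simp only [MonoidHom.coe_mk, OneHom.coe_mk, Algebra.TensorProduct.tmul_mul_tmul, (dQ R r t).braid2 h h']
    obtain ⟨i, hi, h⟩ := sw_eq h
    obtain ⟨j, hj, h'⟩ := sw_eq h'
    rw [h, h', (braidX hi hj).2]
  c_e_comm i h := by
    rw [Algebra.TensorProduct.tmul_mul_tmul, Algebra.TensorProduct.tmul_mul_tmul, (dQ R r t).c_e_comm i h, one_mul, mul_one]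
  cb_e_comm i h := by
    rw [Algebra.TensorProduct.tmul_mul_tmul, Algebra.TensorProduct.tmul_mul_tmul, (dQ R r t).cb_e_comm i h, one_mul, mul_one]
  e_c_e h := by
    rw [Algebra.TensorProduct.tmul_mul_tmul, Algebra.TensorProduct.tmul_mul_tmul, (dQ R r t).e_c_e, TensorProduct.tmul_zero]
  e_cb_e h := by
    rw [Algebra.TensorProduct.tmul_mul_tmul, Algebra.TensorProduct.tmul_mul_tmul, (dQ R r t).e_cb_e, TensorProduct.tmul_zero]

end XP

namespace WP
open QP
theorem perm_gen {α : Type*} [DecidableEq α] [Finite α] (P : α → Prop) [DecidablePred P] (M : Submonoid (Equiv.Perm α))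
    (hM : ∀ i j, P i → P j → i ≠ j → Equiv.swap i j ∈ M) (w : Equiv.Perm α) (hw : ∀ i, ¬ P i → w i = i) : w ∈ M := by
  have h1 : ∀ x, P (w x) ↔ P x := by
    intro x
    constructor
    · intro h; by_contra h'; rw [hw _ h'] at h; exact h' h
    · intro h; by_contra h'
      have := hw _ h'
      have := w.injective this
      rw [this] at h'; exact h' h
  have h2 : Equiv.Perm.ofSubtype (w.subtypePerm h1) = w := Equiv.Perm.ofSubtype_subtypePerm h1 (fun x hx => by
    by_contra h; exact hx (hw x h))
  rw [← h2]
  generalize w.subtypePerm h1 = u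
  induction u using Equiv.Perm.swap_induction_on with
  | one => rw [map_one]; exact M.one_mem
  | swap_mul f x y hxy ih =>
    rw [map_mul, Equiv.Perm.ofSubtype_swap_eq]
    exact M.mul_mem (hM _ _ x.2 y.2 (fun h => hxy (Subtype.ext h))) ih

theorem exists_perm {n : ℕ} [NeZero n] {x i i' : Fin n} (hx : x ≠ 0) (h : i ≠ i') : ∃ u : Equiv.Perm (Fin n), u 0 = i ∧ u x = i' := by
  refine ⟨Equiv.swap 0 i * Equiv.swap x (Equiv.swap 0 i i'), ?_, ?_⟩
  · rw [Equiv.Perm.mul_apply, Equiv.swap_apply_of_ne_of_ne hx.symm, Equiv.swap_apply_left]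
    intro h'
    have := congrArg (Equiv.swap 0 i) h'
    simp at this
    exact h this
  · simp

variable {R A : Type} [CommRing R] [Ring A] [Algebra R A] {r t : ℕ} (d : WBC R A r t)

/-- the joint hom -/
def G : Equiv.Perm (Fin r) × Equiv.Perm (Fin t) →* A where
  toFun g := d.σ g.1 * d.σb g.2
  map_one' := by simp
  map_mul' g h := by
    simp only [Prod.fst_mul, Prod.snd_mul, map_mul]
    rw [mul_assoc, mul_assoc, ← mul_assoc (d.σ h.1), d.comm_σσb, mul_assoc]

theorem G1 (w) : G d (w, 1) = d.σ w := by simp [G]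
theorem G2 (w) : G d (1, w) = d.σb w := by simp [G]

theorem G_inv (g) : G d g * G d g⁻¹ = 1 := by rw [← map_mul, mul_inv_cancel, map_one]
theorem G_inv' (g) : G d g⁻¹ * G d g = 1 := by rw [← map_mul, inv_mul_cancel, map_one]

theorem G_c (g i) : G d g * d.c i = d.c (g.1 i) * G d g := by
  have h : d.σ g.1 * d.c i = d.c (g.1 i) * d.σ g.1 := by
    rw [← d.c_conj, mul_assoc _ _ (d.σ g.1), ← map_mul, inv_mul_cancel, map_one, mul_one]
  show d.σ g.1 * d.σb g.2 * _ = _ * (d.σ g.1 * d.σb g.2)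
  rw [mul_assoc, d.comm_σbc, ← mul_assoc, h, mul_assoc]
theorem G_cb (g i) : G d g * d.cb i = d.cb (g.2 i) * G d g := by
  have h : d.σb g.2 * d.cb i = d.cb (g.2 i) * d.σb g.2 := by
    rw [← d.cb_conj, mul_assoc _ _ (d.σb g.2), ← map_mul, inv_mul_cancel, map_one, mul_one]
  show d.σ g.1 * d.σb g.2 * _ = _ * (d.σ g.1 * d.σb g.2)
  rw [mul_assoc, h, ← mul_assoc, d.comm_σcb, mul_assoc]

theorem swap_ind {n : ℕ} [NeZero n] (M : Submonoid (Equiv.Perm (Fin n))) (h : ∀ i, 0 < i → i + 1 < n → sw n i (i+1) ∈ M)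
    (w : Equiv.Perm (Fin n)) (hw : w 0 = 0) : w ∈ M := by
  have key : ∀ (m : ℕ) (i : ℕ) (hi : 0 < i) (hj : i + m + 1 < n), Equiv.swap (⟨i, by omega⟩ : Fin n) ⟨i + m + 1, hj⟩ ∈ M := by
    intro m
    induction m with
    | zero =>
      intro i hi hj
      have := h i hi hj
      rwa [sw, dif_pos ⟨by omega, hj⟩] at this
    | succ m ih =>
      intro i hi hj
      have h1 := ih i hi (by omega)
      have h2 := h (i+m+1) (by omega) (by omega)
      rw [sw, dif_pos ⟨by omega, by omega⟩] at h2
      have e : Equiv.swap (⟨i, by omega⟩ : Fin n) ⟨i + (m + 1) + 1, hj⟩ =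
         Equiv.swap (⟨i+m+1, by omega⟩ : Fin n) ⟨i+m+1+1, hj⟩ * Equiv.swap (⟨i, by omega⟩ : Fin n) ⟨i + m + 1, by omega⟩ * Equiv.swap (⟨i+m+1, by omega⟩ : Fin n) ⟨i+m+1+1, hj⟩ := by
        rw [Equiv.swap_mul_swap_mul_swap, Equiv.swap_comm]
        · rfl
        · simp only [ne_eq, Fin.mk.injEq]; omega
        · simp only [ne_eq, Fin.mk.injEq]; omega
      rw [e]; exact M.mul_mem (M.mul_mem h2 h1) h2
  refine perm_gen (fun i => i ≠ 0) M ?_ w (fun i hi => by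
    simp only [ne_eq, not_not] at hi; rw [hi, hw])
  intro i j hi hj hij
  have hi' : 0 < i.1 := Nat.pos_of_ne_zero fun h => hi (Fin.ext h)
  have hj' : 0 < j.1 := Nat.pos_of_ne_zero fun h => hj (Fin.ext h)
  rcases lt_or_gt_of_ne hij with h | h
  · have h : i.1 < j.1 := h
    have := key (j.1 - i.1 - 1) i.1 hi' (by omega)
    convert this; omega
  · have h : j.1 < i.1 := h
    have := key (i.1 - j.1 - 1) j.1 hj' (by omega)
    rw [Equiv.swap_comm]
    convert this; omega

variable [NeZero r] [NeZero t]

theorem G_e_comm (g) (h1 : g.1 0 = 0) (h2 : g.2 0 = 0) : G d g * d.e = d.e * G d g := by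
  have k1 : d.σ g.1 * d.e = d.e * d.σ g.1 := by
    have := swap_ind ((Submonoid.centralizer {d.e}).comap d.σ) ?_ g.1 h1
    · simp only [Submonoid.mem_comap, Submonoid.mem_centralizer_iff, Set.mem_singleton_iff, forall_eq] at this
      exact this.symm
    · intro i hi hj
      simp only [Submonoid.mem_comap, Submonoid.mem_centralizer_iff, Set.mem_singleton_iff, forall_eq]
      exact (d.s_e_comm i hi hj).symm
  have k2 : d.σb g.2 * d.e = d.e * d.σb g.2 := by
    have := swap_ind ((Submonoid.centralizer {d.e}).comap d.σb) ?_ g.2 h2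
    · simp only [Submonoid.mem_comap, Submonoid.mem_centralizer_iff, Set.mem_singleton_iff, forall_eq] at this
      exact this.symm
    · intro i hi hj
      simp only [Submonoid.mem_comap, Submonoid.mem_centralizer_iff, Set.mem_singleton_iff, forall_eq]
      exact (d.sb_e_comm i hi hj).symm
  show d.σ g.1 * d.σb g.2 * _ = _ * (d.σ g.1 * d.σb g.2)
  rw [mul_assoc, k2, ← mul_assoc, k1, mul_assoc]

/-- `e_{i,j}` (0-based). -/
def F (i : Fin r) (j : Fin t) : A :=
  G d (Equiv.swap 0 i, Equiv.swap 0 j) * d.e * G d (Equiv.swap 0 i, Equiv.swap 0 j)⁻¹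

theorem F_conj (g) : F d (g.1 0) (g.2 0) = G d g * d.e * G d g⁻¹ := by
  have h := G_e_comm d ((Equiv.swap 0 (g.1 0), Equiv.swap 0 (g.2 0))⁻¹ * g) (by simp) (by simp)
  rw [F]
  set s := (Equiv.swap 0 (g.1 0), Equiv.swap 0 (g.2 0))
  rw [map_mul] at h
  calc G d s * d.e * G d s⁻¹ = G d s * (d.e * (G d s⁻¹ * G d g)) * G d g⁻¹ := by
        simp only [mul_assoc]; rw [G_inv, mul_one]
    _ = G d s * (G d s⁻¹ * G d g * d.e) * G d g⁻¹ := by rw [h]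
    _ = (G d s * G d s⁻¹) * (G d g * d.e * G d g⁻¹) := by simp only [mul_assoc]
    _ = _ := by rw [G_inv, one_mul]

theorem F00 : F d 0 0 = d.e := by
  have := F_conj d 1; simpa using this

theorem F1 (g i j) : G d g * F d i j = F d (g.1 i) (g.2 j) * G d g := by
  have h := F_conj d (g * (Equiv.swap 0 i, Equiv.swap 0 j))
  simp only [Prod.fst_mul, Prod.snd_mul, Equiv.Perm.mul_apply, Equiv.swap_apply_left] at h
  rw [h, F, mul_inv_rev, map_mul, map_mul]
  simp only [mul_assoc]; rw [G_inv', mul_one]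

/-- transport -/
theorem F_conj' (g i j) : F d (g.1 i) (g.2 j) = G d g * F d i j * G d g⁻¹ := by
  rw [F1, mul_assoc, G_inv, mul_one]

theorem F2 {i' i : Fin r} (h : i' ≠ i) (j) : d.c i' * F d i j = F d i j * d.c i' := by
  rw [F]
  set g : Equiv.Perm (Fin r) × Equiv.Perm (Fin t) := (Equiv.swap 0 i, Equiv.swap 0 j)
  have h' : g⁻¹.1 i' ≠ 0 := by
    intro h'; apply h; have := congrArg g.1 h'; simpa [g] using this
  have a : d.c i' * G d g = G d g * d.c (g⁻¹.1 i') := by rw [G_c]; simp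
  rw [mul_assoc, ← mul_assoc, a, mul_assoc, mul_assoc, mul_assoc, G_c, ← mul_assoc (d.c _), d.c_e_comm _ (fun h => h' (Fin.ext h)), mul_assoc]
theorem F2b {j' j : Fin t} (h : j' ≠ j) (i) : d.cb j' * F d i j = F d i j * d.cb j' := by
  rw [F]
  set g : Equiv.Perm (Fin r) × Equiv.Perm (Fin t) := (Equiv.swap 0 i, Equiv.swap 0 j)
  have h' : g⁻¹.2 j' ≠ 0 := by
    intro h'; apply h; have := congrArg g.2 h'; simpa [g] using this
  have a : d.cb j' * G d g = G d g * d.cb (g⁻¹.2 j') := by rw [G_cb]; simp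
  rw [mul_assoc, ← mul_assoc, a, mul_assoc, mul_assoc, mul_assoc, G_cb, ← mul_assoc (d.cb _), d.cb_e_comm _ (fun h => h' (Fin.ext h)), mul_assoc]

theorem F3 (i j) : F d i j * d.c i = F d i j * d.cb j := by
  rw [F, mul_assoc, mul_assoc, G_c, mul_assoc _ _ (d.cb j), mul_assoc, G_cb]
  have := d.e_c1 (NeZero.pos r) (NeZero.pos t)
  simp only [mul_assoc, Prod.fst_inv, Prod.snd_inv, Equiv.swap_inv, Equiv.swap_apply_right]
  rw [← mul_assoc d.e, ← mul_assoc d.e]; exact congrArg (fun x => _ * (x * _)) this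
theorem F3' (i j) : d.c i * F d i j = d.cb j * F d i j := by
  set g : Equiv.Perm (Fin r) × Equiv.Perm (Fin t) := (Equiv.swap 0 i, Equiv.swap 0 j) with hg
  have a : d.c i * G d g = G d g * d.c 0 := by rw [G_c]; simp [g]
  have b : d.cb j * G d g = G d g * d.cb 0 := by rw [G_cb]; simp [g]
  have := d.c1_e (NeZero.pos r) (NeZero.pos t)
  have h : d.c 0 * d.e = d.cb 0 * d.e := this
  rw [F, ← hg, ← mul_assoc, ← mul_assoc, a, ← mul_assoc (d.cb j), ← mul_assoc (d.cb j), b, mul_assoc _ _ d.e, h, ← mul_assoc]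

theorem Fconj_mul (g) (x z : A) : (G d g * x * G d g⁻¹) * (G d g * z * G d g⁻¹) = G d g * (x * z) * G d g⁻¹ := by
  simp only [mul_assoc]; rw [← mul_assoc (G d g⁻¹), G_inv', one_mul]

theorem F4 (i j) : F d i j * F d i j = 0 := by
  rw [F, Fconj_mul, d.e_sq, mul_zero, zero_mul]
theorem c_conj' (g i) : d.c (g.1 i) = G d g * d.c i * G d g⁻¹ := by
  rw [G_c, mul_assoc, G_inv, mul_one]
theorem cb_conj' (g i) : d.cb (g.2 i) = G d g * d.cb i * G d g⁻¹ := by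
  rw [G_cb, mul_assoc, G_inv, mul_one]
theorem G_conj' (g h) : G d (g * h * g⁻¹) = G d g * G d h * G d g⁻¹ := by
  rw [map_mul, map_mul]
theorem F4' (i j) : F d i j * d.c i * F d i j = 0 := by
  have := c_conj' d (Equiv.swap 0 i, Equiv.swap 0 j) 0
  simp only [Equiv.swap_apply_left] at this
  rw [this, F, Fconj_mul, Fconj_mul]
  have := d.e_c_e (NeZero.pos r)
  have h : d.e * d.c 0 * d.e = 0 := this
  rw [h, mul_zero, zero_mul]

theorem F5 {i i' : Fin r} (h : i ≠ i') (j) : F d i j * d.σ (Equiv.swap i i') * F d i j = F d i j := by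
  have h1 : 1 < r := by
    rcases i with ⟨i, hi⟩; rcases i' with ⟨i', hi'⟩
    simp only [ne_eq, Fin.mk.injEq] at h; omega
  have b := d.e_s_e h1
  obtain ⟨x, hx, e⟩ := sw_eq h1
  obtain ⟨u, hu0, hux⟩ := exists_perm hx h
  rw [e] at b
  have f := F_conj d (u, Equiv.swap 0 j)
  simp only [hu0, Equiv.swap_apply_left] at f
  have g := G_conj' d (u, Equiv.swap 0 j) (Equiv.swap 0 x, 1)
  have g' : (u, Equiv.swap 0 j) * (Equiv.swap 0 x, 1) * (u, Equiv.swap 0 j)⁻¹ = (Equiv.swap i i', 1) := by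
    rw [← hu0, ← hux, Equiv.swap_apply_apply]; ext <;> simp
  rw [g', G1, G1] at g
  rw [f, g, Fconj_mul, Fconj_mul, b]

theorem F5b {j j' : Fin t} (h : j ≠ j') (i) : F d i j * d.σb (Equiv.swap j j') * F d i j = F d i j := by
  have h1 : 1 < t := by
    rcases j with ⟨i, hi⟩; rcases j' with ⟨i', hi'⟩
    simp only [ne_eq, Fin.mk.injEq] at h; omega
  have b := d.e_sb_e h1
  obtain ⟨x, hx, e⟩ := sw_eq h1
  obtain ⟨u, hu0, hux⟩ := exists_perm hx h
  rw [e] at b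
  have f := F_conj d (Equiv.swap 0 i, u)
  simp only [hu0, Equiv.swap_apply_left] at f
  have g := G_conj' d (Equiv.swap 0 i, u) (1, Equiv.swap 0 x)
  have g' : (Equiv.swap 0 i, u) * (1, Equiv.swap 0 x) * (Equiv.swap 0 i, u)⁻¹ = (1, Equiv.swap j j') := by
    rw [← hu0, ← hux, Equiv.swap_apply_apply]; ext <;> simp
  rw [g', G2, G2] at g
  rw [f, g, Fconj_mul, Fconj_mul, b]

theorem F6_aux {e e2 a b : A} (ha : a * a = 1) (hb : b * b = 1) (hab : a * b = b * a) (he : a * b * e = e2 * (a * b))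
    (he' : a * b * e2 = e * (a * b))
    (b1 : e * a * b * e * a = e * a * b * e * b) (b2 : a * e * a * b * e = b * e * a * b * e) :
    e * e2 = e2 * e ∧ e * e2 * (a * b) = e * e2 := by
  have k : e * a * b * e = e * e2 * (a * b) := by rw [mul_assoc, mul_assoc, ← mul_assoc a, he, mul_assoc]
  have aba : a * b * a = b := by rw [hab, mul_assoc, ha, mul_one]
  have abb : a * b * b = a := by rw [mul_assoc, hb, mul_one]
  have h1 : e * e2 * (a * b) = e * e2 := by
    rw [k, mul_assoc _ _ a, mul_assoc _ _ b, aba, abb] at b1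
    rw [← mul_assoc, ← b1, mul_assoc, mul_assoc, hb, mul_one] 
  have h2 : (a * b) * (e * e2) = e * e2 := by
    have k' : ∀ x, x * e * a * b * e = x * (e * e2) := by
      intro x; rw [← h1, ← k]; simp only [mul_assoc]
    rw [k', k'] at b2
    rw [hab, mul_assoc, b2, ← mul_assoc, hb, one_mul]
  refine ⟨?_, h1⟩
  have h3 : (a * b) * (e * e2) = e2 * e * (a * b) := by
    rw [← mul_assoc, he, mul_assoc, he', mul_assoc]
  have abab : (a * b) * (a * b) = 1 := by rw [← mul_assoc, aba, hb]
  calc e * e2 = e * e2 * (a * b) := h1.symm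
    _ = (a * b) * (e * e2) * (a * b) := by rw [h2]
    _ = e2 * e * ((a * b) * (a * b)) := by rw [h3, mul_assoc]
    _ = e2 * e := by rw [abab, mul_one]

theorem F6 {i i' : Fin r} {j j' : Fin t} (hi : i ≠ i') (hj : j ≠ j') :
    F d i j * F d i' j' = F d i' j' * F d i j ∧
    F d i j * F d i' j' * G d (Equiv.swap i i', Equiv.swap j j') = F d i j * F d i' j' := by
  have h1 : 1 < r := by
    rcases i with ⟨i, _⟩; rcases i' with ⟨i', hi'⟩
    simp only [ne_eq, Fin.mk.injEq] at hi; omega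
  have h2 : 1 < t := by
    rcases j with ⟨i, _⟩; rcases j' with ⟨i', hi'⟩
    simp only [ne_eq, Fin.mk.injEq] at hj; omega
  obtain ⟨x, hx, e⟩ := sw_eq h1
  obtain ⟨z, hz, e'⟩ := sw_eq h2
  obtain ⟨u, hu0, hux⟩ := exists_perm hx hi
  obtain ⟨v, hv0, hvz⟩ := exists_perm hz hj
  have b1 := d.braid1 h1 h2
  have b2 := d.braid2 h1 h2
  rw [e, e'] at b1 b2
  have q1 := F1 d (Equiv.swap 0 x, Equiv.swap 0 z) 0 0
  have q2 := F1 d (Equiv.swap 0 x, Equiv.swap 0 z) x z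
  simp only [Equiv.swap_apply_left, Equiv.swap_apply_right, F00] at q1 q2
  have base := F6_aux (e := d.e) (e2 := F d x z) (a := d.σ (Equiv.swap 0 x)) (b := d.σb (Equiv.swap 0 z))
    (by rw [← map_mul, Equiv.swap_mul_self, map_one]) (by rw [← map_mul, Equiv.swap_mul_self, map_one])
    (d.comm_σσb _ _) q1 q2 b1 b2
  have f := F_conj d (u, v)
  have f' := F_conj' d (u, v) x z
  simp only [hu0, hv0, hux, hvz] at f f'
  have g := G_conj' d (u, v) (Equiv.swap 0 x, Equiv.swap 0 z)
  have g' : (u, v) * (Equiv.swap 0 x, Equiv.swap 0 z) * (u, v)⁻¹ = (Equiv.swap i i', Equiv.swap j j') := by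
    rw [← hu0, ← hux, ← hv0, ← hvz, Equiv.swap_apply_apply, Equiv.swap_apply_apply]; ext <;> simp
  rw [g'] at g
  rw [f, f', g, Fconj_mul, Fconj_mul, Fconj_mul, base.1]
  refine ⟨rfl, ?_⟩
  have := base.2
  rw [base.1] at this
  exact congrArg (fun x => _ * x * _) this
end WP

namespace WP
open QP

/-- Embedding of small symmetric groups. -/
def ve {k n : ℕ} (h : k ≤ n) : Equiv.Perm (Fin k) →* Equiv.Perm (Fin n) :=
  Equiv.Perm.viaEmbeddingHom (Fin.castLEEmb h)

theorem ve_cast {k n : ℕ} (h : k ≤ n) (w : Equiv.Perm (Fin k)) (j : Fin k) : ve h w (Fin.castLE h j) = Fin.castLE h (w j) :=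
  Equiv.Perm.viaEmbedding_apply w (Fin.castLEEmb h) j

theorem ve_ge {k n : ℕ} (h : k ≤ n) (w : Equiv.Perm (Fin k)) (x : Fin n) (hx : k ≤ x.1) : ve h w x = x :=
  Equiv.Perm.viaEmbedding_apply_of_notMem w (Fin.castLEEmb h) x (by
    rintro ⟨j, rfl⟩
    have := j.2
    simp at hx; omega)

theorem ve_k {k n : ℕ} (h : k ≤ n) (w : Equiv.Perm (Fin k)) (hx : k < n) : ve h w ⟨k, hx⟩ = ⟨k, hx⟩ := ve_ge h w _ (le_refl k)

theorem cast_or {k n : ℕ} (h : k ≤ n) (x : Fin n) : (∃ j : Fin k, x = Fin.castLE h j) ∨ k ≤ x.1 := by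
  by_cases hx : x.1 < k
  · exact Or.inl ⟨⟨x.1, hx⟩, rfl⟩
  · exact Or.inr (by omega)

theorem ve_swap {k n : ℕ} (h : k ≤ n) (i j : Fin k) : ve h (Equiv.swap i j) = Equiv.swap (Fin.castLE h i) (Fin.castLE h j) := by
  ext x
  rcases cast_or h x with ⟨l, rfl⟩ | hx
  · rw [ve_cast, Equiv.swap_apply_def, Equiv.swap_apply_def]
    simp only [(Fin.castLE_injective h).eq_iff]
    split_ifs <;> rfl
  · rw [ve_ge h _ _ hx, Equiv.swap_apply_of_ne_of_ne]
    · rintro rfl; have := i.2; simp at hx; omega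
    · rintro rfl; have := j.2; simp at hx; omega

theorem sw_ve {k n : ℕ} (h : k ≤ n) {j : ℕ} (hj : j + 1 < k) : sw n j (j+1) = ve h (Equiv.swap ⟨j, by omega⟩ ⟨j+1, hj⟩) := by
  rw [ve_swap, sw, dif_pos ⟨by omega, by omega⟩]; rfl

theorem kne {k n : ℕ} (h : k < n) (j : Fin k) : (⟨k, h⟩ : Fin n) ≠ Fin.castLE (by omega) j := by
  intro h; have := congrArg Fin.val h; have := j.2; simp at *; omega

variable {R A : Type} [CommRing R] [Ring A] [Algebra R A] {r t : ℕ} (d : WBC R A r t) [NeZero r] [NeZero t]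

theorem E_eq {i j : ℕ} (hi : i < r) (hj : j < t) : d.E (i+1) (j+1) = F d ⟨i, hi⟩ ⟨j, hj⟩ := by
  have h1 : d.tr 1 (i+1) = d.σ (Equiv.swap 0 ⟨i, hi⟩) := by
    simp only [WBC.tr, Nat.sub_self, Nat.add_sub_cancel, sw]
    rw [dif_pos ⟨NeZero.pos r, hi⟩]; rfl
  have h2 : d.trb 1 (j+1) = d.σb (Equiv.swap 0 ⟨j, hj⟩) := by
    simp only [WBC.trb, Nat.sub_self, Nat.add_sub_cancel, sw]
    rw [dif_pos ⟨NeZero.pos t, hj⟩]; rfl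
  rw [WBC.E, h1, h2, ← d.comm_σσb, F]
  simp only [Prod.inv_mk, Equiv.swap_inv, G, MonoidHom.coe_mk, OneHom.coe_mk]
  simp only [mul_assoc]

theorem cn_eq {i : ℕ} (hi : i < r) : d.cn (i+1) = d.c ⟨i, hi⟩ := by
  simp [WBC.cn, hi]
theorem cbn_eq {i : ℕ} (hi : i < t) : d.cbn (i+1) = d.cb ⟨i, hi⟩ := by
  simp [WBC.cbn, hi]
theorem tr_eq {i j : ℕ} (hi : i < r) (hj : j < r) : d.tr (i+1) (j+1) = d.σ (Equiv.swap ⟨i, hi⟩ ⟨j, hj⟩) := by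
  simp [WBC.tr, sw, hi, hj]
theorem trb_eq {i j : ℕ} (hi : i < t) (hj : j < t) : d.trb (i+1) (j+1) = d.σb (Equiv.swap ⟨i, hi⟩ ⟨j, hj⟩) := by
  simp [WBC.trb, sw, hi, hj]

section YS
variable {k : ℕ} (hr : k + 1 ≤ r) (ht : k + 1 ≤ t)

/-- the e-part and s-part of y -/
def P1 : A := ∑ j : Fin k, F d ⟨k, hr⟩ (Fin.castLE (by omega) j)
def P2 : A := ∑ j : Fin k, d.σ (Equiv.swap (Fin.castLE (by omega) j) ⟨k, hr⟩)
def P1b : A := ∑ j : Fin k, F d (Fin.castLE (by omega) j) ⟨k, ht⟩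
def P2b : A := ∑ j : Fin k, d.σb (Equiv.swap (Fin.castLE (by omega) j) ⟨k, ht⟩)

theorem sumIco (f : ℕ → A) : ∑ j ∈ Finset.Ico 1 (k+1), f j = ∑ j : Fin k, f (j.1 + 1) := by
  rw [Finset.sum_Ico_eq_sum_range, Nat.add_sub_cancel, Finset.sum_range]
  exact Finset.sum_congr rfl fun j _ => by rw [add_comm]

theorem y_eq : d.y (k+1) = (P1 d hr ht - P2 d hr) + d.c ⟨k, hr⟩ * (P1 d hr ht - P2 d hr) * d.c ⟨k, hr⟩ := by
  have h1 : d.LL (k+1) = P2 d hr := by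
    rw [WBC.LL, sumIco]; exact Finset.sum_congr rfl fun j _ => tr_eq d (by omega) hr
  have h2 : ∑ j ∈ Finset.Ico 1 (k+1), (d.E (k+1) j + d.Eb (k+1) j) = P1 d hr ht + d.c ⟨k, hr⟩ * P1 d hr ht * d.c ⟨k, hr⟩ := by
    rw [sumIco, P1, Finset.mul_sum, Finset.sum_mul, ← Finset.sum_add_distrib]
    refine Finset.sum_congr rfl fun j _ => ?_
    rw [WBC.Eb, cn_eq d hr, E_eq d hr (by omega : j.1 < t)]; rfl
  rw [WBC.y, h2, WBC.L, h1, cn_eq d hr]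
  rw [mul_sub, sub_mul]; abel

theorem yb_eq : d.yb (k+1) = (P1b d hr ht - P2b d ht) - d.cb ⟨k, ht⟩ * (P1b d hr ht - P2b d ht) * d.cb ⟨k, ht⟩ := by
  have h1 : d.LLb (k+1) = P2b d ht := by
    rw [WBC.LLb, sumIco]; exact Finset.sum_congr rfl fun j _ => trb_eq d (by omega) ht
  have h2 : ∑ j ∈ Finset.Ico 1 (k+1), (d.E j (k+1) - d.Eb j (k+1)) = P1b d hr ht - d.cb ⟨k, ht⟩ * P1b d hr ht * d.cb ⟨k, ht⟩ := by
    rw [sumIco, P1b, Finset.mul_sum, Finset.sum_mul, ← Finset.sum_sub_distrib]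
    refine Finset.sum_congr rfl fun j _ => ?_
    rw [WBC.Eb, cn_eq d (by omega : j.1 < r), E_eq d (by omega : j.1 < r) ht, F3', mul_assoc, F3, ← mul_assoc]; rfl
  rw [WBC.yb, h2, WBC.Lb, h1, cbn_eq d ht]
  rw [mul_sub, sub_mul]; abel

theorem G_P1 (u v : Equiv.Perm (Fin k)) : Commute (G d (ve (by omega) u, ve (by omega) v)) (P1 d hr ht) := by
  show _ * _ = _ * _
  rw [P1, Finset.mul_sum, Finset.sum_mul, ← Equiv.sum_comp v (fun j => _ * G d _)]
  refine Finset.sum_congr rfl fun j _ => ?_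
  rw [F1, ve_cast]; simp only [ve_k]
theorem G_P1b (u v : Equiv.Perm (Fin k)) : Commute (G d (ve (by omega) u, ve (by omega) v)) (P1b d hr ht) := by
  show _ * _ = _ * _
  rw [P1b, Finset.mul_sum, Finset.sum_mul, ← Equiv.sum_comp u (fun j => _ * G d _)]
  refine Finset.sum_congr rfl fun j _ => ?_
  rw [F1, ve_cast]; simp only [ve_k]
theorem G_P2 (u v : Equiv.Perm (Fin k)) : Commute (G d (ve (by omega : k ≤ r) u, ve (by omega : k ≤ t) v)) (P2 d hr) := by
  show _ * _ = _ * _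
  rw [P2, Finset.mul_sum, Finset.sum_mul, ← Equiv.sum_comp u (fun j => _ * G d _)]
  refine Finset.sum_congr rfl fun j _ => ?_
  rw [← G1, ← G1, ← map_mul, ← map_mul]
  congr 1
  refine Prod.ext ?_ (by simp)
  simp only [Prod.fst_mul]
  rw [← ve_cast, Equiv.mul_swap_eq_swap_mul]; simp only [ve_k]
theorem G_P2b (u v : Equiv.Perm (Fin k)) : Commute (G d (ve (by omega : k ≤ r) u, ve (by omega : k ≤ t) v)) (P2b d ht) := by
  show _ * _ = _ * _
  rw [P2b, Finset.mul_sum, Finset.sum_mul, ← Equiv.sum_comp v (fun j => _ * G d _)]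
  refine Finset.sum_congr rfl fun j _ => ?_
  rw [← G2, ← G2, ← map_mul, ← map_mul]
  congr 1
  refine Prod.ext (by simp) ?_
  simp only [Prod.snd_mul]
  rw [← ve_cast, Equiv.mul_swap_eq_swap_mul]; simp only [ve_k]

theorem e_P [NeZero k] : Commute d.e (P1 d hr ht - P2 d hr) := by
  rw [P1, P2, ← Finset.sum_sub_distrib]
  refine Commute.sum_right _ _ _ fun j _ => ?_
  have k0 : (⟨k, hr⟩ : Fin r) ≠ 0 := fun h => NeZero.ne k (congrArg Fin.val h)
  by_cases hj : j = 0
  · subst hj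
    have c0 : ∀ (n : ℕ) [NeZero n] (h : k ≤ n), Fin.castLE h 0 = 0 := fun n _ h => rfl
    rw [c0, c0]
    have h := F5 d k0.symm 0
    have h' := F1 d (Equiv.swap 0 ⟨k, hr⟩, 1) 0 0
    have h'' := F1 d (Equiv.swap 0 ⟨k, hr⟩, 1) ⟨k, hr⟩ 0
    simp only [Equiv.swap_apply_left, Equiv.swap_apply_right, Equiv.Perm.one_apply, G1] at h' h''
    rw [F00] at h h' h''
    have q : d.σ (Equiv.swap 0 ⟨k, hr⟩) * d.σ (Equiv.swap 0 ⟨k, hr⟩) = 1 := by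
      rw [← map_mul, Equiv.swap_mul_self, map_one]
    have z1 : d.e * (F d ⟨k, hr⟩ 0 - d.σ (Equiv.swap 0 ⟨k, hr⟩)) = 0 := by
      rw [mul_sub, sub_eq_zero]
      calc d.e * F d ⟨k, hr⟩ 0 = d.e * (F d ⟨k, hr⟩ 0 * d.σ (Equiv.swap 0 ⟨k, hr⟩)) * d.σ (Equiv.swap 0 ⟨k, hr⟩) := by
            simp only [mul_assoc]; rw [q, mul_one]
        _ = (d.e * d.σ (Equiv.swap 0 ⟨k, hr⟩) * d.e) * d.σ (Equiv.swap 0 ⟨k, hr⟩) := by rw [← h', ← mul_assoc]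
        _ = _ := by rw [h]
    have z2 : (F d ⟨k, hr⟩ 0 - d.σ (Equiv.swap 0 ⟨k, hr⟩)) * d.e = 0 := by
      rw [sub_mul, sub_eq_zero]
      calc F d ⟨k, hr⟩ 0 * d.e = d.σ (Equiv.swap 0 ⟨k, hr⟩) * (d.σ (Equiv.swap 0 ⟨k, hr⟩) * F d ⟨k, hr⟩ 0) * d.e := by
            rw [← mul_assoc, q, one_mul]
        _ = d.σ (Equiv.swap 0 ⟨k, hr⟩) * (d.e * d.σ (Equiv.swap 0 ⟨k, hr⟩) * d.e) := by rw [h'', ← mul_assoc]; simp only [mul_assoc]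
        _ = _ := by rw [h]
    exact z1.trans z2.symm
  · have hj' : ∀ (n : ℕ) [NeZero n] (h : k ≤ n), Fin.castLE h j ≠ 0 := fun n _ h h' => hj (Fin.ext (congrArg (fun x : Fin n => x.1) h'))
    refine Commute.sub_right ?_ ?_
    · have := (F6 d k0.symm (hj' t (by omega)).symm).1
      rw [F00] at this; exact this
    · rw [← G1]
      refine (G_e_comm d _ ?_ rfl).symm
      exact Equiv.swap_apply_of_ne_of_ne (hj' _ _).symm k0.symm

theorem e_Pb [NeZero k] : Commute d.e (P1b d hr ht - P2b d ht) := by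
  rw [P1b, P2b, ← Finset.sum_sub_distrib]
  refine Commute.sum_right _ _ _ fun j _ => ?_
  have k0 : (⟨k, ht⟩ : Fin t) ≠ 0 := fun h => NeZero.ne k (congrArg Fin.val h)
  by_cases hj : j = 0
  · subst hj
    have c0 : ∀ (n : ℕ) [NeZero n] (h : k ≤ n), Fin.castLE h 0 = 0 := fun n _ h => rfl
    rw [c0, c0]
    have h := F5b d k0.symm 0
    have h' := F1 d (1, Equiv.swap 0 ⟨k, ht⟩) 0 0
    have h'' := F1 d (1, Equiv.swap 0 ⟨k, ht⟩) 0 ⟨k, ht⟩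
    simp only [Equiv.swap_apply_left, Equiv.swap_apply_right, Equiv.Perm.one_apply, G2] at h' h''
    rw [F00] at h h' h''
    have q : d.σb (Equiv.swap 0 ⟨k, ht⟩) * d.σb (Equiv.swap 0 ⟨k, ht⟩) = 1 := by
      rw [← map_mul, Equiv.swap_mul_self, map_one]
    have z1 : d.e * (F d 0 ⟨k, ht⟩ - d.σb (Equiv.swap 0 ⟨k, ht⟩)) = 0 := by
      rw [mul_sub, sub_eq_zero]
      calc d.e * F d 0 ⟨k, ht⟩ = d.e * (F d 0 ⟨k, ht⟩ * d.σb (Equiv.swap 0 ⟨k, ht⟩)) * d.σb (Equiv.swap 0 ⟨k, ht⟩) := by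
            simp only [mul_assoc]; rw [q, mul_one]
        _ = (d.e * d.σb (Equiv.swap 0 ⟨k, ht⟩) * d.e) * d.σb (Equiv.swap 0 ⟨k, ht⟩) := by rw [← h', ← mul_assoc]
        _ = _ := by rw [h]
    have z2 : (F d 0 ⟨k, ht⟩ - d.σb (Equiv.swap 0 ⟨k, ht⟩)) * d.e = 0 := by
      rw [sub_mul, sub_eq_zero]
      calc F d 0 ⟨k, ht⟩ * d.e = d.σb (Equiv.swap 0 ⟨k, ht⟩) * (d.σb (Equiv.swap 0 ⟨k, ht⟩) * F d 0 ⟨k, ht⟩) * d.e := by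
            rw [← mul_assoc, q, one_mul]
        _ = d.σb (Equiv.swap 0 ⟨k, ht⟩) * (d.e * d.σb (Equiv.swap 0 ⟨k, ht⟩) * d.e) := by rw [h'', ← mul_assoc]; simp only [mul_assoc]
        _ = _ := by rw [h]
    exact z1.trans z2.symm
  · have hj' : ∀ (n : ℕ) [NeZero n] (h : k ≤ n), Fin.castLE h j ≠ 0 := fun n _ h h' => hj (Fin.ext (congrArg (fun x : Fin n => x.1) h'))
    refine Commute.sub_right ?_ ?_
    · have := (F6 d (hj' r (by omega)).symm k0.symm).1
      rw [F00] at this; exact this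
    · rw [← G2]
      refine (G_e_comm d _ rfl ?_).symm
      exact Equiv.swap_apply_of_ne_of_ne (hj' _ _).symm k0.symm

/-- anticommuting with `c`, commuting with `P`. -/
theorem cc1 {z c P : A} (h1 : z * c = -(c * z)) (h2 : Commute z P) : Commute z (c * P * c) := by
  show z * _ = _ * z
  have h2 : z * P = P * z := h2
  calc z * (c * P * c) = (z * c) * P * c := by simp only [mul_assoc]
    _ = -(c * (z * P) * c) := by rw [h1]; simp only [neg_mul, mul_assoc]
    _ = -(c * P * (z * c)) := by rw [h2]; simp only [mul_assoc]
    _ = _ := by rw [h1]; simp only [mul_neg, neg_neg, mul_assoc]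
theorem cc2 {z c P : A} (hc : c * c = -1) (h1 : z * c = -(c * z)) (h2 : z * P = c * P) (h3 : P * z = P * c) :
    Commute z (P + c * P * c) := by
  show z * _ = _ * z
  have a : z * (c * P * c) = P * c := by
    calc z * (c * P * c) = (z * c) * P * c := by simp only [mul_assoc]
      _ = -(c * (z * P) * c) := by rw [h1]; simp only [neg_mul, mul_assoc]
      _ = -((c * c) * P * c) := by rw [h2]; simp only [mul_assoc]
      _ = _ := by rw [hc]; simp
  have b : (c * P * c) * z = c * P := by
    have h1' : c * z = -(z * c) := by rw [h1, neg_neg]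
    calc (c * P * c) * z = c * P * (c * z) := by simp only [mul_assoc]
      _ = -(c * (P * z) * c) := by rw [h1']; simp only [mul_neg, mul_assoc]
      _ = -(c * P * (c * c)) := by rw [h3]; simp only [mul_assoc]
      _ = _ := by rw [hc]; simp
  rw [mul_add, add_mul, a, b, h2, h3, add_comm]
theorem cc2b {z c P : A} (hc : c * c = 1) (h1 : z * c = -(c * z)) (h2 : z * P = c * P) (h3 : P * z = P * c) :
    Commute z (P - c * P * c) := by
  show z * _ = _ * z
  have a : z * (c * P * c) = -(P * c) := by
    calc z * (c * P * c) = (z * c) * P * c := by simp only [mul_assoc]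
      _ = -(c * (z * P) * c) := by rw [h1]; simp only [neg_mul, mul_assoc]
      _ = -((c * c) * P * c) := by rw [h2]; simp only [mul_assoc]
      _ = _ := by rw [hc]; simp
  have b : (c * P * c) * z = -(c * P) := by
    have h1' : c * z = -(z * c) := by rw [h1, neg_neg]
    calc (c * P * c) * z = c * P * (c * z) := by simp only [mul_assoc]
      _ = -(c * (P * z) * c) := by rw [h1']; simp only [mul_neg, mul_assoc]
      _ = -(c * P * (c * c)) := by rw [h3]; simp only [mul_assoc]
      _ = _ := by rw [hc]; simp
  rw [mul_sub, sub_mul, a, b, h2, h3, sub_neg_eq_add, sub_neg_eq_add, add_comm]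
theorem cc3 {z c P : A} (hc : c * c = -1) (h1 : z * c = -(c * z)) (h2 : z * P = P * c) (h3 : P * z = c * P) :
    Commute z (P + c * P * c) := by
  show z * _ = _ * z
  have a : z * (c * P * c) = c * P := by
    calc z * (c * P * c) = (z * c) * P * c := by simp only [mul_assoc]
      _ = -(c * (z * P) * c) := by rw [h1]; simp only [neg_mul, mul_assoc]
      _ = -(c * P * (c * c)) := by rw [h2]; simp only [mul_assoc]
      _ = _ := by rw [hc]; simp
  have b : (c * P * c) * z = P * c := by
    have h1' : c * z = -(z * c) := by rw [h1, neg_neg]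
    calc (c * P * c) * z = c * P * (c * z) := by simp only [mul_assoc]
      _ = -(c * (P * z) * c) := by rw [h1']; simp only [mul_neg, mul_assoc]
      _ = -((c * c) * P * c) := by rw [h3]; simp only [mul_assoc]
      _ = _ := by rw [hc]; simp
  rw [mul_add, add_mul, a, b, h2, h3, add_comm]
theorem cc3b {z c P : A} (hc : c * c = 1) (h1 : z * c = -(c * z)) (h2 : z * P = P * c) (h3 : P * z = c * P) :
    Commute z (P - c * P * c) := by
  show z * _ = _ * z
  have a : z * (c * P * c) = -(c * P) := by
    calc z * (c * P * c) = (z * c) * P * c := by simp only [mul_assoc]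
      _ = -(c * (z * P) * c) := by rw [h1]; simp only [neg_mul, mul_assoc]
      _ = -(c * P * (c * c)) := by rw [h2]; simp only [mul_assoc]
      _ = _ := by rw [hc]; simp
  have b : (c * P * c) * z = -(P * c) := by
    have h1' : c * z = -(z * c) := by rw [h1, neg_neg]
    calc (c * P * c) * z = c * P * (c * z) := by simp only [mul_assoc]
      _ = -(c * (P * z) * c) := by rw [h1']; simp only [mul_neg, mul_assoc]
      _ = -((c * c) * P * c) := by rw [h3]; simp only [mul_assoc]
      _ = _ := by rw [hc]; simp
  rw [mul_sub, sub_mul, a, b, h2, h3, sub_neg_eq_add, sub_neg_eq_add, add_comm]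

theorem y_split : d.y (k+1) = ∑ j : Fin k, (F d ⟨k, hr⟩ (Fin.castLE (by omega) j) + d.c ⟨k, hr⟩ * F d ⟨k, hr⟩ (Fin.castLE (by omega) j) * d.c ⟨k, hr⟩)
   - ∑ j : Fin k, (d.σ (Equiv.swap (Fin.castLE (by omega) j) ⟨k, hr⟩) + d.c ⟨k, hr⟩ * d.σ (Equiv.swap (Fin.castLE (by omega) j) ⟨k, hr⟩) * d.c ⟨k, hr⟩) := by
  rw [y_eq d hr ht, mul_sub, sub_mul, Finset.sum_add_distrib, Finset.sum_add_distrib, ← Finset.sum_mul, ← Finset.mul_sum, ← Finset.sum_mul, ← Finset.mul_sum]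
  rw [P1, P2]; abel
theorem yb_split : d.yb (k+1) = ∑ j : Fin k, (F d (Fin.castLE (by omega) j) ⟨k, ht⟩ - d.cb ⟨k, ht⟩ * F d (Fin.castLE (by omega) j) ⟨k, ht⟩ * d.cb ⟨k, ht⟩)
   - ∑ j : Fin k, (d.σb (Equiv.swap (Fin.castLE (by omega) j) ⟨k, ht⟩) - d.cb ⟨k, ht⟩ * d.σb (Equiv.swap (Fin.castLE (by omega) j) ⟨k, ht⟩) * d.cb ⟨k, ht⟩) := by
  rw [yb_eq d hr ht, mul_sub, sub_mul, Finset.sum_sub_distrib, Finset.sum_sub_distrib, ← Finset.sum_mul, ← Finset.mul_sum, ← Finset.sum_mul, ← Finset.mul_sum]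
  rw [P1b, P2b]; abel

end YS
variable {k : ℕ}

theorem c_y (hr : k + 1 ≤ r) (ht : k + 1 ≤ t) (i : Fin k) : Commute (d.c (Fin.castLE (by omega) i)) (d.y (k+1)) := by
  rw [y_split d hr ht]
  have an := d.c_anti _ _ (kne hr i).symm
  refine Commute.sub_right (Commute.sum_right _ _ _ fun j _ => ?_) (Commute.sum_right _ _ _ fun j _ => ?_)
  · have := F2 d (kne hr i).symm (Fin.castLE (by omega) j : Fin t)
    exact Commute.add_right this (cc1 an this)
  · have h := G_c d (Equiv.swap (Fin.castLE (by omega) j) ⟨k, hr⟩, 1)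
    simp only [G1] at h
    by_cases hj : j = i
    · subst hj
      have ha := h ⟨k, hr⟩
      have hb := h (Fin.castLE (by omega) j)
      rw [Equiv.swap_apply_right] at ha
      rw [Equiv.swap_apply_left] at hb
      exact cc3 (d.c_sq _) an ha.symm hb
    · have hb := h (Fin.castLE (by omega) i)
      rw [Equiv.swap_apply_of_ne_of_ne (fun h => hj ((Fin.castLE_injective _ h).symm)) (kne hr i).symm] at hb
      exact Commute.add_right hb.symm (cc1 an hb.symm)

theorem cb_y (hr : k + 1 ≤ r) (ht : k + 1 ≤ t) (i : Fin k) : Commute (d.cb (Fin.castLE (by omega) i)) (d.y (k+1)) := by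
  rw [y_split d hr ht]
  have an : d.cb (Fin.castLE (by omega) i) * d.c ⟨k, hr⟩ = -(d.c ⟨k, hr⟩ * d.cb (Fin.castLE (by omega) i)) := by rw [d.anti_ccb, neg_neg]
  refine Commute.sub_right (Commute.sum_right _ _ _ fun j _ => ?_) (Commute.sum_right _ _ _ fun j _ => ?_)
  · by_cases hj : j = i
    · subst hj
      exact cc2 (d.c_sq _) an (F3' d _ _).symm (F3 d _ _).symm
    · have := F2b d (fun h => hj ((Fin.castLE_injective _ h).symm) : (Fin.castLE (by omega) i : Fin t) ≠ Fin.castLE (by omega) j) ⟨k, hr⟩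
      exact Commute.add_right this (cc1 an this)
  · have h := (d.comm_σcb (Equiv.swap (Fin.castLE (by omega) j) ⟨k, hr⟩) (Fin.castLE (by omega) i)).symm
    exact Commute.add_right h (cc1 an h)

theorem cb_yb (hr : k + 1 ≤ r) (ht : k + 1 ≤ t) (i : Fin k) : Commute (d.cb (Fin.castLE (by omega) i)) (d.yb (k+1)) := by
  rw [yb_split d hr ht]
  have an := d.cb_anti _ _ (kne ht i).symm
  refine Commute.sub_right (Commute.sum_right _ _ _ fun j _ => ?_) (Commute.sum_right _ _ _ fun j _ => ?_)
  · have := F2b d (kne ht i).symm (Fin.castLE (by omega) j : Fin r)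
    exact Commute.sub_right this (cc1 an this)
  · have h := G_cb d (1, Equiv.swap (Fin.castLE (by omega) j) ⟨k, ht⟩)
    simp only [G2] at h
    by_cases hj : j = i
    · subst hj
      have ha := h ⟨k, ht⟩
      have hb := h (Fin.castLE (by omega) j)
      rw [Equiv.swap_apply_right] at ha
      rw [Equiv.swap_apply_left] at hb
      exact cc3b (d.cb_sq _) an ha.symm hb
    · have hb := h (Fin.castLE (by omega) i)
      rw [Equiv.swap_apply_of_ne_of_ne (fun h => hj ((Fin.castLE_injective _ h).symm)) (kne ht i).symm] at hb
      exact Commute.sub_right hb.symm (cc1 an hb.symm)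

theorem c_yb (hr : k + 1 ≤ r) (ht : k + 1 ≤ t) (i : Fin k) : Commute (d.c (Fin.castLE (by omega) i)) (d.yb (k+1)) := by
  rw [yb_split d hr ht]
  have an := d.anti_ccb (Fin.castLE (by omega) i) ⟨k, ht⟩
  refine Commute.sub_right (Commute.sum_right _ _ _ fun j _ => ?_) (Commute.sum_right _ _ _ fun j _ => ?_)
  · by_cases hj : j = i
    · subst hj
      exact cc2b (d.cb_sq _) an (F3' d _ _) (F3 d _ _)
    · have := F2 d (fun h => hj ((Fin.castLE_injective _ h).symm) : (Fin.castLE (by omega) i : Fin r) ≠ Fin.castLE (by omega) j) ⟨k, ht⟩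
      exact Commute.sub_right this (cc1 an this)
  · have h := (d.comm_σbc (Equiv.swap (Fin.castLE (by omega) j) ⟨k, ht⟩) (Fin.castLE (by omega) i)).symm
    exact Commute.sub_right h (cc1 an h)

theorem G_y (hr : k + 1 ≤ r) (ht : k + 1 ≤ t) (u v : Equiv.Perm (Fin k)) : Commute (G d (ve (by omega) u, ve (by omega) v)) (d.y (k+1)) := by
  rw [y_eq d hr ht]
  have h := (G_P1 d hr ht u v).sub_right (G_P2 d hr ht u v)
  have hc : Commute (G d (ve (by omega : k ≤ r) u, ve (by omega : k ≤ t) v)) (d.c ⟨k, hr⟩) := by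
    have := G_c d (ve (by omega : k ≤ r) u, ve (by omega : k ≤ t) v) ⟨k, hr⟩
    simp only [ve_k] at this; exact this
  exact h.add_right ((hc.mul_right h).mul_right hc)
theorem G_yb (hr : k + 1 ≤ r) (ht : k + 1 ≤ t) (u v : Equiv.Perm (Fin k)) : Commute (G d (ve (by omega) u, ve (by omega) v)) (d.yb (k+1)) := by
  rw [yb_eq d hr ht]
  have h := (G_P1b d hr ht u v).sub_right (G_P2b d hr ht u v)
  have hc : Commute (G d (ve (by omega : k ≤ r) u, ve (by omega : k ≤ t) v)) (d.cb ⟨k, ht⟩) := by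
    have := G_cb d (ve (by omega : k ≤ r) u, ve (by omega : k ≤ t) v) ⟨k, ht⟩
    simp only [ve_k] at this; exact this
  exact h.sub_right ((hc.mul_right h).mul_right hc)
theorem e_y (hr : k + 1 ≤ r) (ht : k + 1 ≤ t) [NeZero k] : Commute d.e (d.y (k+1)) := by
  rw [y_eq d hr ht]
  have h := e_P d hr ht
  have hc : Commute d.e (d.c ⟨k, hr⟩) := (d.c_e_comm _ (NeZero.ne k)).symm
  exact h.add_right ((hc.mul_right h).mul_right hc)
theorem e_yb (hr : k + 1 ≤ r) (ht : k + 1 ≤ t) [NeZero k] : Commute d.e (d.yb (k+1)) := by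
  rw [yb_eq d hr ht]
  have h := e_Pb d hr ht
  have hc : Commute d.e (d.cb ⟨k, ht⟩) := (d.cb_e_comm _ (NeZero.ne k)).symm
  exact h.sub_right ((hc.mul_right h).mul_right hc)

/-- The generators, uniformly: an induction principle. -/
theorem gens_cases (hr : k + 1 ≤ r) (ht : k + 1 ≤ t) [NeZero k] {x : A} (hx : x ∈ d.lowerGens k) : x = d.e ∨
    (∃ u v : Equiv.Perm (Fin k), x = G d (ve (by omega) u, ve (by omega) v)) ∨ (x = d.c (Fin.castLE (by omega) (0 : Fin k))) ∨ (x = d.cb (Fin.castLE (by omega) (0 : Fin k))) := by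
  rcases hx with ⟨_, h⟩ | ⟨j, h1, h2, h⟩ | ⟨j, h1, h2, h⟩ | ⟨_, h⟩ | ⟨_, h⟩
  · exact Or.inl h
  · refine Or.inr (Or.inl ⟨Equiv.swap ⟨j - 1, by omega⟩ ⟨j-1+1, by omega⟩, 1, ?_⟩)
    rw [← sw_ve _ (by omega), map_one, G1, h, WBC.s]; congr 2; omega
  · refine Or.inr (Or.inl ⟨1, Equiv.swap ⟨j - 1, by omega⟩ ⟨j-1+1, by omega⟩, ?_⟩)
    rw [← sw_ve _ (by omega), map_one, G2, h, WBC.sb]; congr 2; omega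
  · refine Or.inr (Or.inr (Or.inl ?_)); rw [h]; exact cn_eq d (NeZero.pos r)
  · refine Or.inr (Or.inr (Or.inr ?_)); rw [h]; exact cbn_eq d (NeZero.pos t)

theorem adjoin_comm {x z : A} (hx : x ∈ Algebra.adjoin R (d.lowerGens k)) (h : ∀ g ∈ d.lowerGens k, Commute g z) : Commute x z := by
  induction hx using Algebra.adjoin_induction with
  | mem x hx => exact h x hx
  | algebraMap r => exact Algebra.commutes r z
  | add x y _ _ hx hy => exact hx.add_left hy
  | mul x y _ _ hx hy => exact hx.mul_left hy

theorem adj_y (hr : k + 1 ≤ r) (ht : k + 1 ≤ t) [NeZero k] {x : A} (hx : x ∈ Algebra.adjoin R (d.lowerGens k)) : Commute x (d.y (k+1)) := by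
  refine adjoin_comm d hx fun g hg => ?_
  rcases gens_cases d hr ht hg with rfl | ⟨u, v, rfl⟩ | rfl | rfl
  · exact e_y d hr ht
  · exact G_y d hr ht u v
  · exact c_y d hr ht _
  · exact cb_y d hr ht _
theorem adj_yb (hr : k + 1 ≤ r) (ht : k + 1 ≤ t) [NeZero k] {x : A} (hx : x ∈ Algebra.adjoin R (d.lowerGens k)) : Commute x (d.yb (k+1)) := by
  refine adjoin_comm d hx fun g hg => ?_
  rcases gens_cases d hr ht hg with rfl | ⟨u, v, rfl⟩ | rfl | rfl
  · exact e_yb d hr ht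
  · exact G_yb d hr ht u v
  · exact c_yb d hr ht _
  · exact cb_yb d hr ht _
end WP

namespace KP

/-- Diagonal data. -/
structure KD (A : Type) [Ring A] (ι : Type) [DecidableEq ι] where
  g : Equiv.Perm ι × Equiv.Perm ι →* A
  c : ι ⊕ ι → A
  e : ι → A
  c_sq : ∀ x, c x * c x = 1 ∨ c x * c x = -1
  c_anti : ∀ x y, x ≠ y → c x * c y = -(c y * c x)
  g_c : ∀ p x, g p * c x = c (Sum.map p.1 p.2 x) * g p
  g_e : ∀ p i j, p.1 i = j → p.2 i = j → g p * e i = e j * g p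
  e_c : ∀ i, e i * c (Sum.inl i) = e i * c (Sum.inr i)
  c_e : ∀ i, c (Sum.inl i) * e i = c (Sum.inr i) * e i
  c_e_comm : ∀ x i, x ≠ Sum.inl i → x ≠ Sum.inr i → c x * e i = e i * c x
  e_sq : ∀ i, e i * e i = 0
  e_c_e : ∀ i, e i * c (Sum.inl i) * e i = 0
  e_s : ∀ i j, i ≠ j → e i * g (Equiv.swap i j, 1) * e i = e i
  e_sb : ∀ i j, i ≠ j → e i * g (1, Equiv.swap i j) * e i = e i
  e_comm : ∀ i j, e i * e j = e j * e i
  e_red : ∀ i j, i ≠ j → e i * e j * g (Equiv.swap i j, Equiv.swap i j) = e i * e j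

variable {A : Type} [Ring A] {ι : Type} [DecidableEq ι] (K : KD A ι)

/-- equality up to sign -/
def PM (a b : A) : Prop := a = b ∨ a = -b

theorem PM.refl (a : A) : PM a a := Or.inl rfl
theorem PM.trans {a b c : A} (h : PM a b) (h' : PM b c) : PM a c := by
  rcases h with rfl | rfl <;> rcases h' with rfl | rfl
  · exact Or.inl rfl
  · exact Or.inr rfl
  · exact Or.inr rfl
  · left; rw [neg_neg]
theorem PM.symm {a b : A} (h : PM a b) : PM b a := by
  rcases h with rfl | rfl
  · exact Or.inl rfl
  · right; rw [neg_neg]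
theorem PM.mul_left {a b : A} (h : PM a b) (x : A) : PM (x * a) (x * b) := by
  rcases h with rfl | rfl
  · exact Or.inl rfl
  · right; rw [mul_neg]
theorem PM.mul_right {a b : A} (h : PM a b) (x : A) : PM (a * x) (b * x) := by
  rcases h with rfl | rfl
  · exact Or.inl rfl
  · right; rw [neg_mul]

/-- product of the `e i` -/
def eS (S : Finset ι) : A := S.noncommProd K.e (fun i _ j _ _ => K.e_comm i j)

theorem eS_empty : eS K ∅ = 1 := Finset.noncommProd_empty _ _

theorem eS_insert {i : ι} {S : Finset ι} (h : i ∉ S) : eS K (insert i S) = K.e i * eS K S :=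
  Finset.noncommProd_insert_of_notMem _ _ _ _ h

theorem eS_comm_of {x : A} {S : Finset ι} (h : ∀ i ∈ S, Commute x (K.e i)) : Commute x (eS K S) :=
  Finset.noncommProd_commute _ _ _ _ h

theorem e_eS_comm (i : ι) (S : Finset ι) : Commute (K.e i) (eS K S) := eS_comm_of K fun j _ => K.e_comm i j

theorem eS_mem {i : ι} {S : Finset ι} (h : i ∈ S) : eS K S = K.e i * eS K (S.erase i) := by
  rw [← eS_insert K (Finset.notMem_erase i S), Finset.insert_erase h]

theorem eS_mem' {i : ι} {S : Finset ι} (h : i ∈ S) : eS K S = eS K (S.erase i) * K.e i := by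
  rw [eS_mem K h]; exact e_eS_comm K _ _

theorem g_eS (p : Equiv.Perm ι × Equiv.Perm ι) (w : Equiv.Perm ι) (S : Finset ι) (h : ∀ i ∈ S, p.1 i = w i ∧ p.2 i = w i) :
    K.g p * eS K S = eS K (S.map w.toEmbedding) * K.g p := by
  induction S using Finset.induction_on with
  | empty => simp [eS_empty]
  | insert i S hi ih =>
    rw [eS_insert K hi, Finset.map_insert, eS_insert K (by simpa using hi), ← mul_assoc,
      K.g_e p i (w i) (h i (Finset.mem_insert_self _ _)).1 (h i (Finset.mem_insert_self _ _)).2, mul_assoc,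
      ih fun j hj => h j (Finset.mem_insert_of_mem hj), mul_assoc]
    rfl

theorem g_eS_fix (p : Equiv.Perm ι × Equiv.Perm ι) (S : Finset ι) (h : ∀ i ∈ S, p.1 i = i ∧ p.2 i = i) :
    Commute (K.g p) (eS K S) := eS_comm_of K fun i hi => K.g_e p i i (h i hi).1 (h i hi).2

theorem c_eS {x : ι ⊕ ι} {S : Finset ι} (h : ∀ i ∈ S, x ≠ Sum.inl i ∧ x ≠ Sum.inr i) : Commute (K.c x) (eS K S) :=
  eS_comm_of K fun i hi => K.c_e_comm x i (h i hi).1 (h i hi).2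

/-- word in Clifford letters -/
def wd (l : List (ι ⊕ ι)) : A := (l.map K.c).prod
theorem wd_nil : wd K [] = 1 := rfl
theorem wd_cons (x l) : wd K (x :: l) = K.c x * wd K l := by simp [wd]
theorem wd_append (l l') : wd K (l ++ l') = wd K l * wd K l' := by simp [wd]

theorem g_wd (p l) : K.g p * wd K l = wd K (l.map (Sum.map p.1 p.2)) * K.g p := by
  induction l with
  | nil => simp [wd]
  | cons x l ih => rw [List.map_cons, wd_cons, wd_cons, ← mul_assoc, K.g_c, mul_assoc, ih, mul_assoc]

/-- monomials -/
def mon (l : List (ι ⊕ ι)) (β : Equiv.Perm ι) (S : Finset ι) (p : Equiv.Perm ι × Equiv.Perm ι) (l' : List (ι ⊕ ι)) : A :=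
  wd K l * (K.g (1, β) * eS K S * K.g p) * wd K l'

def NN : Set A := {m | ∃ l β S p l', m = mon K l β S p l'}

variable {R : Type} [CommRing R] [Algebra R A]

variable (R) in
def WW : Submodule R A := Submodule.span R (NN K)

theorem WW_l {z : A} (h : ∀ m ∈ NN K, z * m ∈ WW K R) {m : A} (hm : m ∈ WW K R) : z * m ∈ WW K R := by
  induction hm using Submodule.span_induction with
  | mem x hx => exact h x hx
  | zero => rw [mul_zero]; exact zero_mem _
  | add x y _ _ hx hy => rw [mul_add]; exact add_mem hx hy
  | smul a x _ hx => rw [mul_smul_comm]; exact Submodule.smul_mem _ _ hx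
theorem WW_r {z : A} (h : ∀ m ∈ NN K, m * z ∈ WW K R) {m : A} (hm : m ∈ WW K R) : m * z ∈ WW K R := by
  induction hm using Submodule.span_induction with
  | mem x hx => exact h x hx
  | zero => rw [zero_mul]; exact zero_mem _
  | add x y _ _ hx hy => rw [add_mul]; exact add_mem hx hy
  | smul a x _ hx => rw [smul_mul_assoc]; exact Submodule.smul_mem _ _ hx

theorem WW_mon (l β S p l') : mon K l β S p l' ∈ WW K R := Submodule.subset_span ⟨l, β, S, p, l', rfl⟩

theorem WW_eS (S) : eS K S ∈ WW K R := by
  have := WW_mon (R := R) K [] 1 S 1 []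
  simpa [mon, wd_nil, ← Prod.one_eq_mk] using this
theorem WW_one : (1 : A) ∈ WW K R := by rw [← eS_empty K]; exact WW_eS K _

theorem c_WW (x) {m : A} (hm : m ∈ WW K R) : K.c x * m ∈ WW K R := by
  refine WW_l K ?_ hm
  rintro _ ⟨l, β, S, p, l', rfl⟩
  have := WW_mon (R := R) K (x :: l) β S p l'
  rw [mon, wd_cons] at this
  rw [mon]; simpa only [mul_assoc] using this
theorem WW_c (x) {m : A} (hm : m ∈ WW K R) : m * K.c x ∈ WW K R := by
  refine WW_r K ?_ hm
  rintro _ ⟨l, β, S, p, l', rfl⟩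
  have := WW_mon (R := R) K l β S p (l' ++ [x])
  rw [mon, wd_append, wd_cons, wd_nil, mul_one] at this
  rw [mon]; simpa only [mul_assoc] using this
theorem WW_g (q) {m : A} (hm : m ∈ WW K R) : m * K.g q ∈ WW K R := by
  refine WW_r K ?_ hm
  rintro _ ⟨l, β, S, p, l', rfl⟩
  have h : wd K l' * K.g q = K.g q * wd K (l'.map (Sum.map (q⁻¹).1 (q⁻¹).2)) := by
    rw [g_wd, List.map_map]
    congr 2
    conv_lhs => rw [← List.map_id l']
    refine List.map_congr_left fun x _ => ?_
    rcases x with x | x <;> simp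
  have := WW_mon (R := R) K l β S (p * q) (l'.map (Sum.map (q⁻¹).1 (q⁻¹).2))
  rw [mon, map_mul] at this
  rw [mon, mul_assoc, h]; simpa only [mul_assoc] using this
theorem g_WW (q) {m : A} (hm : m ∈ WW K R) : K.g q * m ∈ WW K R := by
  refine WW_l K ?_ hm
  rintro _ ⟨l, β, S, p, l', rfl⟩
  have := WW_mon (R := R) K (l.map (Sum.map q.1 q.2)) (q.2 * β * q.1⁻¹) (S.map q.1.toEmbedding) ((q.1, q.1) * p) l'
  have h : K.g q * K.g (1, β) = K.g (1, q.2 * β * q.1⁻¹) * K.g (q.1, q.1) := by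
    rw [← map_mul, ← map_mul]; congr 1; ext <;> simp
  rw [mon, map_mul, ← mul_assoc (_ * _) (K.g (q.1, q.1)), mul_assoc (K.g (1, q.2 * β * q.1⁻¹)), 
     ← g_eS K (q.1, q.1) q.1 S (fun _ _ => ⟨rfl, rfl⟩), ← mul_assoc (K.g (1, q.2 * β * q.1⁻¹)), ← h] at this
  rw [mon, ← mul_assoc, ← mul_assoc, g_wd]; simpa only [mul_assoc] using this
theorem WW_wd (l) {m : A} (hm : m ∈ WW K R) : m * wd K l ∈ WW K R := by
  induction l generalizing m with
  | nil => simpa [wd] using hm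
  | cons x l ih => rw [wd_cons, ← mul_assoc]; exact ih (WW_c K x hm)

theorem PM.mem {a b : A} (h : PM a b) {W : Submodule R A} (hb : b ∈ W) : a ∈ W := by
  rcases h with rfl | rfl
  · exact hb
  · exact neg_mem hb

theorem e_base1 (i m : ι) (S : Finset ι) (z : A) (hz : z = 1 ∨ z = K.c (Sum.inl i)) :
    K.e i * K.g (1, Equiv.swap i m) * z * eS K S ∈ WW K R := by
  have gc : K.g (1, Equiv.swap i m) * K.c (Sum.inl i) = K.c (Sum.inl i) * K.g (1, Equiv.swap i m) := by
    rw [K.g_c]; simp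
  by_cases hi : i ∈ S
  · by_cases hm : m = i
    · subst hm
      rw [Equiv.swap_self, show K.g (1, Equiv.refl ι) = 1 from map_one K.g, mul_one, eS_mem K hi, ← mul_assoc]
      rcases hz with rfl | rfl
      · rw [mul_one, K.e_sq, zero_mul]; exact zero_mem _
      · rw [K.e_c_e, zero_mul]; exact zero_mem _
    · have h := K.e_sb i m (Ne.symm hm)
      rcases hz with rfl | rfl
      · rw [mul_one, eS_mem K hi, ← mul_assoc, h, ← eS_mem K hi]; exact WW_eS K S
      · have g2 : K.g (1, Equiv.swap i m) * K.c (Sum.inr i) = K.c (Sum.inr m) * K.g (1, Equiv.swap i m) := by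
          rw [K.g_c]; simp
        have : K.e i * K.g (1, Equiv.swap i m) * K.c (Sum.inl i) * eS K S = K.c (Sum.inr m) * eS K S := by
          rw [eS_mem K hi, ← mul_assoc, mul_assoc _ _ (K.e i), K.c_e, ← mul_assoc, mul_assoc (K.e i), g2, ← mul_assoc,
            ← K.c_e_comm _ _ (by simp) (by simpa using hm), mul_assoc (K.c _) (K.e i), mul_assoc (K.c _), h, mul_assoc]
        rw [this]; exact c_WW K _ (WW_eS K S)
  · have zc : z * eS K S = eS K S * z := by
      rcases hz with rfl | rfl
      · simp
      · exact c_eS K fun j hj => ⟨by simp; rintro rfl; exact hi hj, by simp⟩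
    rw [mul_assoc, zc, ← mul_assoc]
    have key : K.e i * K.g (1, Equiv.swap i m) * eS K S ∈ WW K R := by
      by_cases hm : m ∈ S
      · have him : m ≠ i := by rintro rfl; exact hi hm
        have h1 : K.e i * K.g (1, Equiv.swap i m) * K.e m = K.g (Equiv.swap i m, Equiv.swap i m) * K.e m := by
          have a := K.g_e (Equiv.swap i m, Equiv.swap i m) m i (by simp) (by simp)
          have b : K.g (1, Equiv.swap i m) = K.g (Equiv.swap i m, Equiv.swap i m) * K.g (Equiv.swap m i, 1) := by
            rw [← map_mul]; congr 1; ext <;> simp [Equiv.swap_comm i m]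
          rw [b, ← mul_assoc, ← a, mul_assoc _ (K.e m), mul_assoc, K.e_s m i him]
        rw [eS_mem K hm, ← mul_assoc, h1, mul_assoc, ← eS_mem K hm]
        exact g_WW K _ (WW_eS K S)
      · have : Commute (K.g (1, Equiv.swap i m)) (eS K S) := by
          refine g_eS_fix K _ _ fun j hj => ⟨rfl, ?_⟩
          refine Equiv.swap_apply_of_ne_of_ne ?_ ?_ <;> rintro rfl
          · exact hi hj
          · exact hm hj
        rw [mul_assoc, this.eq, ← mul_assoc, ← eS_insert K hi]
        exact WW_g K _ (WW_eS K _)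
    rcases hz with rfl | rfl
    · rwa [mul_one]
    · exact WW_c K _ key

theorem e_base2 (i : ι) (β : Equiv.Perm ι) (S : Finset ι) (z : A) (hz : z = 1 ∨ z = K.c (Sum.inl i)) :
    K.e i * z * (K.g (1, β) * eS K S) ∈ WW K R := by
  have gc : z * K.g (1, β) = K.g (1, β) * z := by
    rcases hz with rfl | rfl
    · simp
    · rw [K.g_c]; simp
  have a := K.g_e (1, β * Equiv.swap i (β⁻¹ i)) i i rfl (by simp)
  have b : K.g (1, β) = K.g (1, β * Equiv.swap i (β⁻¹ i)) * K.g (1, Equiv.swap i (β⁻¹ i)) := by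
    rw [← map_mul]; congr 1; ext <;> simp
  have : K.e i * z * (K.g (1, β) * eS K S) = K.g (1, β * Equiv.swap i (β⁻¹ i)) * (K.e i * K.g (1, Equiv.swap i (β⁻¹ i)) * z * eS K S) := by
    rw [← mul_assoc, mul_assoc (K.e i), gc, b]
    simp only [← mul_assoc]; rw [a]
  rw [this]
  exact g_WW K _ (e_base1 K i _ S z hz)

theorem e_base3 (i : ι) (l : List (ι ⊕ ι)) (β : Equiv.Perm ι) (S : Finset ι) (z : A) (hz : z = 1 ∨ z = K.c (Sum.inl i)) :
    K.e i * z * wd K l * (K.g (1, β) * eS K S) ∈ WW K R := by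
  induction l generalizing z with
  | nil => rw [wd_nil, mul_one]; exact e_base2 K i β S z hz
  | cons x l ih =>
    rw [wd_cons]
    have sq := K.c_sq (Sum.inl i)
    by_cases h1 : x = Sum.inl i
    · subst h1
      rcases hz with rfl | rfl
      · have := ih _ (Or.inr rfl)
        rw [mul_one]; simpa only [mul_assoc] using this
      · have := ih 1 (Or.inl rfl)
        rw [mul_one] at this
        refine PM.mem (b := K.e i * wd K l * (K.g (1, β) * eS K S)) ?_ this
        refine PM.mul_right ?_ _
        rw [← mul_assoc, mul_assoc (K.e i)]
        refine PM.mul_right ?_ _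
        rcases sq with h | h <;> rw [h]
        · left; simp
        · right; simp
    by_cases h2 : x = Sum.inr i
    · subst h2
      rcases hz with rfl | rfl
      · have := ih _ (Or.inr rfl)
        rw [mul_one, ← mul_assoc (K.e i), ← K.e_c]; exact this
      · have := ih 1 (Or.inl rfl)
        rw [mul_one] at this
        refine PM.mem (b := K.e i * wd K l * (K.g (1, β) * eS K S)) ?_ this
        refine PM.mul_right ?_ _
        rw [← mul_assoc, mul_assoc (K.e i), K.c_anti _ _ (by simp), mul_neg, ← mul_assoc, ← K.e_c, mul_assoc (K.e i)]
        refine PM.mul_right ?_ _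
        rcases sq with h | h <;> rw [h]
        · right; simp
        · left; simp
    have hp : PM (z * K.c x) (K.c x * z) := by
      rcases hz with rfl | rfl
      · left; simp
      · right; rw [K.c_anti _ _ h1]; simp
    have := c_WW K x (ih z hz)
    refine PM.mem ?_ this
    have e1 : K.e i * z * (K.c x * wd K l) * (K.g (1, β) * eS K S) = K.e i * (z * K.c x) * wd K l * (K.g (1, β) * eS K S) := by
      simp only [mul_assoc]
    have e2 : K.c x * (K.e i * z * wd K l * (K.g (1, β) * eS K S)) = K.e i * (K.c x * z) * wd K l * (K.g (1, β) * eS K S) := by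
      rw [← mul_assoc (K.e i) (K.c x), ← K.c_e_comm _ _ h1 h2]; simp only [mul_assoc]
    rw [e1, e2]
    exact ((hp.mul_left _).mul_right _).mul_right _

theorem e_WW (i) {m : A} (hm : m ∈ WW K R) : K.e i * m ∈ WW K R := by
  refine WW_l K ?_ hm
  rintro _ ⟨l, β, S, p, l', rfl⟩
  have := WW_wd K l' (WW_g K p (e_base3 (R := R) K i l β S 1 (Or.inl rfl)))
  rw [mul_one] at this
  rw [mon]; simpa only [mul_assoc] using this

theorem adjoin_WW (s : Set A) (hs : ∀ x ∈ s, (∃ i, x = K.e i) ∨ (∃ p, x = K.g p) ∨ (∃ y, x = K.c y)) {x : A}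
    (hx : x ∈ Algebra.adjoin R s) : x ∈ WW K R := by
  have : ∀ m ∈ WW K R, x * m ∈ WW K R := by
    induction hx using Algebra.adjoin_induction with
    | mem x hx =>
      intro m hm
      rcases hs x hx with ⟨i, rfl⟩ | ⟨p, rfl⟩ | ⟨y, rfl⟩
      · exact e_WW K i hm
      · exact g_WW K p hm
      · exact c_WW K y hm
    | algebraMap a => intro m hm; rw [← Algebra.smul_def]; exact Submodule.smul_mem _ _ hm
    | add x y _ _ hx hy => intro m hm; rw [add_mul]; exact add_mem (hx m hm) (hy m hm)
    | mul x y _ _ hx hy => intro m hm; rw [mul_assoc]; exact hx _ (hy m hm)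
  have := this 1 (WW_one K)
  rwa [mul_one] at this
end KP

namespace KP
variable {A : Type} [Ring A] {ι : Type} [DecidableEq ι] (K : KD A ι)

instance sumLawful {α β : Type} [DecidableEq α] [DecidableEq β] : LawfulBEq (α ⊕ β) where
  eq_of_beq := by
    rintro (a | a) (b | b) h
    · exact congrArg _ (eq_of_beq (α := α) h)
    · exact absurd h (by intro h; cases h)
    · exact absurd h (by intro h; cases h)
    · exact congrArg _ (eq_of_beq (α := β) h)
  rfl := by
    rintro (a | a)
    · exact beq_self_eq_true (α := α) a
    · exact beq_self_eq_true (α := β) a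

theorem PM.one_mul' {a b : A} (h : PM a 1) : PM (a * b) b := by
  have := h.mul_right b
  rwa [one_mul] at this
theorem PM.mul_one' {a b : A} (h : PM a 1) : PM (b * a) b := by
  have := h.mul_left b
  rwa [mul_one] at this

theorem wd_perm {l l' : List (ι ⊕ ι)} (h : l.Perm l') : PM (wd K l) (wd K l') := by
  induction h with
  | nil => exact PM.refl _
  | cons x _ ih => rw [wd_cons, wd_cons]; exact ih.mul_left _
  | swap x y l =>
    rw [wd_cons, wd_cons, wd_cons, wd_cons, ← mul_assoc, ← mul_assoc]
    by_cases h : x = y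
    · subst h; exact PM.refl _
    · right; rw [K.c_anti x y h, neg_mul, neg_neg]
  | trans _ _ h1 h2 => exact h1.trans h2

theorem wd_even (n : ℕ) : ∀ l : List (ι ⊕ ι), l.length ≤ n → (∀ x, Even (l.count x)) → PM (wd K l) 1 := by
  induction n with
  | zero => intro l hl _; rw [List.length_eq_zero_iff.1 (Nat.le_zero.1 hl)]; exact PM.refl _
  | succ n ih =>
    intro l hl he
    rcases l with _ | ⟨x, l⟩
    · exact PM.refl _
    have hx : x ∈ l := by
      have := he x
      rw [List.count_cons_self] at this
      by_contra h
      rw [List.count_eq_zero.2 h] at this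
      exact absurd this (by decide)
    have h1 := wd_perm K ((List.perm_cons_erase hx).cons x)
    refine h1.trans ?_
    rw [wd_cons, wd_cons, ← mul_assoc]
    have h2 : PM (K.c x * K.c x) 1 := K.c_sq x
    refine h2.one_mul'.trans (ih _ ?_ ?_)
    · have := List.length_erase_of_mem hx
      simp at hl; omega
    · intro y
      have h := (((List.perm_cons_erase hx).cons x).count_eq y).symm ▸ he y
      have h := he y
      rw [((List.perm_cons_erase hx).cons x).count_eq y, List.count_cons, List.count_cons] at h
      split_ifs at h
      · rw [add_assoc] at h
        exact (Nat.even_add.1 h).2 (by decide)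
      · simpa using h

/-- replace barred letters in `S` by unbarred ones -/
def tau (S : Finset ι) : ι ⊕ ι → ι ⊕ ι
  | Sum.inl i => Sum.inl i
  | Sum.inr i => if i ∈ S then Sum.inl i else Sum.inr i

theorem tau_l (S : Finset ι) (x) : K.c x * eS K S = K.c (tau S x) * eS K S := by
  rcases x with i | i
  · rfl
  · rw [tau]; split_ifs with h
    · rw [eS_mem K h, ← mul_assoc, ← mul_assoc, K.c_e]
    · rfl
theorem tau_r (S : Finset ι) (x) : eS K S * K.c x = eS K S * K.c (tau S x) := by
  rcases x with i | i
  · rfl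
  · rw [tau]; split_ifs with h
    · rw [eS_mem' K h, mul_assoc, mul_assoc, K.e_c]
    · rfl

theorem c_wd (x l) : PM (K.c x * wd K l) (wd K l * K.c x) := by
  have := wd_perm K (List.perm_append_comm (l₁ := [x]) (l₂ := l))
  rwa [wd_append, wd_append, wd_cons, wd_nil, mul_one] at this

theorem wd_tau_l (S : Finset ι) (l) : PM (wd K l * eS K S) (wd K (l.map (tau S)) * eS K S) := by
  induction l with
  | nil => exact PM.refl _
  | cons x l ih =>
    rw [List.map_cons, wd_cons, wd_cons]
    refine ((c_wd K x l).mul_right _).trans ?_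
    rw [mul_assoc, tau_l, ← mul_assoc]
    refine ((c_wd K _ l).symm.mul_right _).trans ?_
    rw [mul_assoc, mul_assoc]
    exact ih.mul_left _
theorem wd_tau_r (S : Finset ι) (l) : PM (eS K S * wd K l) (eS K S * wd K (l.map (tau S))) := by
  induction l with
  | nil => exact PM.refl _
  | cons x l ih =>
    rw [List.map_cons, wd_cons, wd_cons, ← mul_assoc, tau_r, mul_assoc]
    refine ((c_wd K _ l).mul_left _).trans ?_
    rw [← mul_assoc]
    refine (ih.mul_right _).trans ?_
    rw [mul_assoc]
    exact (c_wd K _ _).symm.mul_left _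

def inS (S : Finset ι) (x : ι ⊕ ι) : Bool := decide (∃ i ∈ S, x = Sum.inl i ∨ x = Sum.inr i)

theorem wd_split (S : Finset ι) (l : List (ι ⊕ ι)) (h : ∀ x, inS S x = true → Even (l.count x)) :
    PM (wd K l) (wd K (l.filter fun x => !inS S x)) := by
  have := wd_perm K (List.filter_append_perm (inS S) l).symm
  refine this.trans ?_
  rw [wd_append]
  refine PM.one_mul' (wd_even K _ _ le_rfl fun x => ?_)
  by_cases hx : inS S x = true
  · rw [List.count_filter hx]; exact h x hx
  · rw [List.count_eq_zero.2 (fun hh => hx (List.mem_filter.1 hh).2)]; exact Even.zero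

theorem wd_eS_comm (S : Finset ι) (l : List (ι ⊕ ι)) (h : ∀ x ∈ l, inS S x = false) : Commute (wd K l) (eS K S) := by
  induction l with
  | nil => exact Commute.one_left _
  | cons x l ih =>
    rw [wd_cons]
    refine Commute.mul_left (c_eS K fun i hi => ?_) (ih fun y hy => h y (List.mem_cons_of_mem _ hy))
    have := h x List.mem_cons_self
    simp only [inS, decide_eq_false_iff_not, not_exists, not_and, not_or] at this
    exact this i hi

theorem core (S : Finset ι) (L L' : List (ι ⊕ ι))
    (h1 : ∀ x, inS S x = true → Even ((L.map (tau S)).count x) ∧ Even ((L'.map (tau S)).count x))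
    (h2 : ∀ x, inS S x = false → Even ((L.map (tau S)).count x + (L'.map (tau S)).count x)) :
    PM (wd K L * eS K S * wd K L') (eS K S) := by
  refine ((wd_tau_l K S L).mul_right _).trans ?_
  rw [mul_assoc]
  refine ((wd_tau_r K S L').mul_left _).trans ?_
  refine ((wd_split K S _ fun x hx => (h1 x hx).1).mul_right _).trans ?_
  refine (((wd_split K S _ fun x hx => (h1 x hx).2).mul_left _).mul_left _).trans ?_
  rw [← mul_assoc, (wd_eS_comm K S _ _).eq, mul_assoc, ← wd_append]
  · refine PM.mul_one' (wd_even K _ _ le_rfl fun x => ?_)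
    rw [List.count_append]
    by_cases hx : inS S x = true
    · rw [List.count_eq_zero.2, List.count_eq_zero.2]
      · exact Even.zero
      · intro hh; have := (List.mem_filter.1 hh).2; simp [hx] at this
      · intro hh; have := (List.mem_filter.1 hh).2; simp [hx] at this
    · have hx' : inS S x = false := by simpa using hx
      rw [List.count_filter (by simp [hx']), List.count_filter (by simp [hx'])]
      exact h2 x hx'
  · intro x hx
    have := (List.mem_filter.1 hx).2; simpa using this

theorem eS_red [Fintype ι] (S : Finset ι) (w : Equiv.Perm ι) (h : ∀ i, i ∉ S → w i = i) : eS K S * K.g (w, w) = eS K S := by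
  let M : Submonoid (Equiv.Perm ι) :=
    { carrier := {w | eS K S * K.g (w, w) = eS K S}
      one_mem' := by
        show eS K S * K.g (1, 1) = eS K S
        rw [← Prod.one_eq_mk, map_one, mul_one]
      mul_mem' := by
        intro a b ha hb
        show eS K S * K.g (a * b, a * b) = eS K S
        rw [show (a * b, a * b) = (a, a) * (b, b) from rfl, map_mul, ← mul_assoc]
        rw [show eS K S * K.g (a, a) = eS K S from ha]; exact hb }
  refine WP.perm_gen (fun i => i ∈ S) M ?_ w h
  intro i j hi hj hij
  show eS K S * K.g (Equiv.swap i j, Equiv.swap i j) = eS K S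
  rw [eS_mem' K hi, eS_mem' K (Finset.mem_erase.2 ⟨hij.symm, hj⟩), mul_assoc, mul_assoc, ← mul_assoc (K.e j),
    K.e_comm j i, K.e_red i j hij, mul_assoc, K.e_comm i j]

theorem red [Fintype ι] (S : Finset ι) (β w v : Equiv.Perm ι) (hβ : ∀ i ∈ S, β i = i) (hw : ∀ i, i ∉ S → w i = i)
    (hv : v = w * β⁻¹) : K.g (1, β) * eS K S * K.g (w, v) = eS K S := by
  subst hv
  rw [(g_eS_fix K (1, β) S fun i hi => ⟨rfl, hβ i hi⟩).eq, mul_assoc, ← map_mul]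
  have : β * (w * β⁻¹) = w := by
    rw [← mul_assoc, mul_inv_eq_iff_eq_mul]
    ext i
    by_cases hi : i ∈ S
    · have : w i ∈ S := by
        by_contra h
        have h2 := hw _ h
        exact h (by rwa [w.injective h2])
      simp [hβ i hi, hβ _ this]
    · have : β i ∉ S := by
        intro h
        have h2 := hβ _ h
        exact hi (by rwa [β.injective h2] at h)
      simp [hw i hi, hw _ this]
  rw [show ((1 : Equiv.Perm ι), β) * (w, w * β⁻¹) = (w, w) by simp [this]]
  exact eS_red K S w hw

variable {R : Type} [CommRing R] [IsDomain R] [Algebra R A]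

theorem lin_zero (N : Set A) (x : A) (hx : x ∈ Submodule.span R N)
    (lam : ∀ n ∈ N, ∃ f : A →ₗ[R] R, f n ≠ 0 ∧ (∀ m ∈ N, f m ≠ 0 → PM m n) ∧ f x = 0) : x = 0 := by
  have key : ∀ (n : ℕ) (l : Finset A) (a : A → R), l.card ≤ n → (∀ m ∈ l, m ∈ N) → x = ∑ m ∈ l, a m • m → x = 0 := by
    intro n
    induction n with
    | zero => 
      intro l a hl _ hx
      rw [Finset.card_eq_zero.1 (Nat.le_zero.1 hl)] at hx
      simpa using hx
    | succ n ih =>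
      intro l a hl hN hx
      rcases l.eq_empty_or_nonempty with rfl | ⟨m, hm⟩
      · simpa using hx
      classical
      obtain ⟨f, f1, f2, f3⟩ := lam m (hN m hm)
      by_cases hneg : -m ∈ l ∧ -m ≠ m
      · refine ih (l.erase m) (fun z => if z = -m then a z - a m else a z) ?_ (fun z hz => hN z (Finset.mem_of_mem_erase hz)) ?_
        · rw [Finset.card_erase_of_mem hm]; omega
        · have h1 : -m ∈ l.erase m := Finset.mem_erase.2 ⟨hneg.2, hneg.1⟩
          rw [hx, ← Finset.add_sum_erase _ _ hm, ← Finset.add_sum_erase _ _ h1, ← Finset.add_sum_erase (a := -m) _ _ h1]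
          rw [Finset.sum_congr rfl (g := fun z => a z • z) (s₁ := (l.erase m).erase (-m)) (f := fun z => (if z = -m then a z - a m else a z) • z)]
          · simp [sub_smul]; abel
          · intro z hz; simp [(Finset.mem_erase.1 hz).1]
      · have h0 : a m = 0 := by
          have := f3
          rw [hx, map_sum, Finset.sum_eq_single_of_mem m hm] at this
          · rw [map_smul, smul_eq_mul] at this
            exact (mul_eq_zero.1 this).resolve_right f1
          · intro z hz hzm
            rw [map_smul, smul_eq_mul]
            by_contra h
            rcases f2 z (hN z hz) (right_ne_zero_of_mul h) with h' | h'
            · exact hzm h'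
            · subst h'; exact hneg ⟨hz, hzm⟩
        refine ih (l.erase m) a ?_ (fun z hz => hN z (Finset.mem_of_mem_erase hz)) ?_
        · rw [Finset.card_erase_of_mem hm]; omega
        · rw [hx, ← Finset.add_sum_erase _ _ hm, h0, zero_smul, zero_add]
  rw [Submodule.mem_span_iff_exists_finset_subset] at hx
  obtain ⟨a, l, hl, _, hx⟩ := hx
  exact key _ l a le_rfl (fun m hm => hl hm) hx.symm
end KP

namespace KP
variable {A : Type} [Ring A] {ι : Type} [DecidableEq ι] (K : KD A ι)

theorem wd_rev (l) : PM (wd K l * wd K l.reverse) 1 := by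
  induction l with
  | nil => left; simp [wd]
  | cons x l ih =>
    rw [List.reverse_cons, wd_append, wd_cons, wd_cons, wd_nil, mul_one,
      show K.c x * wd K l * (wd K l.reverse * K.c x) = K.c x * (wd K l * wd K l.reverse) * K.c x by simp only [mul_assoc]]
    refine ((ih.mul_left _).mul_right _).trans ?_
    rw [mul_one]
    exact K.c_sq x
theorem wd_rev' (l) : PM (wd K l.reverse * wd K l) 1 := by
  have := wd_rev K l.reverse
  rwa [List.reverse_reverse] at this

theorem g_inv_l (p) : K.g p⁻¹ * K.g p = 1 := by rw [← map_mul, inv_mul_cancel, map_one]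
theorem g_inv_r (p) : K.g p * K.g p⁻¹ = 1 := by rw [← map_mul, mul_inv_cancel, map_one]

theorem pm_sand {a b u v m n : A} (ha : PM (a * u) 1) (hb : PM (v * b) 1) (h : PM (u * m * v) (u * n * v)) : PM m n := by
  have e : ∀ z, PM (a * (u * z * v) * b) z := by
    intro z
    rw [show a * (u * z * v) * b = a * u * (z * (v * b)) by simp only [mul_assoc]]
    exact ha.one_mul'.trans hb.mul_one'
  exact (e m).symm.trans (((h.mul_left a).mul_right b).trans (e n))

theorem wd_g (l q) : wd K l * K.g q = K.g q * wd K (l.map (Sum.map (q⁻¹).1 (q⁻¹).2)) := by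
  rw [g_wd, List.map_map]
  congr 2
  conv_lhs => rw [← List.map_id l]
  refine List.map_congr_left fun x _ => ?_
  rcases x with x | x <;> simp

theorem mon_mul (l1 : List (ι ⊕ ι)) (γ : Equiv.Perm ι) (q : Equiv.Perm ι × Equiv.Perm ι) (l2 l β S p l') :
    K.g (1, γ) * wd K l1 * mon K l β S p l' * (wd K l2 * K.g q) =
      mon K ((l1 ++ l).map (Sum.map (1 : Equiv.Perm ι) γ)) (γ * β) S (p * q) ((l' ++ l2).map (Sum.map (q⁻¹).1 (q⁻¹).2)) := by
  have h1 := g_wd K (1, γ) (l1 ++ l)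
  have h2 := wd_g K (l' ++ l2) q
  have h3 : K.g (1, γ * β) = K.g (1, γ) * K.g (1, β) := by rw [← map_mul]; simp
  rw [mon, mon, h3, map_mul]
  calc _ = K.g (1, γ) * (wd K (l1 ++ l)) * (K.g (1, β) * eS K S * K.g p) * (wd K (l' ++ l2) * K.g q) := by
        simp only [wd_append, mul_assoc]
    _ = _ := by rw [h1, h2]; simp only [mul_assoc]

variable {R : Type} [CommRing R] [IsDomain R] [Algebra R A]

theorem inj (E : A) (hg : ∀ p, Commute (K.g p) E) (hc : ∀ x, Commute (K.c x) E)
    (hf : ∀ S, ∃ f : A →ₗ[R] R, f (eS K S * E) ≠ 0 ∧ ∀ L β S' p L', f (mon K L β S' p L' * E) ≠ 0 → PM (mon K L β S' p L') (eS K S))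
    (x : A) (hx : x ∈ WW K R) (h0 : x * E = 0) : x = 0 := by
  have hw : ∀ l, Commute (wd K l) E := by
    intro l
    induction l with
    | nil => exact Commute.one_left _
    | cons y l ih => rw [wd_cons]; exact (hc y).mul_left ih
  refine lin_zero (R := R) (NN K) x hx ?_
  rintro _ ⟨l, β, S, p, l', rfl⟩
  obtain ⟨f, f1, f2⟩ := hf S
  set u := K.g (1, β⁻¹) * wd K l.reverse with hu
  set v := wd K l'.reverse * K.g p⁻¹ with hv
  have vE : Commute v E := (hw _).mul_left (hg _)
  have hn : PM (u * mon K l β S p l' * v) (eS K S) := by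
    rw [hu, hv, mon, show K.g (1, β⁻¹) * wd K l.reverse * (wd K l * (K.g (1, β) * eS K S * K.g p) * wd K l') * (wd K l'.reverse * K.g p⁻¹)
      = (K.g (1, β⁻¹) * (wd K l.reverse * wd K l) * K.g (1, β)) * eS K S * (K.g p * (wd K l' * wd K l'.reverse) * K.g p⁻¹) by simp only [mul_assoc]]
    have e1 : PM (K.g (1, β⁻¹) * (wd K l.reverse * wd K l) * K.g (1, β)) 1 := by
      refine (((wd_rev' K l).mul_left _).mul_right _).trans ?_
      rw [mul_one]; left; exact g_inv_l K (1, β)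
    have e2 : PM (K.g p * (wd K l' * wd K l'.reverse) * K.g p⁻¹) 1 := by
      refine (((wd_rev K l').mul_left _).mul_right _).trans ?_
      rw [mul_one]; left; exact g_inv_r K p
    exact e2.mul_one'.trans e1.one_mul'
  refine ⟨f ∘ₗ LinearMap.mulRight R (v * E) ∘ₗ LinearMap.mulLeft R u, ?_, ?_, ?_⟩
  · simp only [LinearMap.comp_apply, LinearMap.mulRight_apply, LinearMap.mulLeft_apply]
    rw [← mul_assoc]
    rcases hn with h | h <;> rw [h]
    · exact f1
    · rw [neg_mul, map_neg]; exact neg_ne_zero.2 f1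
  · rintro _ ⟨l1, β1, S1, p1, l1', rfl⟩ h
    simp only [LinearMap.comp_apply, LinearMap.mulRight_apply, LinearMap.mulLeft_apply] at h
    rw [← mul_assoc, hu, hv, mon_mul] at h
    have := f2 _ _ _ _ _ h
    rw [← mon_mul] at this
    refine pm_sand (a := wd K l * K.g (1, β)) (u := u) (v := v) (b := K.g p * wd K l') ?_ ?_ (this.trans hn.symm)
    · rw [hu, show wd K l * K.g (1, β) * (K.g (1, β⁻¹) * wd K l.reverse) = wd K l * (K.g (1, β) * K.g (1, β⁻¹)) * wd K l.reverse by simp only [mul_assoc],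
        show K.g (1, β) * K.g (1, β⁻¹) = 1 from g_inv_r K (1, β), mul_one]
      exact wd_rev K l
    · rw [hv, show wd K l'.reverse * K.g p⁻¹ * (K.g p * wd K l') = wd K l'.reverse * (K.g p⁻¹ * K.g p) * wd K l' by simp only [mul_assoc],
        g_inv_l, mul_one]
      exact wd_rev' K l'
  · simp only [LinearMap.comp_apply, LinearMap.mulRight_apply, LinearMap.mulLeft_apply]
    rw [vE.eq, ← mul_assoc, mul_assoc u, h0, mul_zero, zero_mul, map_zero]
end KP

namespace KP
open WP
variable {R A : Type} [CommRing R] [Ring A] [Algebra R A] {r t : ℕ} (d : WBC R A r t) [NeZero r] [NeZero t]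
  {k : ℕ} (hr : k ≤ r) (ht : k ≤ t)

/-- the embedding of pairs of permutations -/
def vv : Equiv.Perm (Fin k) × Equiv.Perm (Fin k) →* Equiv.Perm (Fin r) × Equiv.Perm (Fin t) :=
  (ve hr).prodMap (ve ht)

def kd : KD A (Fin k) where
  g := (G d).comp (vv hr ht)
  c := Sum.elim (fun i => d.c (Fin.castLE hr i)) (fun i => d.cb (Fin.castLE ht i))
  e := fun i => F d (Fin.castLE hr i) (Fin.castLE ht i)
  c_sq := by
    rintro (i | i)
    · exact Or.inr (d.c_sq _)
    · exact Or.inl (d.cb_sq _)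
  c_anti := by
    rintro (i | i) (j | j) h
    · exact d.c_anti _ _ fun h' => h (by rw [Fin.castLE_injective hr h'])
    · exact d.anti_ccb _ _
    · show d.cb _ * d.c _ = - (d.c _ * d.cb _)
      rw [d.anti_ccb, neg_neg]
    · exact d.cb_anti _ _ fun h' => h (by rw [Fin.castLE_injective ht h'])
  g_c := by
    rintro p (i | i)
    · have := G_c d (vv hr ht p) (Fin.castLE hr i)
      rw [show (vv hr ht p).1 (Fin.castLE hr i) = Fin.castLE hr (p.1 i) from ve_cast hr p.1 i] at this
      exact this
    · have := G_cb d (vv hr ht p) (Fin.castLE ht i)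
      rw [show (vv hr ht p).2 (Fin.castLE ht i) = Fin.castLE ht (p.2 i) from ve_cast ht p.2 i] at this
      exact this
  g_e := by
    intro p i j h1 h2
    have := F1 d (vv hr ht p) (Fin.castLE hr i) (Fin.castLE ht i)
    rw [show (vv hr ht p).1 (Fin.castLE hr i) = Fin.castLE hr (p.1 i) from ve_cast hr p.1 i,
      show (vv hr ht p).2 (Fin.castLE ht i) = Fin.castLE ht (p.2 i) from ve_cast ht p.2 i, h1, h2] at this
    exact this
  e_c := fun i => F3 d _ _
  c_e := fun i => F3' d _ _
  c_e_comm := by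
    rintro (x | x) i h1 h2
    · exact F2 d (fun h' => h1 (by rw [Fin.castLE_injective hr h'])) _
    · exact F2b d (fun h' => h2 (by rw [Fin.castLE_injective ht h'])) _
  e_sq := fun i => F4 d _ _
  e_c_e := fun i => F4' d _ _
  e_s := by
    intro i j h
    show F d _ _ * G d (ve hr (Equiv.swap i j), ve ht 1) * _ = _
    rw [map_one, G1, ve_swap]
    exact F5 d (fun h' => h (Fin.castLE_injective hr h')) _
  e_sb := by
    intro i j h
    show F d _ _ * G d (ve hr 1, ve ht (Equiv.swap i j)) * _ = _
    rw [map_one, G2, ve_swap]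
    exact F5b d (fun h' => h (Fin.castLE_injective ht h')) _
  e_comm := by
    intro i j
    by_cases h : i = j
    · rw [h]
    · exact (F6 d (fun h' => h (Fin.castLE_injective hr h')) (fun h' => h (Fin.castLE_injective ht h'))).1
  e_red := by
    intro i j h
    show F d _ _ * F d _ _ * G d (ve hr (Equiv.swap i j), ve ht (Equiv.swap i j)) = _
    rw [ve_swap, ve_swap]
    exact (F6 d (fun h' => h (Fin.castLE_injective hr h')) (fun h' => h (Fin.castLE_injective ht h'))).2

theorem lower_WW (hr1 : k + 1 ≤ r) (ht1 : k + 1 ≤ t) [NeZero k] {x : A} (hx : x ∈ Algebra.adjoin R (d.lowerGens k)) : x ∈ WW (kd d hr ht) R := by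
  refine adjoin_WW (kd d hr ht) _ ?_ hx
  intro x hx
  rcases gens_cases d hr1 ht1 hx with h | ⟨u, v, h⟩ | h | h
  · left; refine ⟨0, ?_⟩
    rw [h, ← F00]; rfl
  · exact Or.inr (Or.inl ⟨(u, v), h⟩)
  · exact Or.inr (Or.inr ⟨Sum.inl 0, h⟩)
  · exact Or.inr (Or.inr ⟨Sum.inr 0, h⟩)
end KP

namespace KP
open WP
variable {R A : Type} [CommRing R] [Ring A] [Algebra R A] {r t : ℕ} (d : WBC R A r t)

/-- twist of the data by the parity automorphism -/
def pd : WBC R A r t where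
  σ := d.σ
  σb := d.σb
  c := fun i => -d.c i
  cb := fun i => -d.cb i
  e := d.e
  c_sq := by intro i; rw [neg_mul_neg]; exact d.c_sq i
  c_anti := by intro i j h; rw [neg_mul_neg, neg_mul_neg]; exact d.c_anti i j h
  c_conj := by intro w i; rw [mul_neg, neg_mul, d.c_conj]
  cb_sq := by intro i; rw [neg_mul_neg]; exact d.cb_sq i
  cb_anti := by intro i j h; rw [neg_mul_neg, neg_mul_neg]; exact d.cb_anti i j h
  cb_conj := by intro w i; rw [mul_neg, neg_mul, d.cb_conj]
  comm_σσb := d.comm_σσb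
  comm_σcb := by intro w i; rw [mul_neg, neg_mul, d.comm_σcb]
  comm_σbc := by intro w i; rw [mul_neg, neg_mul, d.comm_σbc]
  anti_ccb := by intro i j; rw [neg_mul_neg, neg_mul_neg]; exact d.anti_ccb i j
  e_c1 := by intro h1 h2; rw [mul_neg, mul_neg, d.e_c1 h1 h2]
  c1_e := by intro h1 h2; rw [neg_mul, neg_mul, d.c1_e h1 h2]
  e_sq := d.e_sq
  e_s_e := d.e_s_e
  e_sb_e := d.e_sb_e
  s_e_comm := d.s_e_comm
  sb_e_comm := d.sb_e_comm
  braid1 := d.braid1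
  braid2 := d.braid2
  c_e_comm := by intro i h; rw [mul_neg, neg_mul, d.c_e_comm i h]
  cb_e_comm := by intro i h; rw [mul_neg, neg_mul, d.cb_e_comm i h]
  e_c_e := by intro h; rw [mul_neg, neg_mul, d.e_c_e, neg_zero]
  e_cb_e := by intro h; rw [mul_neg, neg_mul, d.e_cb_e, neg_zero]

variable {φ : A →ₐ[R] A}

theorem p_cn (H : WBCHom d (pd d) φ) (i) : φ (d.cn i) = - d.cn i := by
  rw [WBC.cn]; split_ifs
  · exact H.map_c _
  · simp
theorem p_cbn (H : WBCHom d (pd d) φ) (i) : φ (d.cbn i) = - d.cbn i := by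
  rw [WBC.cbn]; split_ifs
  · exact H.map_cb _
  · simp
theorem p_s (H : WBCHom d (pd d) φ) (w) : φ (d.σ w) = d.σ w := H.map_σ w
theorem p_sb (H : WBCHom d (pd d) φ) (w) : φ (d.σb w) = d.σb w := H.map_σb w
theorem p_e (H : WBCHom d (pd d) φ) : φ d.e = d.e := H.map_e
theorem p_E (H : WBCHom d (pd d) φ) (i j) : φ (d.E i j) = d.E i j := by
  simp only [WBC.E, WBC.tr, WBC.trb, map_mul, p_s d H, p_sb d H, p_e d H]
theorem p_y (H : WBCHom d (pd d) φ) (i) : φ (d.y i) = d.y i := by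
  simp only [WBC.y, WBC.L, WBC.LL, WBC.Eb, WBC.tr, map_sub, map_add, map_sum, map_mul, p_E d H, p_cn d H, p_s d H, neg_mul, mul_neg, neg_neg]
theorem p_yb (H : WBCHom d (pd d) φ) (i) : φ (d.yb i) = d.yb i := by
  simp only [WBC.yb, WBC.Lb, WBC.LLb, WBC.Eb, WBC.trb, map_sub, map_add, map_sum, map_mul, p_E d H, p_cn d H, p_cbn d H, p_sb d H, neg_mul, mul_neg, neg_neg]

variable {k : ℕ}

theorem p_gen (H : WBCHom d (pd d) φ) {x : A} (hx : x ∈ d.lowerGens k) : φ x = x ∨ φ x = -x := by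
  rcases hx with ⟨_, rfl⟩ | ⟨j, h1, h2, rfl⟩ | ⟨j, h1, h2, rfl⟩ | ⟨_, rfl⟩ | ⟨_, rfl⟩
  · exact Or.inl (p_e d H)
  · exact Or.inl (p_s d H _)
  · exact Or.inl (p_sb d H _)
  · exact Or.inr (p_cn d H _)
  · exact Or.inr (p_cbn d H _)

theorem p_adj (H : WBCHom d (pd d) φ) {x : A} (hx : x ∈ Algebra.adjoin R (d.lowerGens k)) : φ x ∈ Algebra.adjoin R (d.lowerGens k) := by
  induction hx using Algebra.adjoin_induction with
  | mem x hx => 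
    rcases p_gen d H hx with h | h <;> rw [h]
    · exact Algebra.subset_adjoin hx
    · exact neg_mem (Algebra.subset_adjoin hx)
  | algebraMap a => rw [AlgHom.commutes]; exact Subalgebra.algebraMap_mem _ _
  | add x y _ _ hx hy => rw [map_add]; exact add_mem hx hy
  | mul x y _ _ hx hy => rw [map_mul]; exact mul_mem hx hy

theorem p_comm_gen (H : WBCHom d (pd d) φ) [NeZero r] [NeZero t] [NeZero k] (hr : k + 1 ≤ r) (ht : k + 1 ≤ t) {z : A}
    (hz : (∃ i : Fin r, k ≤ i.1 ∧ z = d.c i) ∨ (∃ i : Fin t, k ≤ i.1 ∧ z = d.cb i)) {x : A} (hx : x ∈ d.lowerGens k) :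
    z * x = φ x * z := by
  have k0 := NeZero.pos k
  rcases gens_cases d hr ht hx with h | ⟨u, v, h⟩ | h | h
  · subst h
    rw [p_e d H]
    rcases hz with ⟨i, hi, rfl⟩ | ⟨i, hi, rfl⟩
    · exact d.c_e_comm i (by omega)
    · exact d.cb_e_comm i (by omega)
  · have : φ x = x := by
      rw [h]; show φ (d.σ _ * d.σb _) = d.σ _ * d.σb _
      rw [map_mul, p_s d H, p_sb d H]
    rw [this, h]
    rcases hz with ⟨i, hi, rfl⟩ | ⟨i, hi, rfl⟩
    · rw [G_c]; simp only; rw [ve_ge _ _ _ hi]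
    · rw [G_cb]; simp only; rw [ve_ge _ _ _ hi]
  · have : φ x = -x := by rw [h]; exact H.map_c _
    rw [this, h, neg_mul]
    rcases hz with ⟨i, hi, rfl⟩ | ⟨i, hi, rfl⟩
    · refine d.c_anti _ _ ?_
      rintro rfl; simp at hi; omega
    · rw [d.anti_ccb, neg_neg]
  · have : φ x = -x := by rw [h]; exact H.map_cb _
    rw [this, h, neg_mul]
    rcases hz with ⟨i, hi, rfl⟩ | ⟨i, hi, rfl⟩
    · exact d.anti_ccb _ _
    · refine d.cb_anti _ _ ?_
      rintro rfl; simp at hi; omega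

theorem p_comm (H : WBCHom d (pd d) φ) [NeZero r] [NeZero t] [NeZero k] (hr : k + 1 ≤ r) (ht : k + 1 ≤ t) {z : A}
    (hz : (∃ i : Fin r, k ≤ i.1 ∧ z = d.c i) ∨ (∃ i : Fin t, k ≤ i.1 ∧ z = d.cb i)) {x : A} (hx : x ∈ Algebra.adjoin R (d.lowerGens k)) :
    z * x = φ x * z := by
  induction hx using Algebra.adjoin_induction with
  | mem x hx => exact p_comm_gen d H hr ht hz hx
  | algebraMap a => rw [AlgHom.commutes]; exact (Algebra.commutes a z).symm
  | add x y _ _ hx hy => rw [map_add, mul_add, add_mul, hx, hy]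
  | mul x y _ _ hx hy => rw [map_mul, ← mul_assoc, hx, mul_assoc, hy, mul_assoc]

theorem p_final (H : WBCHom d (pd d) φ) [NeZero r] [NeZero t] [NeZero k] (hr : k + 1 ≤ r) (ht : k + 1 ≤ t)
    (inj : ∀ x ∈ Algebra.adjoin R (d.lowerGens k), x * d.E (k+1) (k+1) = 0 → x = 0)
    {x : A} (hx : x ∈ Algebra.adjoin R (d.lowerGens k)) {W : A} (hW : W = x * d.E (k+1) (k+1)) (hφ : φ W = W) :
    (∀ l : ℕ, k + 1 ≤ l → l ≤ r → x * d.cn l = d.cn l * x) ∧ (∀ l : ℕ, k + 1 ≤ l → l ≤ t → x * d.cbn l = d.cbn l * x) := by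
  have h : φ x = x := by
    refine sub_eq_zero.1 (inj _ (sub_mem (p_adj d H hx) hx) ?_)
    rw [hW, map_mul, p_E d H] at hφ
    rw [sub_mul, hφ, sub_self]
  constructor
  · intro l h1 h2
    obtain ⟨l, rfl⟩ : ∃ m, l = m + 1 := ⟨l - 1, by omega⟩
    rw [cn_eq d (by omega : l < r), p_comm d H hr ht (Or.inl ⟨⟨l, by omega⟩, by simp; omega, rfl⟩) hx, h]
  · intro l h1 h2
    obtain ⟨l, rfl⟩ : ∃ m, l = m + 1 := ⟨l - 1, by omega⟩
    rw [cbn_eq d (by omega : l < t), p_comm d H hr ht (Or.inr ⟨⟨l, by omega⟩, by simp; omega, rfl⟩) hx, h]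
end KP

namespace KP
open WP QP XP
open scoped TensorProduct

section good
variable {R : Type} [CommRing R] {J : Type} [Fintype J] [DecidableEq J] {Λ : Type} [Fintype Λ] [DecidableEq Λ]
  {ι : Type} [DecidableEq ι] (V W : ι → J)

/-- label condition -/
def LC (T : Finset ι) (x y : J → Λ) : Prop :=
  (∀ i ∈ T, y (V i) = y (W i) ∧ x (V i) = x (W i)) ∧ (∀ p, (∀ i ∈ T, p ≠ V i ∧ p ≠ W i) → y p = x p)

structure Good (T : Finset ι) (a : Module.End R ((J → Λ) → R)) (b : Module.End R (Q R J)) : Prop where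
  lab1 : ∀ x y, LC V W T x y → a (Pi.single x 1) y = 1
  lab0 : ∀ x y, ¬ LC V W T x y → a (Pi.single x 1) y = 0
  dgc : ∀ α : J → R, (∀ i ∈ T, α (V i) * α (W i) = 1) → dg α * b = b * dg α
  dga : ∀ α : J → R, ∀ i ∈ T, α (V i) * α (W i) = 1 → (∀ j, j ≠ V i → j ≠ W i → α j = 1) → b * dg α = b
  ddv : ∀ p, (∀ i ∈ T, p ≠ V i ∧ p ≠ W i) → dd R p (b 1) = 0
  ev : eps R J (b 1) = 1

theorem good_empty : Good V W ∅ (1 : Module.End R ((J → Λ) → R)) (1 : Module.End R (Q R J)) where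
  lab1 := by
    intro x y h
    have : y = x := funext fun p => h.2 p (by simp)
    rw [this]; simp
  lab0 := by
    intro x y h
    have : y ≠ x := by rintro rfl; exact h ⟨by simp, fun _ _ => rfl⟩
    simp [this]
  dgc := by intros; simp
  dga := by simp
  ddv := by intro p _; exact dd_vac p
  ev := eps_one

theorem good_insert (hV : Function.Injective V) (hW : Function.Injective W) (hVW : ∀ i j, V i ≠ W j)
    {T : Finset ι} {a : Module.End R ((J → Λ) → R)} {b : Module.End R (Q R J)} (h : Good V W T a b) {i : ι} (hi : i ∉ T) :
    Good V W (insert i T) (eX R Λ (V i) (W i) * a) (eQ R (V i) (W i) * b) := by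
  have nV : ∀ j ∈ T, V i ≠ V j ∧ V i ≠ W j := fun j hj => ⟨fun e => hi (hV e ▸ hj), hVW _ _⟩
  have nW : ∀ j ∈ T, W i ≠ V j ∧ W i ≠ W j := fun j hj => ⟨fun e => hVW _ _ e.symm, fun e => hi (hW e ▸ hj)⟩
  have key : ∀ x y : J → Λ, ∀ z, LC V W T x (upd y (V i) (W i) z) → z = x (V i) ∧ z = x (W i) ∧
      (y (V i) = y (W i) → LC V W (insert i T) x y) := by
    intro x y z hz
    have h1 := hz.2 _ nV
    have h2 := hz.2 _ nW
    simp [upd] at h1 h2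
    refine ⟨h1, h2, fun hy => ⟨?_, ?_⟩⟩
    · intro j hj
      rcases Finset.mem_insert.1 hj with rfl | hj
      · exact ⟨hy, h1 ▸ h2⟩
      · have := hz.1 j hj
        rw [upd, upd, if_neg, if_neg] at this
        · exact this
        · rintro (e | e)
          · exact (nV j hj).2 e.symm
          · exact (nW j hj).2 e.symm
        · rintro (e | e)
          · exact (nV j hj).1 e.symm
          · exact (nW j hj).1 e.symm
    · intro p hp
      have := hz.2 p fun j hj => hp j (Finset.mem_insert_of_mem hj)
      have hp' := hp i (Finset.mem_insert_self _ _)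
      simpa [upd, hp'.1, hp'.2] using this
  have key2 : ∀ x y : J → Λ, LC V W (insert i T) x y → LC V W T x (upd y (V i) (W i) (x (V i))) := by
    intro x y hz
    have hii := hz.1 i (Finset.mem_insert_self _ _)
    refine ⟨?_, ?_⟩
    · intro j hj
      have := hz.1 j (Finset.mem_insert_of_mem hj)
      rw [upd, upd, if_neg, if_neg]
      · exact this
      · rintro (e | e)
        · exact (nV j hj).2 e.symm
        · exact (nW j hj).2 e.symm
      · rintro (e | e)
        · exact (nV j hj).1 e.symm
        · exact (nW j hj).1 e.symm
    · intro p hp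
      by_cases h1 : p = V i
      · simp [upd, h1]
      by_cases h2 : p = W i
      · simp [upd, h2, hii.2]
      simp only [upd, h1, h2, or_self, if_false]
      refine hz.2 p fun j hj => ?_
      rcases Finset.mem_insert.1 hj with rfl | hj
      · exact ⟨h1, h2⟩
      · exact hp j hj
  refine ⟨?_, ?_, ?_, ?_, ?_, ?_⟩
  · intro x y hx
    rw [Module.End.mul_apply, eX_apply, if_pos (hx.1 i (Finset.mem_insert_self _ _)).1,
      Finset.sum_eq_single (x (V i))]
    · exact h.lab1 _ _ (key2 x y hx)
    · intro z _ hz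
      exact h.lab0 _ _ fun hh => hz (key x y z hh).1
    · simp
  · intro x y hx
    rw [Module.End.mul_apply, eX_apply]
    split_ifs with hy
    · refine Finset.sum_eq_zero fun z _ => h.lab0 _ _ fun hh => hx ((key x y z hh).2.2 hy)
    · rfl
  · intro α hα
    rw [← mul_assoc, dg_eQ α (hα i (Finset.mem_insert_self _ _)), mul_assoc,
      h.dgc α fun j hj => hα j (Finset.mem_insert_of_mem hj), mul_assoc]
  · intro α j hj h1 h2
    rcases Finset.mem_insert.1 hj with rfl | hj
    · rw [mul_assoc, ← h.dgc α, ← mul_assoc, eQ_dg α h1 h2]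
      intro l hl
      rw [h2 _ (nV l hl).1.symm (nW l hl).1.symm, h2 _ (nV l hl).2.symm (nW l hl).2.symm, one_mul]
    · rw [mul_assoc, h.dga α j hj h1 h2]
  · intro p hp
    have hp' := hp i (Finset.mem_insert_self _ _)
    rw [← Module.End.mul_apply, ← mul_assoc, dd_eQ hp'.1 hp'.2, Module.End.mul_apply, Module.End.mul_apply,
      h.ddv p fun j hj => hp j (Finset.mem_insert_of_mem hj), map_zero]
  · rw [Module.End.mul_apply, eps_eQ _ _ _ (h.ddv _ nV), h.ev]
end good
end KP

namespace KP
open WP QP XP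
open scoped TensorProduct

section rho
variable {R A : Type} [CommRing R] [Ring A] [Algebra R A] {r t : ℕ} (d : WBC R A r t) [NeZero r] [NeZero t]
  {Λ : Type} [Fintype Λ] [DecidableEq Λ] {ρ : A →ₐ[R] TT R Λ r t}

theorem tm (a a' : Module.End R ((Fin r ⊕ Fin t → Λ) → R)) (b b' : Module.End R (Q R (Fin r ⊕ Fin t))) :
    ((a ⊗ₜ[R] b : TT R Λ r t)) * ((a' ⊗ₜ[R] b' : TT R Λ r t)) = (a * a') ⊗ₜ[R] (b * b') :=
  Algebra.TensorProduct.tmul_mul_tmul a a' b b'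

def jj (r t : ℕ) : Equiv.Perm (Fin r) × Equiv.Perm (Fin t) →* Equiv.Perm (Fin r ⊕ Fin t) := Equiv.Perm.sumCongrHom (Fin r) (Fin t)

theorem jj_eq (g) : jj r t g = il r t g.1 * ir r t g.2 := by
  ext x; rcases x with x | x <;> rfl

theorem rho_G (H : WBCHom d (dT R Λ r t) ρ) (g) : ρ (G d g) = PP R _ Λ (jj r t g) ⊗ₜ[R] th R (jj r t g) := by
  show ρ (d.σ g.1 * d.σb g.2) = _
  rw [map_mul, H.map_σ, H.map_σb, jj_eq, map_mul, map_mul]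
  exact tm _ _ _ _

theorem rho_F (H : WBCHom d (dT R Λ r t) ρ) (i j) : ρ (F d i j) = eX R Λ (Sum.inl i) (Sum.inr j) ⊗ₜ[R] eQ R (Sum.inl i) (Sum.inr j) := by
  have h : ∀ g, ρ (G d g * d.e) = ρ (F d (g.1 0) (g.2 0) * G d g) := by
    intro g; rw [← F00, F1]
  rw [F, map_mul, map_mul, rho_G d H, rho_G d H, H.map_e]
  set g := (Equiv.swap 0 i, Equiv.swap 0 j)
  have e1 := PP_eX (R := R) (Λ := Λ) (jj r t g) (Sum.inl 0) (Sum.inr 0)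
  have e2 := eQ_th (R := R) (jj r t g) (Sum.inl 0) (Sum.inr 0)
  have a1 : jj r t g (Sum.inl 0) = Sum.inl i := congrArg Sum.inl (Equiv.swap_apply_left 0 i)
  have a2 : jj r t g (Sum.inr 0) = Sum.inr j := congrArg Sum.inr (Equiv.swap_apply_left 0 j)
  rw [a1, a2] at e1 e2
  show _ * (eX R Λ (Sum.inl 0) (Sum.inr 0) ⊗ₜ[R] eQ R (Sum.inl 0) (Sum.inr 0)) * _ = _
  rw [tm, tm, e1, e2, mul_assoc, mul_assoc, ← map_mul (PP R _ Λ), ← map_mul (th R), ← map_mul, mul_inv_cancel, map_one, map_one, map_one, mul_one, mul_one]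


theorem rho_eS (H : WBCHom d (dT R Λ r t) ρ) {n : ℕ} (hr : n ≤ r) (ht : n ≤ t) (T : Finset (Fin n)) : ∃ a b, ρ (eS (kd d hr ht) T) = a ⊗ₜ[R] b ∧
    Good (R := R) (Λ := Λ) (fun i : Fin n => (Sum.inl (Fin.castLE hr i) : Fin r ⊕ Fin t)) (fun i => Sum.inr (Fin.castLE ht i)) T a b := by
  induction T using Finset.induction_on with
  | empty => exact ⟨1, 1, by rw [eS_empty, map_one]; rfl, good_empty _ _⟩
  | insert i T hi ih =>
    obtain ⟨a, b, h1, h2⟩ := ih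
    refine ⟨_, _, ?_, good_insert _ _ ?_ ?_ ?_ h2 hi⟩
    · rw [eS_insert _ hi, map_mul, h1, ← tm]
      congr 1
      exact rho_F d H _ _
    · intro a b h; exact Fin.castLE_injective hr (Sum.inl_injective h)
    · intro a b h; exact Fin.castLE_injective ht (Sum.inr_injective h)
    · intro i j h; cases h

theorem rho_wd (H : WBCHom d (dT R Λ r t) ρ) {n : ℕ} (hr : n ≤ r) (ht : n ≤ t) (l : List (Fin n ⊕ Fin n)) : ∃ b, ρ (wd (kd d hr ht) l) = 1 ⊗ₜ[R] b ∧
    ∀ α : Fin r ⊕ Fin t → R, (∀ j, α j * α j = 1) →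
      dg α * b = (l.map fun x => α (Sum.map (Fin.castLE hr) (Fin.castLE ht) x)).prod • (b * dg α) := by
  induction l with
  | nil => exact ⟨1, by rw [wd_nil, map_one]; rfl, fun α _ => by simp⟩
  | cons x l ih =>
    obtain ⟨b, h1, h2⟩ := ih
    have hx : ∃ b', ρ ((kd d hr ht).c x) = 1 ⊗ₜ[R] b' ∧ ∀ α : Fin r ⊕ Fin t → R, (∀ j, α j * α j = 1) →
        dg α * b' = α (Sum.map (Fin.castLE hr) (Fin.castLE ht) x) • (b' * dg α) := by
      rcases x with x | x
      · exact ⟨_, H.map_c _, fun α hα => dg_c hα _⟩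
      · exact ⟨_, H.map_cb _, fun α hα => dg_cb hα _⟩
    obtain ⟨b', h3, h4⟩ := hx
    refine ⟨b' * b, ?_, ?_⟩
    · rw [wd_cons, map_mul, h3, h1, tm, one_mul]
    · intro α hα
      rw [List.map_cons, List.prod_cons, ← mul_assoc, h4 α hα, smul_mul_assoc, mul_assoc, h2 α hα, mul_smul_comm, smul_smul, ← mul_assoc]
end rho

section misc
variable {R A : Type} [CommRing R] [Ring A] [Algebra R A] {r t : ℕ} (d : WBC R A r t) [NeZero r] [NeZero t]
  {k : ℕ} (hr : k + 1 ≤ r) (ht : k + 1 ≤ t) (hr' : k ≤ r) (ht' : k ≤ t)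

/-- the set of all contracted positions -/
def TS (S : Finset (Fin k)) : Finset (Fin (k+1)) := insert (Fin.last k) (S.map Fin.castSuccEmb)

theorem mem_TS {S : Finset (Fin k)} {j} : j ∈ TS S ↔ j = Fin.last k ∨ ∃ i ∈ S, j = Fin.castSucc i := by
  simp [TS, eq_comm]

theorem eS_E (S : Finset (Fin k)) : eS (kd d hr' ht') S * F d ⟨k, hr⟩ ⟨k, ht⟩ = eS (kd d hr ht) (TS S) := by
  induction S using Finset.induction_on with
  | empty =>
    rw [TS, Finset.map_empty, eS_insert _ (by simp), eS_empty, eS_empty, one_mul, mul_one]; rfl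
  | insert i S hi ih =>
    have h1 : TS (insert i S) = insert (Fin.castSuccEmb i) (TS S) := by
      rw [TS, TS, Finset.map_insert, Finset.insert_comm]
    rw [eS_insert _ hi, mul_assoc, ih, h1, eS_insert]
    · rfl
    · intro h
      rcases Finset.mem_insert.1 h with h | h
      · exact absurd h (Fin.castSucc_lt_last i).ne
      · simp at h; exact hi h

theorem g_E (p) : Commute ((kd d hr' ht').g p) (F d ⟨k, hr⟩ ⟨k, ht⟩) := by
  have := F1 d (vv hr' ht' p) ⟨k, hr⟩ ⟨k, ht⟩
  rw [show (vv hr' ht' p).1 ⟨k, hr⟩ = ⟨k, hr⟩ from ve_k hr' p.1 hr,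
    show (vv hr' ht' p).2 ⟨k, ht⟩ = ⟨k, ht⟩ from ve_k ht' p.2 ht] at this
  exact this
theorem c_E (x) : Commute ((kd d hr' ht').c x) (F d ⟨k, hr⟩ ⟨k, ht⟩) := by
  rcases x with x | x
  · exact F2 d (kne hr x).symm _
  · exact F2b d (kne ht x).symm _
theorem wd_E (l) : Commute (wd (kd d hr' ht') l) (F d ⟨k, hr⟩ ⟨k, ht⟩) := by
  induction l with
  | nil => exact Commute.one_left _
  | cons y l ih => rw [wd_cons]; exact (c_E d hr ht hr' ht' y).mul_left ih
end misc
end KP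

namespace KP
open WP QP XP
open scoped TensorProduct

section comb
variable {ι : Type} [DecidableEq ι]

theorem comb (S S' : Finset ι) (β w v : Equiv.Perm ι)
    (h1 : ∀ i ∈ S', (if i ∈ S then Sum.inr i else Sum.inl i : ι ⊕ ι) = Sum.inr (β i) ∧
      (Sum.inl (w⁻¹ i) : ι ⊕ ι) = if v⁻¹ i ∈ S then Sum.inl (v⁻¹ i) else Sum.inr (v⁻¹ i))
    (h2 : ∀ i, i ∉ S' → (if i ∈ S then Sum.inr i else Sum.inl i : ι ⊕ ι) = Sum.inl (w⁻¹ i) ∧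
      (Sum.inr (β i) : ι ⊕ ι) = if v⁻¹ i ∈ S then Sum.inl (v⁻¹ i) else Sum.inr (v⁻¹ i)) :
    S' = S ∧ (∀ i ∈ S, β i = i) ∧ (∀ i, i ∉ S → w i = i) ∧ v = w * β⁻¹ := by
  have e : S' = S := by
    ext i
    by_cases h : i ∈ S'
    · have := (h1 i h).1
      split_ifs at this with h3
      simp [h, h3]
    · have := (h2 i h).1
      split_ifs at this with h3
      simp [h, h3]
  subst e
  have a1 : ∀ i ∈ S', β i = i := fun i hi => by
    have := (h1 i hi).1
    rw [if_pos hi] at this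
    exact (Sum.inr_injective this).symm
  have a2 : ∀ i, i ∉ S' → w⁻¹ i = i := fun i hi => by
    have := (h2 i hi).1
    rw [if_neg hi] at this
    exact (Sum.inl_injective this).symm
  refine ⟨rfl, a1, ?_, ?_⟩
  · intro i hi
    have := a2 i hi
    rw [Equiv.Perm.inv_eq_iff_eq] at this
    exact this.symm
  · have : v⁻¹ = β * w⁻¹ := by
      refine Equiv.ext fun i => ?_
      rw [Equiv.Perm.mul_apply]
      by_cases hi : i ∈ S'
      · have := (h1 i hi).2
        split_ifs at this with h3
        have h4 := Sum.inl_injective this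
        rw [h4, a1 _ h3]
      · have := (h2 i hi).2
        split_ifs at this with h3
        have h4 := Sum.inr_injective this
        rw [a2 i hi, h4]
    rw [← inv_inv v, this, mul_inv_rev, inv_inv]

variable {R : Type} [CommRing R] {J : Type}

/-- sign function attached to a letter -/
def al (R : Type) [CommRing R] (em : ι ⊕ ι → J) (S : Finset ι) (x0 : ι ⊕ ι) (j : J) : R :=
  open Classical in if ∃ x, em x = j ∧ tau S x = x0 then -1 else 1

theorem al_em {em : ι ⊕ ι → J} (he : Function.Injective em) (S : Finset ι) (x0 x : ι ⊕ ι) :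
    al R em S x0 (em x) = if tau S x = x0 then -1 else 1 := by
  rw [al]
  congr 1
  refine propext ⟨?_, fun h => ⟨x, rfl, h⟩⟩
  rintro ⟨y, h1, h2⟩
  rwa [← he h1]

theorem al_out {em : ι ⊕ ι → J} (S : Finset ι) (x0 : ι ⊕ ι) {j : J} (hj : ∀ x, em x = j → tau S x ≠ x0) :
    al R em S x0 j = 1 := by
  rw [al, if_neg]
  rintro ⟨y, h1, h2⟩
  exact hj y h1 h2

theorem al_sq (em : ι ⊕ ι → J) (S : Finset ι) (x0 : ι ⊕ ι) (j : J) : al R em S x0 j * al R em S x0 j = 1 := by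
  rw [al]; split_ifs <;> simp

theorem al_prod {em : ι ⊕ ι → J} (he : Function.Injective em) (S : Finset ι) (x0 : ι ⊕ ι) (L : List (ι ⊕ ι)) :
    (L.map fun x => al R em S x0 (em x)).prod = (-1) ^ ((L.map (tau S)).count x0) := by
  induction L with
  | nil => simp
  | cons y L ih =>
    rw [List.map_cons, List.prod_cons, ih, al_em he, List.map_cons, List.count_cons]
    by_cases h : tau S y = x0
    · simp [h, pow_succ]
    · simp [h]

theorem count_tau_inr (S : Finset ι) {i : ι} (hi : i ∈ S) (L : List (ι ⊕ ι)) : (L.map (tau S)).count (Sum.inr i) = 0 := by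
  rw [List.count_eq_zero]
  intro h
  obtain ⟨x, -, hx⟩ := List.mem_map.1 h
  rcases x with x | x
  · cases hx
  · rw [tau] at hx
    split_ifs at hx with h3
    cases hx; exact h3 hi

theorem ev_of [IsDomain R] (h2 : IsUnit (2 : R)) {n : ℕ} (h : (-1 : R) ^ n = 1) : Even n := by
  rcases Nat.even_or_odd n with h' | h'
  · exact h'
  · rw [h'.neg_one_pow] at h
    exfalso
    apply h2.ne_zero
    rw [← one_add_one_eq_two]
    nth_rw 1 [← h]
    simp
end comb

section par
variable {R : Type} [CommRing R] [IsDomain R] {J : Type} [Fintype J] [DecidableEq J]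

theorem par1 {α : J → R} {b bL bL' : Module.End R (Q R J)} {s s' : R}
    (h1 : dg α * bL = s • (bL * dg α)) (h2 : dg α * bL' = s' • (bL' * dg α)) (h3 : dg α * b = b * dg α)
    (h0 : eps R J ((bL * b * bL') 1) ≠ 0) : s * s' = 1 := by
  have : dg α * (bL * b * bL') = (s * s') • (bL * b * bL' * dg α) := by
    rw [← mul_assoc, ← mul_assoc, h1, smul_mul_assoc, mul_assoc bL, h3, smul_mul_assoc, ← mul_assoc, mul_assoc _ (dg α), h2, mul_smul_comm, smul_smul, ← mul_assoc]
  have h := congrArg (fun m : Module.End R (Q R J) => eps R J (m 1)) this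
  have e1 : eps R J ((dg α * (bL * b * bL')) 1) = eps R J ((bL * b * bL') 1) := eps_dg _ _
  have e2 : eps R J (((s * s') • (bL * b * bL' * dg α)) 1) = s * s' * eps R J ((bL * b * bL') 1) := by
    rw [LinearMap.smul_apply, map_smul, smul_eq_mul, Module.End.mul_apply _ (dg α), dg_vac]
  have h' := e1.symm.trans (h.trans e2)
  exact mul_right_cancel₀ h0 (by rw [one_mul]; exact h'.symm)

theorem par2 {α : J → R} {b bL bL' : Module.End R (Q R J)} {s' : R}
    (h2 : dg α * bL' = s' • (bL' * dg α)) (h3 : b * dg α = b)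
    (h0 : eps R J ((bL * b * bL') 1) ≠ 0) : s' = 1 := by
  have : bL * b * bL' = s' • (bL * b * bL' * dg α) := by
    nth_rw 1 [← h3]
    rw [← mul_assoc, mul_assoc _ (dg α), h2, mul_smul_comm, ← mul_assoc]
  have h := congrArg (fun m : Module.End R (Q R J) => eps R J (m 1)) this
  have e2 : eps R J ((s' • (bL * b * bL' * dg α)) 1) = s' * eps R J ((bL * b * bL') 1) := by
    rw [LinearMap.smul_apply, map_smul, smul_eq_mul, Module.End.mul_apply _ (dg α), dg_vac]
  have h' := h.trans e2
  exact mul_right_cancel₀ h0 (by rw [one_mul]; exact h'.symm)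
end par

section lab
variable {k : ℕ} [NeZero k]

def lab {n : ℕ} (P : Fin k → Fin k ⊕ Fin k) (p : Fin n) : Fin k ⊕ Fin k := if h : (p : ℕ) < k then P ⟨p, h⟩ else Sum.inl 0

theorem lab_cast {n : ℕ} (P) (h : k ≤ n) (i : Fin k) : lab P (Fin.castLE h i) = P i := by
  rw [lab, dif_pos (by simp)]; congr 1

theorem lab_ge {n : ℕ} (P) (p : Fin n) (h : k ≤ (p : ℕ)) : lab P p = (Sum.inl 0 : Fin k ⊕ Fin k) := by
  rw [lab, dif_neg (by omega)]

def lx (r t : ℕ) (S : Finset (Fin k)) : Fin r ⊕ Fin t → Fin k ⊕ Fin k :=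
  Sum.elim (lab Sum.inl) (lab fun i => if i ∈ S then Sum.inl i else Sum.inr i)
def ly (r t : ℕ) (S : Finset (Fin k)) : Fin r ⊕ Fin t → Fin k ⊕ Fin k :=
  Sum.elim (lab fun i => if i ∈ S then Sum.inr i else Sum.inl i) (lab Sum.inr)

variable {r t : ℕ} (hr : k + 1 ≤ r) (ht : k + 1 ≤ t) (hr' : k ≤ r) (ht' : k ≤ t)

theorem lx1 (S : Finset (Fin k)) (p) : lx r t S (Sum.inl p) = lab Sum.inl p := rfl
theorem lx2 (S : Finset (Fin k)) (p) : lx r t S (Sum.inr p) = lab (fun i => if i ∈ S then Sum.inl i else Sum.inr i) p := rfl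
theorem ly1 (S : Finset (Fin k)) (p) : ly r t S (Sum.inl p) = lab (fun i => if i ∈ S then Sum.inr i else Sum.inl i) p := rfl
theorem ly2 (S : Finset (Fin k)) (p) : ly r t S (Sum.inr p) = lab Sum.inr p := rfl

theorem LC_self (S : Finset (Fin k)) :
    LC (fun i : Fin (k+1) => (Sum.inl (Fin.castLE hr i) : Fin r ⊕ Fin t)) (fun i => Sum.inr (Fin.castLE ht i)) (TS S) (lx r t S) (ly r t S) := by
  constructor
  · intro j hj
    rcases mem_TS.1 hj with rfl | ⟨i, hi, rfl⟩
    · simp [lx, ly, lab_ge]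
    · have e1 := fun P : Fin k → Fin k ⊕ Fin k => lab_cast (n := r) P (Nat.le_of_succ_le hr) i
      have e2 := fun P : Fin k → Fin k ⊕ Fin k => lab_cast (n := t) P (Nat.le_of_succ_le ht) i
      constructor
      · refine (e1 fun i => if i ∈ S then Sum.inr i else Sum.inl i).trans (Eq.trans ?_ (e2 Sum.inr).symm)
        rw [if_pos hi]
      · refine (e1 Sum.inl).trans (Eq.trans ?_ (e2 fun i => if i ∈ S then Sum.inl i else Sum.inr i).symm)
        rw [if_pos hi]
  · rintro (p | p) hp
    · simp only [lx1, lx2, ly1, ly2, lab]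
      split_ifs with h1 h2
      · exact absurd rfl (hp (Fin.castSucc ⟨p, h1⟩) (mem_TS.2 (Or.inr ⟨_, h2, rfl⟩))).1
      · rfl
      · rfl
    · simp only [lx1, lx2, ly1, ly2, lab]
      split_ifs with h1 h2
      · exact absurd rfl (hp (Fin.castSucc ⟨p, h1⟩) (mem_TS.2 (Or.inr ⟨_, h2, rfl⟩))).2
      · rfl
      · rfl

theorem PP_single {R : Type} [CommRing R] {J Λ : Type} [Fintype J] [DecidableEq J] [Fintype Λ] [DecidableEq Λ] (w : Equiv.Perm J) (x : J → Λ) :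
    PP R J Λ w (Pi.single x 1) = Pi.single (fun j => x (w⁻¹ j)) 1 := by
  funext y
  rw [PP_apply, Pi.single_apply, Pi.single_apply]
  congr 1
  refine propext ⟨fun h => ?_, fun h => ?_⟩
  · rw [← h]; funext j; simp
  · rw [h]; funext j; simp

theorem LC_comb (S S' : Finset (Fin k)) (β w v : Equiv.Perm (Fin k))
    (h : LC (fun i : Fin (k+1) => (Sum.inl (Fin.castLE hr i) : Fin r ⊕ Fin t)) (fun i => Sum.inr (Fin.castLE ht i)) (TS S')
      (fun j => lx r t S ((jj r t (vv hr' ht' (w, v)))⁻¹ j)) (fun j => ly r t S (jj r t (vv hr' ht' (1, β)) j))) :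
    S' = S ∧ (∀ i ∈ S, β i = i) ∧ (∀ i, i ∉ S → w i = i) ∧ v = w * β⁻¹ := by
  have y1 : ∀ i : Fin k, ly r t S (jj r t (vv hr' ht' (1, β)) (Sum.inl (Fin.castLE hr' i))) = if i ∈ S then Sum.inr i else Sum.inl i := by
    intro i
    show lab (k := k) (fun i => if i ∈ S then Sum.inr i else Sum.inl i) (ve hr' 1 (Fin.castLE hr' i)) = _
    rw [ve_cast, lab_cast, Equiv.Perm.one_apply]
  have y2 : ∀ i : Fin k, ly r t S (jj r t (vv hr' ht' (1, β)) (Sum.inr (Fin.castLE ht' i))) = Sum.inr (β i) := by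
    intro i
    show lab (k := k) (Sum.inr) (ve ht' β (Fin.castLE ht' i)) = _
    rw [ve_cast, lab_cast]
  have x1 : ∀ i : Fin k, lx r t S ((jj r t (vv hr' ht' (w, v)))⁻¹ (Sum.inl (Fin.castLE hr' i))) = Sum.inl (w⁻¹ i) := by
    intro i
    rw [← map_inv, ← map_inv]
    show lab (k := k) (Sum.inl) (ve hr' w⁻¹ (Fin.castLE hr' i)) = _
    rw [ve_cast, lab_cast]
  have x2 : ∀ i : Fin k, lx r t S ((jj r t (vv hr' ht' (w, v)))⁻¹ (Sum.inr (Fin.castLE ht' i))) = if v⁻¹ i ∈ S then Sum.inl (v⁻¹ i) else Sum.inr (v⁻¹ i) := by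
    intro i
    rw [← map_inv, ← map_inv]
    show lab (k := k) (fun i => if i ∈ S then Sum.inl i else Sum.inr i) (ve ht' v⁻¹ (Fin.castLE ht' i)) = _
    rw [ve_cast, lab_cast]
  have nm : ∀ i : Fin k, i ∉ S' → ∀ j ∈ TS S', j ≠ Fin.castSucc i := by
    rintro i hi j hj rfl
    rcases mem_TS.1 hj with h | ⟨i', h1, h2⟩
    · exact absurd h (Fin.castSucc_lt_last i).ne
    · rw [Fin.castSucc_injective k h2] at hi; exact hi h1
  refine comb S S' β w v ?_ ?_
  · intro i hi
    obtain ⟨a, b⟩ := h.1 (Fin.castSucc i) (mem_TS.2 (Or.inr ⟨i, hi, rfl⟩))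
    rw [← y1, ← y2, ← x1, ← x2]
    exact ⟨a, b⟩
  · intro i hi
    have a := h.2 (Sum.inl (Fin.castLE hr' i)) (fun j hj => ⟨fun h' => nm i hi j hj
      (Fin.castLE_injective hr (Sum.inl_injective h').symm), by simp⟩)
    have b := h.2 (Sum.inr (Fin.castLE ht' i)) (fun j hj => ⟨by simp, fun h' => nm i hi j hj
      (Fin.castLE_injective ht (Sum.inr_injective h').symm)⟩)
    rw [← y1, ← y2, ← x1, ← x2]
    exact ⟨a, b⟩
end lab
end KP

namespace KP
open WP QP XP
open scoped TensorProduct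

section fin
variable {R A : Type} [CommRing R] [IsDomain R] [Ring A] [Algebra R A] {r t : ℕ} (d : WBC R A r t) [NeZero r] [NeZero t]
  {k : ℕ} [NeZero k] (hr : k + 1 ≤ r) (ht : k + 1 ≤ t) (hr' : k ≤ r) (ht' : k ≤ t)

/-- matrix coefficient functional -/
def ff {Λ : Type} [Fintype Λ] [DecidableEq Λ] (x y : Fin r ⊕ Fin t → Λ) : TT R Λ r t →ₗ[R] R :=
  (LinearMap.mul' R R).comp (TensorProduct.map
    ((LinearMap.proj y).comp (LinearMap.applyₗ (R := R) (Pi.single x (1 : R) : (Fin r ⊕ Fin t → Λ) → R)))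
    ((eps R (Fin r ⊕ Fin t)).comp (LinearMap.applyₗ (R := R) (1 : Q R (Fin r ⊕ Fin t)))))

theorem ff_tmul {Λ : Type} [Fintype Λ] [DecidableEq Λ] (x y : Fin r ⊕ Fin t → Λ) (a : Module.End R ((Fin r ⊕ Fin t → Λ) → R)) (b : Module.End R (Q R (Fin r ⊕ Fin t))) :
    ff (R := R) x y (a ⊗ₜ[R] b : TT R Λ r t) = a (Pi.single x 1) y * eps R _ (b 1) := rfl

theorem hf_main {ρ : A →ₐ[R] TT R (Fin k ⊕ Fin k) r t} (H : WBCHom d (dT R (Fin k ⊕ Fin k) r t) ρ) (h2 : IsUnit (2 : R)) (S : Finset (Fin k)) :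
    ∃ f : A →ₗ[R] R, f (eS (kd d hr' ht') S * F d ⟨k, hr⟩ ⟨k, ht⟩) ≠ 0 ∧ ∀ L β S' p L',
      f (mon (kd d hr' ht') L β S' p L' * F d ⟨k, hr⟩ ⟨k, ht⟩) ≠ 0 → PM (mon (kd d hr' ht') L β S' p L') (eS (kd d hr' ht') S) := by
  obtain ⟨a, b, hab, hg⟩ := rho_eS d H hr ht (TS S)
  refine ⟨(ff (lx r t S) (ly r t S)).comp ρ.toLinearMap, ?_, ?_⟩
  · rw [eS_E]
    show ff _ _ (ρ _) ≠ 0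
    rw [hab, ff_tmul, hg.lab1 _ _ (LC_self hr ht S), hg.ev, one_mul]
    exact one_ne_zero
  · intro L β S' p L' hne
    obtain ⟨w, v⟩ := p
    have hS : S' = S ∧ (∀ i ∈ S, β i = i) ∧ (∀ i, i ∉ S → w i = i) ∧ v = w * β⁻¹ := by
      by_contra hcon
      apply hne
      obtain ⟨a', b', hab', hg'⟩ := rho_eS d H hr ht (TS S')
      obtain ⟨bL, hL, -⟩ := rho_wd d H hr' ht' L
      obtain ⟨bL', hL', -⟩ := rho_wd d H hr' ht' L'
      have e1 : mon (kd d hr' ht') L β S' (w, v) L' * F d ⟨k, hr⟩ ⟨k, ht⟩ =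
          wd (kd d hr' ht') L * ((kd d hr' ht').g (1, β) * eS (kd d hr ht) (TS S') * (kd d hr' ht').g (w, v)) * wd (kd d hr' ht') L' := by
        rw [← eS_E d hr ht hr' ht', mon, mul_assoc, (wd_E d hr ht hr' ht' L').eq]
        simp only [mul_assoc]
        rw [(g_E d hr ht hr' ht' (w, v)).left_comm]
      show ff _ _ (ρ _) = 0
      rw [e1, map_mul ρ, map_mul ρ, map_mul ρ, map_mul ρ, hL, hL', hab']
      rw [show ρ ((kd d hr' ht').g (1, β)) = _ from rho_G d H (vv hr' ht' (1, β)), show ρ ((kd d hr' ht').g (w, v)) = _ from rho_G d H (vv hr' ht' (w, v))]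
      rw [tm, tm, tm, tm, ff_tmul, one_mul, mul_one]
      have z : (PP R _ (Fin k ⊕ Fin k) (jj r t (vv hr' ht' (1, β))) * a' * PP R _ (Fin k ⊕ Fin k) (jj r t (vv hr' ht' (w, v))) : Module.End R ((Fin r ⊕ Fin t → Fin k ⊕ Fin k) → R)) (Pi.single (lx r t S) 1) (ly r t S) = 0 := by
        rw [Module.End.mul_apply, Module.End.mul_apply, PP_single, PP_apply]
        exact hg'.lab0 _ _ fun hLC => hcon (LC_comb hr ht hr' ht' S S' β w v hLC)
      rw [z, zero_mul]
    obtain ⟨rfl, hβ, hw, hv⟩ := hS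
    have e2 : mon (kd d hr' ht') L β S' (w, v) L' = wd (kd d hr' ht') L * eS (kd d hr' ht') S' * wd (kd d hr' ht') L' := by
      rw [mon, red _ S' β w v hβ hw hv]
    rw [e2] at hne ⊢
    obtain ⟨bL, hL, cL⟩ := rho_wd d H hr' ht' L
    obtain ⟨bL', hL', cL'⟩ := rho_wd d H hr' ht' L'
    have e3 : wd (kd d hr' ht') L * eS (kd d hr' ht') S' * wd (kd d hr' ht') L' * F d ⟨k, hr⟩ ⟨k, ht⟩ =
        wd (kd d hr' ht') L * eS (kd d hr ht) (TS S') * wd (kd d hr' ht') L' := by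
      rw [← eS_E d hr ht hr' ht', mul_assoc, (wd_E d hr ht hr' ht' L').eq]
      simp only [mul_assoc]
    have h0 : eps R _ ((bL * b * bL') 1) ≠ 0 := by
      intro h0
      apply hne
      show ff _ _ (ρ _) = 0
      rw [e3, map_mul ρ, map_mul ρ, hL, hL', hab, tm, tm, ff_tmul, h0, mul_zero]
    set em : Fin k ⊕ Fin k → Fin r ⊕ Fin t := Sum.map (Fin.castLE hr') (Fin.castLE ht') with hem
    have he : Function.Injective em := Function.Injective.sumMap (Fin.castLE_injective hr') (Fin.castLE_injective ht')
    have pair : ∀ x0, ∀ j ∈ TS S', al R em S' x0 (Sum.inl (Fin.castLE hr j)) * al R em S' x0 (Sum.inr (Fin.castLE ht j)) = 1 := by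
      intro x0 j hj
      rcases mem_TS.1 hj with rfl | ⟨i, hi, rfl⟩
      · rw [al_out, al_out, one_mul]
        · rintro (x | x) hx
          · cases hx
          · exact absurd (congrArg Fin.val (Sum.inr_injective hx)) (by simpa using x.2.ne)
        · rintro (x | x) hx
          · exact absurd (congrArg Fin.val (Sum.inl_injective hx)) (by simpa using x.2.ne)
          · cases hx
      · have q1 := al_em (R := R) he S' x0 (Sum.inl i)
        have q2 := al_em (R := R) he S' x0 (Sum.inr i)
        rw [show em (Sum.inl i) = Sum.inl (Fin.castLE hr i.castSucc) from rfl] at q1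
        rw [show em (Sum.inr i) = Sum.inr (Fin.castLE ht i.castSucc) from rfl] at q2
        have q3 : tau S' (Sum.inr i) = tau S' (Sum.inl i) := by simp only [tau, if_pos hi]
        rw [q3] at q2
        rw [q1, q2]
        by_cases hq : tau S' (Sum.inl i) = x0
        · rw [if_pos hq, neg_mul_neg, one_mul]
        · rw [if_neg hq, one_mul]
    have tot : ∀ x0, Even ((L.map (tau S')).count x0 + (L'.map (tau S')).count x0) := by
      intro x0
      have := par1 (cL (al R em S' x0) (al_sq _ _ _)) (cL' (al R em S' x0) (al_sq _ _ _)) (hg.dgc _ (pair x0)) h0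
      rw [al_prod he, al_prod he, ← pow_add] at this
      exact ev_of h2 this
    have half : ∀ i ∈ S', Even ((L'.map (tau S')).count (Sum.inl i)) := by
      intro i hi
      have := par2 (cL' (al R em S' (Sum.inl i)) (al_sq _ _ _)) (hg.dga _ i.castSucc (mem_TS.2 (Or.inr ⟨i, hi, rfl⟩)) (pair _ _ (mem_TS.2 (Or.inr ⟨i, hi, rfl⟩))) ?_) h0
      · rw [al_prod he] at this
        exact ev_of h2 this
      · intro j hj1 hj2
        apply al_out
        rintro (x | x) hx hh
        · cases hh
          exact hj1 hx.symm
        · rw [tau] at hh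
          split_ifs at hh
          cases hh
          exact hj2 hx.symm
    refine core _ S' L L' ?_ fun x _ => tot x
    intro x hx
    have key : Even ((L'.map (tau S')).count x) := by
      simp only [inS, decide_eq_true_eq] at hx
      obtain ⟨i, hi, rfl | rfl⟩ := hx
      · exact half i hi
      · rw [count_tau_inr S' hi]; exact Even.zero
    exact ⟨(Nat.even_add.1 (tot x)).2 key, key⟩

theorem inj_main (hr : k + 1 ≤ r) (ht : k + 1 ≤ t) (hu : d.IsUniversal) (h2 : IsUnit (2 : R)) (x : A) (hx : x ∈ Algebra.adjoin R (d.lowerGens k))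
    (h0 : x * d.E (k+1) (k+1) = 0) : x = 0 := by
  have hr' : k ≤ r := Nat.le_of_succ_le hr
  have ht' : k ≤ t := Nat.le_of_succ_le ht
  obtain ⟨ρ, H, -⟩ := hu (TT R (Fin k ⊕ Fin k) r t) (dT R (Fin k ⊕ Fin k) r t)
  rw [E_eq d hr ht] at h0
  exact inj (R := R) (kd d hr' ht') _ (g_E d hr ht hr' ht') (c_E d hr ht hr' ht') (hf_main d hr ht hr' ht' H h2) x
    (lower_WW d hr' ht' hr ht hx) h0
end fin
end KP

theorem statement6 (R A : Type) [CommRing R] [IsDomain R] [Ring A] [Algebra R A]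
    (h2 : IsUnit (2 : R)) (r t : ℕ) (hr : 1 ≤ r) (ht : 1 ≤ t)
    (d : WBC R A r t) (hu : d.IsUniversal)
    (k a : ℕ) (hk : 1 ≤ k) (hkr : k + 1 ≤ r) (hkt : k + 1 ≤ t)
    (ω ωb : A)
    (hω : ω ∈ Algebra.adjoin R (d.lowerGens k) ∧
      d.E (k + 1) (k + 1) * d.y (k + 1) ^ a * d.E (k + 1) (k + 1) = ω * d.E (k + 1) (k + 1))
    (hωb : ωb ∈ Algebra.adjoin R (d.lowerGens k) ∧
      d.E (k + 1) (k + 1) * d.yb (k + 1) ^ a * d.E (k + 1) (k + 1)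
        = ωb * d.E (k + 1) (k + 1)) :
    (ω * d.y (k + 1) = d.y (k + 1) * ω) ∧ (ω * d.yb (k + 1) = d.yb (k + 1) * ω) ∧
    (∀ l : ℕ, k + 1 ≤ l → l ≤ r → ω * d.cn l = d.cn l * ω) ∧
    (∀ l : ℕ, k + 1 ≤ l → l ≤ t → ω * d.cbn l = d.cbn l * ω) ∧
    (ωb * d.y (k + 1) = d.y (k + 1) * ωb) ∧ (ωb * d.yb (k + 1) = d.yb (k + 1) * ωb) ∧
    (∀ l : ℕ, k + 1 ≤ l → l ≤ r → ωb * d.cn l = d.cn l * ωb) ∧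
    (∀ l : ℕ, k + 1 ≤ l → l ≤ t → ωb * d.cbn l = d.cbn l * ωb) := by
  haveI : NeZero r := ⟨by omega⟩
  haveI : NeZero t := ⟨by omega⟩
  haveI : NeZero k := ⟨by omega⟩
  obtain ⟨φ, H, -⟩ := hu A (KP.pd d)
  have p1 := KP.p_final d H hkr hkt (fun x hx => KP.inj_main d hkr hkt hu h2 x hx) hω.1 hω.2
    (by rw [map_mul, map_mul, map_pow, KP.p_E d H, KP.p_y d H])
  have p2 := KP.p_final d H hkr hkt (fun x hx => KP.inj_main d hkr hkt hu h2 x hx) hωb.1 hωb.2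
    (by rw [map_mul, map_mul, map_pow, KP.p_E d H, KP.p_yb d H])
  exact ⟨WP.adj_y d hkr hkt hω.1, WP.adj_yb d hkr hkt hω.1, p1.1, p1.2,
    WP.adj_y d hkr hkt hωb.1, WP.adj_yb d hkr hkt hωb.1, p2.1, p2.2⟩
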